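/- Boundary value problem (C), solvable variant, for 2D steady Euler: Let Ω = 𝕊¹ × (0,L), α ∈ (0,1), and suppose (v₀,p₀) ∈ C^{2,α}(Ω;ℝ²) × C^{2,α}(Ω) solves the steady Euler equations with v̄₀² := inf_{Ω̄} |v₀²| > 0 and curl v₀ = 0; set J₀ := ∫_𝒞 v₀·n dS. There exist ε > 0, M > 0 sufficiently small and K > 0 (depending only on α, L, v̄₀²) such that: if ‖v₀¹‖_{C^{2,α}(Ω)} ≤ ε and h⁻ ∈ C^{2,α}(∂Ω₋), h⁺ ∈ C^{2,α}(∂Ω₊), f⁻ ∈ C^{2,α}(∂Ω₋), J ∈ ℝ satisfy ‖h⁻‖_{C^{2,α}(∂Ω₋)} + ‖h⁺‖_{C^{2,α}(∂Ω₊)} + ‖f⁻‖_{C^{2,α}(∂Ω₋)} + |J − J₀| ≤ KM, then there exists a unique (v,p) ∈ C^{2,α}(Ω;ℝ²) × C^{2,α}(Ω) solving the steady Euler equations with ‖v − v₀‖_{C^{2,α}(Ω)} ≤ M, p = p₀ + h⁻ on ∂Ω₋, ∂ₓp = ∂ₓp₀ + ∂ₓh⁺ on ∂Ω₊, v·n =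 v₀·n + f⁻ on ∂Ω₋, and ∫_𝒞 v·n dS = J. -/

import Mathlib

open Set
open scoped ENNReal

noncomputable section

namespace EulerBVP

/-- The closed strip `Ω̄ = ℝ × [0, L]`, modelling `𝕊¹ × [0,L]`
(functions on it are required to be 1-periodic in the first variable). -/
def strip (L : ℝ) : Set (ℝ × ℝ) := Set.univ ×ˢ Set.Icc 0 L

/-- Uniform α-Hölder seminorm of `f` on `s`, valued in `ℝ≥0∞`. -/
def hSemi {E F : Type*} [NormedAddCommGroup E] [NormedAddCommGroup F]
    (a : ℝ) (s : Set E) (f : E → F) : ℝ≥0∞ :=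
  ⨆ x ∈ s, ⨆ y ∈ s, ENNReal.ofReal (‖f x - f y‖ / ‖x - y‖ ^ a)

/-- `C^{k,α}` norm of `f` on `s`: sup norms of the derivatives (within `s`) up to
order `k`, plus the `α`-Hölder seminorm of the order-`k` derivative. -/
def hNorm {E F : Type*} [NormedAddCommGroup E] [NormedSpace ℝ E]
    [NormedAddCommGroup F] [NormedSpace ℝ F]
    (k : ℕ) (a : ℝ) (s : Set E) (f : E → F) : ℝ≥0∞ :=
  (Finset.range (k + 1)).sum
      (fun i => ⨆ x ∈ s, (‖iteratedFDerivWithin ℝ i f s x‖₊ : ℝ≥0∞))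
    + hSemi a s (iteratedFDerivWithin ℝ k f s)

/-- Membership in the Hölder space `C^{k,α}(s)`. -/
def MemC {E F : Type*} [NormedAddCommGroup E] [NormedSpace ℝ E]
    [NormedAddCommGroup F] [NormedSpace ℝ F]
    (k : ℕ) (a : ℝ) (s : Set E) (f : E → F) : Prop :=
  ContDiffOn ℝ k f s ∧ hNorm k a s f < ⊤

/-- 1-periodicity in the first (circle) variable. -/
def PerX {F : Type*} (f : ℝ × ℝ → F) : Prop := ∀ x y, f (x + 1, y) = f (x, y)

/-- 1-periodicity for functions on the boundary circle. -/
def Per {F : Type*} (f : ℝ → F) : Prop := ∀ x, f (x + 1) = f x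

/-- Partial derivative in the first variable (within the strip). -/
def pdx (L : ℝ) (f : ℝ × ℝ → ℝ) (z : ℝ × ℝ) : ℝ := fderivWithin ℝ f (strip L) z (1, 0)

/-- Partial derivative in the second variable (within the strip). -/
def pdy (L : ℝ) (f : ℝ × ℝ → ℝ) (z : ℝ × ℝ) : ℝ := fderivWithin ℝ f (strip L) z (0, 1)

/-- First component of a planar vector field. -/
def c1 (v : ℝ × ℝ → ℝ × ℝ) : ℝ × ℝ → ℝ := fun z => (v z).1

/-- Second component of a planar vector field. -/
def c2 (v : ℝ × ℝ → ℝ × ℝ) : ℝ × ℝ → ℝ := fun z => (v z).2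

/-- Divergence `∂ₓ v¹ + ∂_y v²`. -/
def divF (L : ℝ) (v : ℝ × ℝ → ℝ × ℝ) (z : ℝ × ℝ) : ℝ := pdx L (c1 v) z + pdy L (c2 v) z

/-- Scalar curl `∂ₓ v² − ∂_y v¹`. -/
def curlF (L : ℝ) (v : ℝ × ℝ → ℝ × ℝ) (z : ℝ × ℝ) : ℝ := pdx L (c2 v) z - pdy L (c1 v) z

/-- Squared Euclidean length `|v|²` of a planar vector field. -/
def sq (v : ℝ × ℝ → ℝ × ℝ) (z : ℝ × ℝ) : ℝ := (v z).1 ^ 2 + (v z).2 ^ 2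

/-- The steady incompressible Euler equations `v·∇v = −∇p`, `div v = 0` on the strip. -/
def Euler (L : ℝ) (v : ℝ × ℝ → ℝ × ℝ) (p : ℝ × ℝ → ℝ) : Prop :=
  ∀ z ∈ strip L,
    ((v z).1 * pdx L (c1 v) z + (v z).2 * pdy L (c1 v) z = - pdx L p z) ∧
    ((v z).1 * pdx L (c2 v) z + (v z).2 * pdy L (c2 v) z = - pdy L p z) ∧
    divF L v z = 0

/-- The magnetohydrostatic equations `B × j = −∇p`, `j = curl B`, `div B = 0` on the strip;
in 2D, `B × j = (−B² j, B¹ j)`. -/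
def MHS (L : ℝ) (B : ℝ × ℝ → ℝ × ℝ) (p : ℝ × ℝ → ℝ) : Prop :=
  ∀ z ∈ strip L,
    (-(B z).2 * curlF L B z = - pdx L p z) ∧
    ((B z).1 * curlF L B z = - pdy L p z) ∧
    divF L B z = 0

/-- Flux across the segment `𝒞 = {0} × [0,L]`:  `∫_𝒞 w·n dS = −∫₀^L w¹(0,y) dy`. -/
def fluxC (L : ℝ) (w : ℝ × ℝ → ℝ × ℝ) : ℝ := - ∫ y in (0:ℝ)..L, (w (0, y)).1

/-- A velocity/pressure pair of class `C^{k,α}` on the strip, periodic in `x`. -/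
def VP (L : ℝ) (k : ℕ) (a : ℝ) (v : ℝ × ℝ → ℝ × ℝ) (p : ℝ × ℝ → ℝ) : Prop :=
  PerX v ∧ PerX p ∧ MemC k a (strip L) v ∧ MemC k a (strip L) p

/-- Boundary data of class `C^{k,α}(𝕊¹)`: a 1-periodic function in `C^{k,α}(ℝ)`. -/
def BData (k : ℕ) (a : ℝ) (f : ℝ → ℝ) : Prop := Per f ∧ MemC k a (Set.univ : Set ℝ) f

/-- Solution of the steady Euler equations with the (solvable variant of the) boundary
conditions of problem (C): `p = p₀ + h⁻` on `∂Ω₋`, `∂ₓp = ∂ₓp₀ + ∂ₓh⁺` on `∂Ω₊`,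
`v·n = v₀·n + f⁻` on `∂Ω₋`, flux `J`, within `C^{2,α}`-distance `M` of `v₀`. -/
def SolCmod (L a M : ℝ) (v₀ : ℝ × ℝ → ℝ × ℝ) (p₀ : ℝ × ℝ → ℝ) (hm hp fm : ℝ → ℝ) (J : ℝ)
    (v : ℝ × ℝ → ℝ × ℝ) (p : ℝ × ℝ → ℝ) : Prop :=
  VP L 2 a v p ∧ Euler L v p ∧
  hNorm 2 a (strip L) (fun z => v z - v₀ z) ≤ ENNReal.ofReal M ∧
  (∀ x, p (x, 0) = p₀ (x, 0) + hm x) ∧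
  (∀ x, deriv (fun t => p (t, L)) x = deriv (fun t => p₀ (t, L)) x + deriv hp x) ∧
  (∀ x, -(v (x, 0)).2 = -(v₀ (x, 0)).2 + fm x) ∧
  fluxC L v = J

/-- `f` is bounded by `N` on `s` and `a`-Hölder there with constant `N`. -/
def Hol {E F : Type*} [NormedAddCommGroup E] [NormedAddCommGroup F]
    (s : Set E) (a N : ℝ) (f : E → F) : Prop :=
  (∀ z ∈ s, ‖f z‖ ≤ N) ∧ ∀ z ∈ s, ∀ z' ∈ s, ‖f z - f z'‖ ≤ N * ‖z - z'‖ ^ a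

section Holder

variable {E F : Type*} [NormedAddCommGroup E] [NormedAddCommGroup F] {s : Set E} {a N M : ℝ}
  {f g : E → F}

theorem Hol.nonneg (h : Hol s a N f) (hs : s.Nonempty) : 0 ≤ N :=
  let ⟨z, hz⟩ := hs
  (norm_nonneg _).trans (h.1 z hz)

theorem Hol.mono (h : Hol s a N f) (hNM : N ≤ M) : Hol s a M f :=
  ⟨fun z hz => (h.1 z hz).trans hNM, fun z hz z' hz' =>
    (h.2 z hz z' hz').trans (by gcongr)⟩

theorem Hol.subset {t : Set E} (h : Hol s a N f) (ht : t ⊆ s) : Hol t a N f :=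
  ⟨fun z hz => h.1 z (ht hz), fun z hz z' hz' => h.2 z (ht hz) z' (ht hz')⟩

theorem Hol.congr (h : Hol s a N f) (hfg : ∀ z ∈ s, g z = f z) : Hol s a N g :=
  ⟨fun z hz => by rw [hfg z hz]; exact h.1 z hz,
    fun z hz z' hz' => by rw [hfg z hz, hfg z' hz']; exact h.2 z hz z' hz'⟩

theorem Hol.add (h : Hol s a N f) (h' : Hol s a M g) : Hol s a (N + M) (fun z => f z + g z) :=
  ⟨fun z hz => (norm_add_le _ _).trans (add_le_add (h.1 z hz) (h'.1 z hz)),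
    fun z hz z' hz' => by
      rw [show f z + g z - (f z' + g z') = (f z - f z') + (g z - g z') by abel, add_mul]
      exact (norm_add_le _ _).trans (add_le_add (h.2 z hz z' hz') (h'.2 z hz z' hz'))⟩

theorem Hol.neg (h : Hol s a N f) : Hol s a N (fun z => -f z) :=
  ⟨fun z hz => by rw [norm_neg]; exact h.1 z hz, fun z hz z' hz' => by
    rw [show -f z - -f z' = -(f z - f z') by abel, norm_neg]
    exact h.2 z hz z' hz'⟩

theorem Hol.sub (h : Hol s a N f) (h' : Hol s a M g) : Hol s a (N + M) (fun z => f z - g z) := by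
  simpa only [sub_eq_add_neg] using h.add h'.neg

theorem Hol.const (c : F) (hc : ‖c‖ ≤ N) : Hol s a N (fun _ => c) :=
  ⟨fun _ _ => hc, fun z _ z' _ => by
    rw [sub_self, norm_zero]
    exact mul_nonneg ((norm_nonneg _).trans hc) (Real.rpow_nonneg (norm_nonneg _) _)⟩

theorem Hol.mul {f g : E → ℝ} (h : Hol s a N f) (h' : Hol s a M g) :
    Hol s a (2 * N * M) (fun z => f z * g z) := by
  refine ⟨fun z hz => ?_, fun z hz z' hz' => ?_⟩
  · have hN := (norm_nonneg _).trans (h.1 z hz)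
    have hM := (norm_nonneg _).trans (h'.1 z hz)
    rw [norm_mul]
    have := mul_le_mul (h.1 z hz) (h'.1 z hz) (norm_nonneg _) hN
    nlinarith [mul_nonneg hN hM]
  · have hN := (norm_nonneg _).trans (h.1 z hz)
    have hM := (norm_nonneg _).trans (h'.1 z hz)
    have hr := Real.rpow_nonneg (norm_nonneg (z - z')) a
    rw [show f z * g z - f z' * g z' = f z * (g z - g z') + (f z - f z') * g z' by ring]
    refine (norm_add_le _ _).trans ?_
    rw [norm_mul, norm_mul]
    have h1 := mul_le_mul (h.1 z hz) (h'.2 z hz z' hz') (norm_nonneg _) hN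
    have h2 := mul_le_mul (h.2 z hz z' hz') (h'.1 z' hz') (norm_nonneg _) (mul_nonneg hN hr)
    nlinarith

theorem Hol.const_mul {f : E → ℝ} (h : Hol s a N f) (c : ℝ) :
    Hol s a (|c| * N) (fun z => c * f z) :=
  ⟨fun z hz => by
      rw [norm_mul, Real.norm_eq_abs c]
      exact mul_le_mul_of_nonneg_left (h.1 z hz) (abs_nonneg c),
    fun z hz z' hz' => by
      rw [← mul_sub, norm_mul, Real.norm_eq_abs c, mul_assoc]
      exact mul_le_mul_of_nonneg_left (h.2 z hz z' hz') (abs_nonneg c)⟩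

theorem Hol.of_lip (ha : 0 < a) (ha1 : a ≤ 1) (h : ∀ z ∈ s, ‖f z‖ ≤ N)
    (h' : ∀ z ∈ s, ∀ z' ∈ s, ‖f z - f z'‖ ≤ M * ‖z - z'‖) (hNM : 2 * N ≤ M) : Hol s a M f := by
  refine ⟨fun z hz => ?_, fun z hz z' hz' => ?_⟩
  · have := (norm_nonneg _).trans (h z hz)
    linarith [h z hz]
  · have hN := (norm_nonneg _).trans (h z hz)
    have hM : 0 ≤ M := by linarith
    rcases le_total ‖z - z'‖ 1 with h1 | h1
    · refine (h' z hz z' hz').trans (mul_le_mul_of_nonneg_left ?_ hM)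
      exact Real.self_le_rpow_of_le_one (norm_nonneg _) h1 ha1
    · calc ‖f z - f z'‖ ≤ ‖f z‖ + ‖f z'‖ := norm_sub_le _ _
        _ ≤ M * 1 := by linarith [h z hz, h z' hz']
        _ ≤ M * ‖z - z'‖ ^ a :=
          mul_le_mul_of_nonneg_left (Real.one_le_rpow h1 ha.le) hM

theorem Hol.comp_lip {E' : Type*} [NormedAddCommGroup E'] {t : Set E'} {p : E' → E} {K : ℝ}
    (h : Hol s a N f) (ha : 0 < a) (ha1 : a ≤ 1) (hp : ∀ z ∈ t, p z ∈ s) (hK : 1 ≤ K)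
    (hl : ∀ z ∈ t, ∀ z' ∈ t, ‖p z - p z'‖ ≤ K * ‖z - z'‖) :
    Hol t a (K * N) (fun z => f (p z)) := by
  refine ⟨fun z hz => ?_, fun z hz z' hz' => ?_⟩
  · have := (norm_nonneg _).trans (h.1 _ (hp z hz))
    nlinarith [h.1 _ (hp z hz)]
  · have hN := (norm_nonneg _).trans (h.1 _ (hp z hz))
    calc ‖f (p z) - f (p z')‖ ≤ N * ‖p z - p z'‖ ^ a := h.2 _ (hp z hz) _ (hp z' hz')
      _ ≤ N * (K * ‖z - z'‖) ^ a := by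
          gcongr
          exact hl z hz z' hz'
      _ = K ^ a * N * ‖z - z'‖ ^ a := by
          rw [Real.mul_rpow (by linarith) (norm_nonneg _)]; ring
      _ ≤ K * N * ‖z - z'‖ ^ a := by
          gcongr
          exact Real.rpow_le_self_of_one_le hK ha1

theorem Hol.lim {fn : ℕ → E → F} (h : ∀ n, Hol s a N (fn n))
    (hf : ∀ z ∈ s, Filter.Tendsto (fun n => fn n z) Filter.atTop (nhds (f z))) :
    Hol s a N f :=
  ⟨fun z hz => le_of_tendsto (hf z hz).norm (Filter.Eventually.of_forall fun n => (h n).1 z hz),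
    fun z hz z' hz' => le_of_tendsto ((hf z hz).sub (hf z' hz')).norm
      (Filter.Eventually.of_forall fun n => (h n).2 z hz z' hz')⟩

theorem Hol.continuousOn (h : Hol s a N f) (ha : 0 < a) : ContinuousOn f s := by
  intro z hz
  rw [ContinuousWithinAt, tendsto_iff_norm_sub_tendsto_zero]
  have h0 : Filter.Tendsto (fun z' => N * ‖z' - z‖ ^ a) (nhdsWithin z s) (nhds 0) := by
    have : Continuous fun z' : E => N * ‖z' - z‖ ^ a := by
      refine continuous_const.mul (Continuous.rpow_const (by fun_prop) fun _ => Or.inr ha.le)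
    have h2 := this.tendsto z
    simp only [sub_self, norm_zero, Real.zero_rpow ha.ne', mul_zero] at h2
    exact h2.mono_left nhdsWithin_le_nhds
  refine squeeze_zero' (Filter.Eventually.of_forall fun _ => norm_nonneg _) ?_ h0
  filter_upwards [self_mem_nhdsWithin] with z' hz' using h.2 z' hz' z hz

theorem Hol.inv_one_add {f : E → ℝ} (h : Hol s a N f) (hN : N ≤ 1 / 2) :
    Hol s a 2 (fun z => (1 + f z)⁻¹) := by
  have hp : ∀ z ∈ s, 1 / 2 ≤ 1 + f z := fun z hz => by
    have := (abs_le.1 (h.1 z hz)).1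
    linarith
  have hi : ∀ z ∈ s, |(1 + f z)⁻¹| ≤ 2 := fun z hz => by
    rw [abs_of_nonneg (inv_nonneg.2 (by linarith [hp z hz]))]
    exact inv_le_of_inv_le₀ (by norm_num) (by linarith [hp z hz])
  refine ⟨hi, fun z hz z' hz' => ?_⟩
  have h1 := hp z hz
  have h2 := hp z' hz'
  rw [show (1 + f z)⁻¹ - (1 + f z')⁻¹ = (1 + f z)⁻¹ * (1 + f z')⁻¹ * -(f z - f z') by
    field_simp; ring, norm_mul, norm_mul, norm_neg]
  have h3 := h.2 z hz z' hz'
  have hr := Real.rpow_nonneg (norm_nonneg (z - z')) a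
  calc ‖(1 + f z)⁻¹‖ * ‖(1 + f z')⁻¹‖ * ‖f z - f z'‖ ≤ 2 * 2 * (N * ‖z - z'‖ ^ a) := by
        gcongr
        · exact hi z hz
        · exact hi z' hz'
    _ ≤ 2 * ‖z - z'‖ ^ a := by nlinarith

/-- Hölder bound for a difference of compositions with a `C^{1,a}` function. -/
theorem Hol.comp_sub {H H' : ℝ → ℝ} {p q : E → ℝ} {K : ℝ} (ha : 0 < a) (ha1 : a ≤ 1)
    (hd : ∀ t, HasDerivAt H (H' t) t) (hH' : Hol univ a N H') (hK : 1 ≤ K)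
    (hp : ∀ z ∈ s, ∀ z' ∈ s, ‖p z - p z'‖ ≤ K * ‖z - z'‖)
    (hq : ∀ z ∈ s, ∀ z' ∈ s, ‖q z - q z'‖ ≤ K * ‖z - z'‖)
    (hpq : Hol s a M (fun z => p z - q z)) :
    Hol s a (2 * K * N * M) (fun z => H (p z) - H (q z)) := by
  have hc : Continuous H' := continuousOn_univ.1 (hH'.continuousOn ha)
  have hN := hH'.nonneg ⟨0, mem_univ _⟩
  have key : ∀ z, H (p z) - H (q z)
      = (∫ t in (0:ℝ)..1, H' (q z + t * (p z - q z))) * (p z - q z) := by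
    intro z
    rw [← intervalIntegral.integral_mul_const]
    have := intervalIntegral.integral_eq_sub_of_hasDerivAt (a := 0) (b := 1)
      (f := fun t => H (q z + t * (p z - q z)))
      (f' := fun t => H' (q z + t * (p z - q z)) * (p z - q z)) (fun t _ => by
        refine (hd _).comp t ?_
        simpa using ((hasDerivAt_id t).mul_const (p z - q z)).const_add (q z))
      (Continuous.intervalIntegrable (by fun_prop) _ _)
    rw [this]
    simp
  have hI : Hol s a (K * N) (fun z => ∫ t in (0:ℝ)..1, H' (q z + t * (p z - q z))) := by
    have hci : ∀ z, IntervalIntegrable (fun t => H' (q z + t * (p z - q z)))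
      MeasureTheory.volume 0 1 := fun z => Continuous.intervalIntegrable (by fun_prop) _ _
    refine ⟨fun z hz => ?_, fun z hz z' hz' => ?_⟩
    · have := intervalIntegral.norm_integral_le_of_norm_le_const (a := 0) (b := 1) (C := N)
        (f := fun t => H' (q z + t * (p z - q z))) (fun t _ => hH'.1 _ (mem_univ _))
      norm_num at this
      simp only [Real.norm_eq_abs]
      nlinarith
    · rw [← intervalIntegral.integral_sub (hci z) (hci z')]
      have := intervalIntegral.norm_integral_le_of_norm_le_const (a := 0) (b := 1)
        (C := K * N * ‖z - z'‖ ^ a)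
        (f := fun t => H' (q z + t * (p z - q z)) - H' (q z' + t * (p z' - q z'))) ?_
      · simpa using this
      intro t ht
      rw [uIoc_of_le zero_le_one] at ht
      refine (hH'.2 _ (mem_univ _) _ (mem_univ _)).trans ?_
      have h1 : ‖q z + t * (p z - q z) - (q z' + t * (p z' - q z'))‖ ≤ K * ‖z - z'‖ := by
        rw [show q z + t * (p z - q z) - (q z' + t * (p z' - q z'))
          = (1 - t) * (q z - q z') + t * (p z - p z') by ring]
        refine (norm_add_le _ _).trans ?_
        rw [norm_mul, norm_mul, Real.norm_of_nonneg ht.1.le, Real.norm_of_nonneg (sub_nonneg.2 ht.2)]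
        nlinarith [mul_le_mul_of_nonneg_left (hp z hz z' hz') ht.1.le,
          mul_le_mul_of_nonneg_left (hq z hz z' hz') (sub_nonneg.2 ht.2)]
      calc N * ‖q z + t * (p z - q z) - (q z' + t * (p z' - q z'))‖ ^ a
          ≤ N * (K * ‖z - z'‖) ^ a := by gcongr
        _ = K ^ a * N * ‖z - z'‖ ^ a := by
            rw [Real.mul_rpow (by linarith) (norm_nonneg _)]; ring
        _ ≤ K * N * ‖z - z'‖ ^ a := by
            gcongr
            exact Real.rpow_le_self_of_one_le hK ha1
  refine ((hI.mul hpq).congr fun z _ => key z).mono (le_of_eq (by ring))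

end Holder

/-- Periodicity in the first variable on the strip. -/
def PerS (L : ℝ) (f : ℝ × ℝ → ℝ) : Prop := ∀ x, ∀ y ∈ Icc 0 L, f (x + 1, y) = f (x, y)

/-- The linear form `(ξ, η) ↦ p ξ + q η`. -/
def lin2 (p q : ℝ) : ℝ × ℝ →L[ℝ] ℝ :=
  p • ContinuousLinearMap.fst ℝ ℝ ℝ + q • ContinuousLinearMap.snd ℝ ℝ ℝ

@[simp] theorem lin2_apply (p q : ℝ) (z : ℝ × ℝ) : lin2 p q z = p * z.1 + q * z.2 := by
  simp [lin2]

theorem lin2_norm_le (p q : ℝ) : ‖lin2 p q‖ ≤ |p| + |q| := by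
  refine ContinuousLinearMap.opNorm_le_bound _ (by positivity) fun z => ?_
  rw [lin2_apply, Real.norm_eq_abs]
  have h1 : |z.1| ≤ ‖z‖ := norm_fst_le z
  have h2 : |z.2| ≤ ‖z‖ := norm_snd_le z
  calc |p * z.1 + q * z.2| ≤ |p * z.1| + |q * z.2| := abs_add_le _ _
    _ = |p| * |z.1| + |q| * |z.2| := by rw [abs_mul, abs_mul]
    _ ≤ (|p| + |q|) * ‖z‖ := by
      nlinarith [mul_le_mul_of_nonneg_left h1 (abs_nonneg p),
        mul_le_mul_of_nonneg_left h2 (abs_nonneg q)]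

/-- `f` has gradient `(fx, fy)` on the closed strip. -/
def Grad (L : ℝ) (f fx fy : ℝ × ℝ → ℝ) : Prop :=
  ∀ z ∈ strip L, HasFDerivWithinAt f (lin2 (fx z) (fy z)) (strip L) z

theorem mem_strip {L : ℝ} {z : ℝ × ℝ} : z ∈ strip L ↔ 0 ≤ z.2 ∧ z.2 ≤ L := by
  simp [strip]

theorem strip_convex (L : ℝ) : Convex ℝ (strip L) := convex_univ.prod (convex_Icc 0 L)

theorem strip_interior (L : ℝ) : interior (strip L) = univ ×ˢ Ioo 0 L := by
  rw [strip, interior_prod_eq, interior_univ, interior_Icc]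

theorem strip_unique {L : ℝ} (hL : 0 < L) : UniqueDiffOn ℝ (strip L) :=
  uniqueDiffOn_univ.prod (uniqueDiffOn_Icc hL)

section Gradient

variable {L a N : ℝ} {f fx fy g gx gy : ℝ × ℝ → ℝ}

theorem Grad.continuousOn (h : Grad L f fx fy) : ContinuousOn f (strip L) :=
  fun z hz => (h z hz).continuousWithinAt

theorem Grad.congr {f' fx' fy' : ℝ × ℝ → ℝ} (h : Grad L f fx fy)
    (h0 : ∀ z ∈ strip L, f' z = f z) (h1 : ∀ z ∈ strip L, fx' z = fx z)
    (h2 : ∀ z ∈ strip L, fy' z = fy z) : Grad L f' fx' fy' := fun z hz => by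
  rw [h1 z hz, h2 z hz]
  exact (h z hz).congr h0 (h0 z hz)

theorem Grad.add (h : Grad L f fx fy) (h' : Grad L g gx gy) :
    Grad L (fun z => f z + g z) (fun z => fx z + gx z) (fun z => fy z + gy z) := fun z hz => by
  refine ((h z hz).add (h' z hz)).congr_fderiv ?_
  ext <;> simp

theorem Grad.sub (h : Grad L f fx fy) (h' : Grad L g gx gy) :
    Grad L (fun z => f z - g z) (fun z => fx z - gx z) (fun z => fy z - gy z) := fun z hz => by
  refine ((h z hz).sub (h' z hz)).congr_fderiv ?_
  ext <;> simp

theorem Grad.mul (h : Grad L f fx fy) (h' : Grad L g gx gy) :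
    Grad L (fun z => f z * g z) (fun z => fx z * g z + f z * gx z)
      (fun z => fy z * g z + f z * gy z) := fun z hz => by
  refine ((h z hz).mul (h' z hz)).congr_fderiv ?_
  ext <;> simp <;> ring

theorem Grad.const (c : ℝ) : Grad L (fun _ => c) (fun _ => 0) (fun _ => 0) := fun z _ => by
  refine (hasFDerivWithinAt_const c z _).congr_fderiv ?_
  ext <;> simp

theorem Grad.const_mul (h : Grad L f fx fy) (c : ℝ) :
    Grad L (fun z => c * f z) (fun z => c * fx z) (fun z => c * fy z) :=
  ((Grad.const c).mul h).congr (fun _ _ => rfl) (fun _ _ => by ring) (fun _ _ => by ring)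

theorem Grad.add_const (h : Grad L f fx fy) (c : ℝ) :
    Grad L (fun z => f z + c) fx fy :=
  (h.add (Grad.const c)).congr (fun _ _ => rfl) (fun _ _ => by ring) (fun _ _ => by ring)

theorem Grad.neg (h : Grad L f fx fy) :
    Grad L (fun z => -f z) (fun z => -fx z) (fun z => -fy z) :=
  (h.const_mul (-1)).congr (fun _ _ => by ring) (fun _ _ => by ring) (fun _ _ => by ring)

theorem Grad.comp {H H' : ℝ → ℝ} (h : Grad L f fx fy)
    (hH : ∀ z ∈ strip L, HasDerivAt H (H' (f z)) (f z)) :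
    Grad L (fun z => H (f z)) (fun z => H' (f z) * fx z) (fun z => H' (f z) * fy z) :=
  fun z hz => by
  refine ((hH z hz).comp_hasFDerivWithinAt z (h z hz)).congr_fderiv ?_
  ext <;> simp

/-- A function of the first variable only. -/
theorem Grad.of_fst {H H' : ℝ → ℝ} (hH : ∀ x, HasDerivAt H (H' x) x) :
    Grad L (fun z => H z.1) (fun z => H' z.1) (fun _ => 0) := fun z _ => by
  refine ((hH z.1).comp_hasFDerivWithinAt z hasFDerivWithinAt_fst).congr_fderiv ?_
  ext <;> simp

/-- A function of the second variable only. -/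
theorem Grad.of_snd {H H' : ℝ → ℝ} (hH : ∀ y ∈ Icc 0 L, HasDerivWithinAt H (H' y) (Icc 0 L) y) :
    Grad L (fun z => H z.2) (fun _ => 0) (fun z => H' z.2) := fun z hz => by
  refine ((hH z.2 hz.2).comp_hasFDerivWithinAt z hasFDerivWithinAt_snd
    (fun w hw => hw.2)).congr_fderiv ?_
  ext <;> simp

theorem Grad.unique (hL : 0 < L) (h : Grad L f fx fy) (h' : Grad L f gx gy) :
    ∀ z ∈ strip L, fx z = gx z ∧ fy z = gy z := fun z hz => by
  have := (strip_unique hL z hz).eq (h z hz) (h' z hz)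
  exact ⟨by simpa using DFunLike.congr_fun this (1, 0), by simpa using DFunLike.congr_fun this (0, 1)⟩

theorem Grad.pdx_eq (hL : 0 < L) (h : Grad L f fx fy) {z : ℝ × ℝ} (hz : z ∈ strip L) :
    pdx L f z = fx z := by
  rw [pdx, (h z hz).fderivWithin (strip_unique hL z hz)]; simp

theorem Grad.pdy_eq (hL : 0 < L) (h : Grad L f fx fy) {z : ℝ × ℝ} (hz : z ∈ strip L) :
    pdy L f z = fy z := by
  rw [pdy, (h z hz).fderivWithin (strip_unique hL z hz)]; simp

theorem Grad.shift (h : Grad L f fx fy) (c : ℝ) :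
    Grad L (fun z => f (z.1 + c, z.2)) (fun z => fx (z.1 + c, z.2))
      (fun z => fy (z.1 + c, z.2)) := fun z hz => by
  have h1 : HasFDerivWithinAt (fun z : ℝ × ℝ => (z.1 + c, z.2))
      ((ContinuousLinearMap.fst ℝ ℝ ℝ).prod (ContinuousLinearMap.snd ℝ ℝ ℝ)) (strip L) z :=
    (hasFDerivWithinAt_fst.add_const c).prodMk hasFDerivWithinAt_snd
  refine ((h (z.1 + c, z.2) ⟨mem_univ _, hz.2⟩).comp z h1
    (fun w hw => mem_strip.2 hw.2)).congr_fderiv ?_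
  ext <;> simp

theorem Grad.perS (hL : 0 < L) (h : Grad L f fx fy) (hp : PerS L f) :
    PerS L fx ∧ PerS L fy := by
  have h1 : Grad L f (fun z => fx (z.1 + 1, z.2)) (fun z => fy (z.1 + 1, z.2)) :=
    (h.shift 1).congr (fun z hz => (hp z.1 z.2 hz.2).symm) (fun _ _ => rfl) (fun _ _ => rfl)
  have := h1.unique hL h
  exact ⟨fun x y hy => (this (x, y) ⟨mem_univ _, hy⟩).1,
    fun x y hy => (this (x, y) ⟨mem_univ _, hy⟩).2⟩

theorem Grad.hasDerivAt_x (h : Grad L f fx fy) {x y : ℝ} (hy : y ∈ Icc 0 L) :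
    HasDerivAt (fun t => f (t, y)) (fx (x, y)) x := by
  have h1 : HasFDerivWithinAt (fun t : ℝ => (t, y)) (ContinuousLinearMap.inl ℝ ℝ ℝ) univ x := by
    refine (hasFDerivWithinAt_id x univ).prodMk (hasFDerivWithinAt_const y x univ)
  have := ((h (x, y) ⟨mem_univ _, hy⟩).comp x h1 (fun t _ => mem_strip.2 hy))
  rw [hasFDerivWithinAt_univ] at this
  have h2 := this.hasDerivAt
  simp only [ContinuousLinearMap.comp_apply, ContinuousLinearMap.inl_apply, lin2_apply, mul_one,
    mul_zero, add_zero] at h2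
  exact h2

theorem Grad.hasDerivWithinAt_y (h : Grad L f fx fy) {x y : ℝ} (hy : y ∈ Icc 0 L) :
    HasDerivWithinAt (fun t => f (x, t)) (fy (x, y)) (Icc 0 L) y := by
  have h1 : HasFDerivWithinAt (fun t : ℝ => (x, t)) (ContinuousLinearMap.inr ℝ ℝ ℝ) (Icc 0 L) y :=
    (hasFDerivWithinAt_const x y _).prodMk (hasFDerivWithinAt_id y _)
  have := ((h (x, y) ⟨mem_univ _, hy⟩).comp y h1 (fun t ht => ⟨mem_univ _, ht⟩))
  have h2 := this.hasDerivWithinAt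
  simp only [ContinuousLinearMap.comp_apply, ContinuousLinearMap.inr_apply, lin2_apply, mul_one,
    mul_zero, zero_add] at h2
  exact h2

theorem Grad.lip (h : Grad L f fx fy) (hx : ∀ z ∈ strip L, ‖fx z‖ ≤ N)
    (hy : ∀ z ∈ strip L, ‖fy z‖ ≤ N) :
    ∀ z ∈ strip L, ∀ z' ∈ strip L, ‖f z - f z'‖ ≤ 2 * N * ‖z - z'‖ := fun z hz z' hz' =>
  (strip_convex L).norm_image_sub_le_of_norm_hasFDerivWithin_le (C := 2 * N) h
    (fun w hw => (lin2_norm_le _ _).trans (by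
      have := hx w hw; have := hy w hw; simp only [Real.norm_eq_abs] at *; linarith)) hz' hz

theorem Grad.hol (ha : 0 < a) (ha1 : a ≤ 1) (h : Grad L f fx fy) (h0 : ∀ z ∈ strip L, ‖f z‖ ≤ N)
    (hx : ∀ z ∈ strip L, ‖fx z‖ ≤ N) (hy : ∀ z ∈ strip L, ‖fy z‖ ≤ N) :
    Hol (strip L) a (2 * N) f :=
  Hol.of_lip ha ha1 h0 (h.lip hx hy) le_rfl

theorem Grad.taylor (ha : 0 < a) (h : Grad L f fx fy) (hx : Hol (strip L) a N fx)
    (hy : Hol (strip L) a N fy) {z z' : ℝ × ℝ} (hz : z ∈ strip L) (hz' : z' ∈ strip L) :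
    |f z' - f z - (fx z * (z'.1 - z.1) + fy z * (z'.2 - z.2))|
      ≤ 2 * N * ‖z' - z‖ ^ a * ‖z' - z‖ := by
  have hs : segment ℝ z z' ⊆ strip L := (strip_convex L).segment_subset hz hz'
  have hN := hx.nonneg ⟨z, hz⟩
  have := (convex_segment (𝕜 := ℝ) z z').norm_image_sub_le_of_norm_hasFDerivWithin_le'
    (f := f) (f' := fun w => lin2 (fx w) (fy w)) (φ := lin2 (fx z) (fy z))
    (C := 2 * N * ‖z' - z‖ ^ a) (fun w hw => (h w (hs hw)).mono hs) (fun w hw => ?_)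
    (left_mem_segment ℝ z z') (right_mem_segment ℝ z z')
  · simpa using this
  · have h1 : lin2 (fx w) (fy w) - lin2 (fx z) (fy z) = lin2 (fx w - fx z) (fy w - fy z) := by
      ext <;> simp
    rw [h1]
    have h2 : ‖w - z‖ ≤ ‖z' - z‖ := by
      obtain ⟨t, ht, rfl⟩ := (segment_eq_image' ℝ z z').subset hw
      simp only [add_sub_cancel_left, norm_smul, Real.norm_of_nonneg ht.1]
      nlinarith [norm_nonneg (z' - z), ht.2]
    have h3 : ‖w - z‖ ^ a ≤ ‖z' - z‖ ^ a := by gcongr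
    have h4 := hx.2 w (hs hw) z hz
    have h5 := hy.2 w (hs hw) z hz
    refine (lin2_norm_le _ _).trans ?_
    simp only [Real.norm_eq_abs] at h4 h5
    nlinarith [mul_le_mul_of_nonneg_left h3 hN]

theorem Grad.of_taylor (ha : 0 < a) (C : ℝ)
    (h : ∀ z ∈ strip L, ∀ z' ∈ strip L, |f z' - f z - (fx z * (z'.1 - z.1) + fy z * (z'.2 - z.2))|
      ≤ C * ‖z' - z‖ ^ a * ‖z' - z‖) : Grad L f fx fy := fun z hz => by
  refine HasFDerivWithinAt.of_isLittleO ?_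
  have h1 : (fun z' => f z' - f z - lin2 (fx z) (fy z) (z' - z)) =O[nhdsWithin z (strip L)]
      fun z' => ‖z' - z‖ ^ a * ‖z' - z‖ := by
    refine Asymptotics.IsBigO.of_bound C ?_
    filter_upwards [self_mem_nhdsWithin] with z' hz'
    have := h z hz z' hz'
    simp only [lin2_apply, Prod.fst_sub, Prod.snd_sub]
    rw [Real.norm_eq_abs, Real.norm_of_nonneg (by positivity), ← mul_assoc]
    exact this
  refine h1.trans_isLittleO ?_
  have h2 : (fun z' => ‖z' - z‖ ^ a) =o[nhdsWithin z (strip L)] fun _ => (1 : ℝ) := by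
    rw [Asymptotics.isLittleO_one_iff]
    have : Continuous fun z' : ℝ × ℝ => ‖z' - z‖ ^ a :=
      Continuous.rpow_const (by fun_prop) fun _ => Or.inr ha.le
    have h2 := this.tendsto z
    simp only [sub_self, norm_zero, Real.zero_rpow ha.ne'] at h2
    exact h2.mono_left nhdsWithin_le_nhds
  have h3 := h2.mul_isBigO (Asymptotics.isBigO_refl (fun z' => ‖z' - z‖) _)
  simp only [one_mul] at h3
  exact h3.trans_isBigO (Asymptotics.isBigO_refl _ _).norm_left

theorem Grad.lim {fn fxn fyn : ℕ → ℝ × ℝ → ℝ} (ha : 0 < a) (h : ∀ n, Grad L (fn n) (fxn n) (fyn n))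
    (hx : ∀ n, Hol (strip L) a N (fxn n)) (hy : ∀ n, Hol (strip L) a N (fyn n))
    (hf : ∀ z ∈ strip L, Filter.Tendsto (fun n => fn n z) Filter.atTop (nhds (f z)))
    (hfx : ∀ z ∈ strip L, Filter.Tendsto (fun n => fxn n z) Filter.atTop (nhds (fx z)))
    (hfy : ∀ z ∈ strip L, Filter.Tendsto (fun n => fyn n z) Filter.atTop (nhds (fy z))) :
    Grad L f fx fy := by
  refine Grad.of_taylor ha (2 * N) fun z hz z' hz' => ?_
  refine le_of_tendsto (x := Filter.atTop) ?_ (Filter.Eventually.of_forall fun n =>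
    (h n).taylor ha (hx n) (hy n) hz hz')
  exact (((hf z' hz').sub (hf z hz)).sub (((hfx z hz).mul_const _).add
    ((hfy z hz).mul_const _))).abs

/-- A gradient on the open strip extends to the closed strip by continuity. -/
theorem Grad.of_interior (hL : 0 < L) (hf : ContinuousOn f (strip L))
    (hx : ContinuousOn fx (strip L)) (hy : ContinuousOn fy (strip L))
    (h : ∀ z ∈ univ ×ˢ Ioo 0 L, HasFDerivAt f (lin2 (fx z) (fy z)) z) : Grad L f fx fy := by
  intro z hz
  have ho : IsOpen (univ ×ˢ Ioo 0 L : Set (ℝ × ℝ)) := isOpen_univ.prod isOpen_Ioo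
  have hcl : closure (univ ×ˢ Ioo 0 L : Set (ℝ × ℝ)) = strip L := by
    rw [closure_prod_eq, closure_univ, closure_Ioo hL.ne, strip]
  have hsub : (univ ×ˢ Ioo 0 L : Set (ℝ × ℝ)) ⊆ strip L := by rw [← hcl]; exact subset_closure
  have := hasFDerivWithinAt_closure_of_tendsto_fderiv (f := f) (s := univ ×ˢ Ioo 0 L) (x := z)
    (f' := lin2 (fx z) (fy z)) (fun w hw => (h w hw).differentiableAt.differentiableWithinAt)
    (convex_univ.prod (convex_Ioo 0 L)) ho (fun w hw => by
      rw [hcl] at hw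
      exact (hf w hw).mono hsub) ?_
  · rwa [hcl] at this
  · have h1 : Filter.Tendsto (fun w => lin2 (fx w) (fy w)) (nhdsWithin z (univ ×ˢ Ioo 0 L))
        (nhds (lin2 (fx z) (fy z))) := by
      unfold lin2
      exact (((hx z hz).mono hsub).tendsto.smul_const _).add
        (((hy z hz).mono hsub).tendsto.smul_const _)
    refine h1.congr' ?_
    filter_upwards [self_mem_nhdsWithin] with w hw using (h w hw).fderiv.symm

/-- Poincaré lemma on the strip. -/
theorem exists_potential {p px py q qx qy : ℝ × ℝ → ℝ} (hp : Grad L p px py)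
    (hq : Grad L q qx qy) (hc : ∀ z ∈ strip L, py z = qx z) (c : ℝ) :
    ∃ f, Grad L f p q ∧ f (0, 0) = c := by
  obtain ⟨f, hf⟩ := (strip_convex L).exists_forall_hasFDerivWithinAt_of_hasFDerivWithinAt_symmetric
    (ω := fun z => lin2 (p z) (q z))
    (dω := fun z => (lin2 (px z) (py z)).smulRight (ContinuousLinearMap.fst ℝ ℝ ℝ)
      + (lin2 (qx z) (qy z)).smulRight (ContinuousLinearMap.snd ℝ ℝ ℝ))
    (fun z hz => by
      exact ((hp z hz).smul_const (ContinuousLinearMap.fst ℝ ℝ ℝ)).add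
        ((hq z hz).smul_const (ContinuousLinearMap.snd ℝ ℝ ℝ)))
    (fun z hz => by
      intro u _ v _
      have := hc z hz
      simp
      rw [this]; ring)
  refine ⟨fun z => f z + (c - f (0, 0)), Grad.add_const hf _, by ring⟩

end Gradient

/-- Projection of the plane onto the strip. -/
def clamp (L : ℝ) (z : ℝ × ℝ) : ℝ × ℝ := (z.1, max 0 (min z.2 L))

theorem clamp_mem {L : ℝ} (hL : 0 < L) (z : ℝ × ℝ) : clamp L z ∈ strip L :=
  mem_strip.2 ⟨le_max_left _ _, max_le hL.le (min_le_right _ _)⟩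

theorem clamp_eq {L : ℝ} {z : ℝ × ℝ} (hz : z ∈ strip L) : clamp L z = z := by
  obtain ⟨h0, h1⟩ := mem_strip.1 hz
  ext
  · rfl
  · simp [clamp, h0, h1]

theorem clamp_pair {L x y : ℝ} (hy : y ∈ Icc 0 L) : clamp L (x, y) = (x, y) :=
  clamp_eq (mem_strip.2 hy)

theorem clamp_continuous (L : ℝ) : Continuous (clamp L) := by unfold clamp; fun_prop

theorem continuous_comp_clamp {L : ℝ} (hL : 0 < L) {f : ℝ × ℝ → ℝ}
    (hf : ContinuousOn f (strip L)) : Continuous fun z => f (clamp L z) :=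
  hf.comp_continuous (clamp_continuous L) (clamp_mem hL)

theorem PerS.periodic {L : ℝ} {f : ℝ × ℝ → ℝ} (h : PerS L f) {y : ℝ} (hy : y ∈ Icc 0 L) :
    Function.Periodic (fun x => f (x, y)) 1 := fun x => h x y hy

theorem PerS.eq_of_Icc {L : ℝ} {f : ℝ × ℝ → ℝ} (h : PerS L f)
    (h0 : ∀ x ∈ Icc (0:ℝ) 1, ∀ y ∈ Icc 0 L, f (x, y) = 0) : ∀ z ∈ strip L, f z = 0 := by
  rintro ⟨x, y⟩ hz
  obtain ⟨x', hx', hxx⟩ := (h.periodic hz.2).exists_mem_Ico₀ one_pos x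
  exact hxx.trans (h0 x' ⟨hx'.1, hx'.2.le⟩ y hz.2)

theorem cont_x {L : ℝ} {f : ℝ × ℝ → ℝ} (hf : ContinuousOn f (strip L)) {y : ℝ}
    (hy : y ∈ Icc 0 L) : Continuous fun x => f (x, y) :=
  hf.comp_continuous (by fun_prop) (fun _ => mem_strip.2 hy)

theorem cont_y {L : ℝ} {f : ℝ × ℝ → ℝ} (hf : ContinuousOn f (strip L)) (x : ℝ) :
    ContinuousOn (fun y => f (x, y)) (Icc 0 L) :=
  hf.comp (by fun_prop) (fun _ hy => mem_strip.2 hy)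

/-- The fundamental theorem of calculus along a vertical segment of the strip. -/
theorem Grad.ftc_y {L : ℝ} {f fx fy : ℝ × ℝ → ℝ} (h : Grad L f fx fy)
    (hc : ContinuousOn fy (strip L)) (x : ℝ) {s t : ℝ} (hs : 0 ≤ s) (hst : s ≤ t) (ht : t ≤ L) :
    ∫ y in s..t, fy (x, y) = f (x, t) - f (x, s) := by
  have hsub : Icc s t ⊆ Icc 0 L := Icc_subset_Icc hs ht
  refine intervalIntegral.integral_eq_sub_of_hasDeriv_right_of_le hst
    ((cont_y h.continuousOn x).mono hsub) (fun y hy => ?_)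
    (ContinuousOn.intervalIntegrable_of_Icc hst ((cont_y hc x).mono hsub))
  have hy' : y ∈ Icc 0 L := hsub ⟨hy.1.le, hy.2.le⟩
  refine ((h.hasDerivWithinAt_y (x := x) hy').hasDerivAt ?_).hasDerivWithinAt
  exact Icc_mem_nhds (by linarith [hy.1]) (by linarith [hy.2])

theorem Grad.ftc_x {L : ℝ} {f fx fy : ℝ × ℝ → ℝ} (h : Grad L f fx fy)
    (hc : ContinuousOn fx (strip L)) {y : ℝ} (hy : y ∈ Icc 0 L) (s t : ℝ) :
    ∫ x in s..t, fx (x, y) = f (t, y) - f (s, y) :=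
  intervalIntegral.integral_eq_sub_of_hasDerivAt (f := fun x => f (x, y))
    (fun _ _ => h.hasDerivAt_x hy) ((cont_x hc hy).intervalIntegrable _ _)

/-- Green's identity on the periodic strip. -/
theorem green {L : ℝ} (hL : 0 < L) {F Fx Fy Q Qx Qy : ℝ × ℝ → ℝ} (hF : Grad L F Fx Fy)
    (hQ : Grad L Q Qx Qy) (hFc : ContinuousOn Fy (strip L)) (hQc : ContinuousOn Qx (strip L))
    (hQp : PerS L Q) {t : ℝ} (ht : t ∈ Icc 0 L) :
    (∫ x in (0:ℝ)..1, F (x, t)) - ∫ x in (0:ℝ)..1, F (x, 0)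
      = ∫ y in (0:ℝ)..t, ∫ x in (0:ℝ)..1, (Fy (x, y) - Qx (x, y)) := by
  have h0 : (0:ℝ) ∈ Icc 0 L := ⟨le_rfl, hL.le⟩
  have hsub : ∀ y ∈ uIcc 0 t, y ∈ Icc 0 L := fun y hy => by
    rw [uIcc_of_le ht.1] at hy; exact ⟨hy.1, hy.2.trans ht.2⟩
  rw [← intervalIntegral.integral_sub ((cont_x hF.continuousOn ht).intervalIntegrable _ _)
    ((cont_x hF.continuousOn h0).intervalIntegrable _ _)]
  have h1 : ∀ x : ℝ, F (x, t) - F (x, 0) = ∫ y in (0:ℝ)..t, Fy (clamp L (x, y)) := fun x => by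
    rw [← hF.ftc_y hFc x le_rfl ht.1 ht.2]
    exact intervalIntegral.integral_congr fun y hy => by
      simp only [clamp_pair (hsub y hy)]
  have h2 : ∫ y in (0:ℝ)..t, ∫ x in (0:ℝ)..1, (Fy (x, y) - Qx (x, y))
      = ∫ y in (0:ℝ)..t, ∫ x in (0:ℝ)..1, Fy (clamp L (x, y)) := by
    refine intervalIntegral.integral_congr fun y hy => ?_
    have hy' := hsub y hy
    rw [intervalIntegral.integral_sub ((cont_x hFc hy').intervalIntegrable _ _)
      ((cont_x hQc hy').intervalIntegrable _ _), hQ.ftc_x hQc hy']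
    have := hQp 0 y hy'
    rw [zero_add] at this
    rw [this, sub_self, sub_zero]
    exact intervalIntegral.integral_congr fun x _ => by
      simp only [clamp_pair hy']
  rw [h2]
  simp only [h1]
  refine MeasureTheory.intervalIntegral_intervalIntegral_swap ?_
  have hc := continuous_comp_clamp hL hFc
  exact (hc.continuousOn.integrableOn_compact (isCompact_uIcc.prod isCompact_uIcc)).mono_set
    (prod_mono uIoc_subset_uIcc uIoc_subset_uIcc)

theorem eq_zero_of_integral_eq_zero {f : ℝ → ℝ} {s t : ℝ} (hst : s < t)
    (hf : ContinuousOn f (Icc s t)) (h0 : ∀ x ∈ Icc s t, 0 ≤ f x) (hi : ∫ x in s..t, f x = 0) :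
    ∀ x ∈ Icc s t, f x = 0 := by
  by_contra! h
  obtain ⟨x, hx, hfx⟩ := h
  have := intervalIntegral.integral_pos hst hf (fun y hy => h0 y ⟨hy.1.le, hy.2⟩)
    ⟨x, hx, lt_of_le_of_ne (h0 x hx) (Ne.symm hfx)⟩
  exact this.ne' hi

theorem eq_of_grad_zero {L : ℝ} {f : ℝ × ℝ → ℝ} (h : Grad L f (fun _ => 0) (fun _ => 0)) :
    ∀ z ∈ strip L, ∀ z' ∈ strip L, f z = f z' := fun z hz z' hz' => by
  have := h.lip (N := 0) (by simp) (by simp) z hz z' hz'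
  simp only [mul_zero, zero_mul, norm_le_zero_iff] at this
  exact sub_eq_zero.1 this

/-- A potential increases by a constant over a period. -/
theorem Grad.quasiperiodic {L : ℝ} {f fx fy : ℝ × ℝ → ℝ} (hL : 0 < L) (h : Grad L f fx fy)
    (hx : PerS L fx) (hy : PerS L fy) :
    ∀ x, ∀ y ∈ Icc 0 L, f (x + 1, y) = f (x, y) + (f (1, 0) - f (0, 0)) := fun x y hxy => by
  have h1 : Grad L (fun z => f (z.1 + 1, z.2) - f z) (fun _ => 0) (fun _ => 0) :=
    ((h.shift 1).sub h).congr (fun _ _ => rfl)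
      (fun z hz => by rw [hx z.1 z.2 hz.2, sub_self])
      (fun z hz => by rw [hy z.1 z.2 hz.2, sub_self])
  have := eq_of_grad_zero h1 (x, y) (mem_strip.2 hxy) (0, 0) (mem_strip.2 ⟨le_rfl, hL.le⟩)
  simp only [zero_add] at this
  linarith

/-- Uniqueness for the homogeneous div-curl problem on the periodic strip. -/
theorem divcurl_unique {L : ℝ} (hL : 0 < L) {u ux uy w wx wy : ℝ × ℝ → ℝ} (hu : Grad L u ux uy)
    (hw : Grad L w wx wy) (huy : ContinuousOn uy (strip L))
    (hdiv : ∀ z ∈ strip L, wy z = -ux z) (hcurl : ∀ z ∈ strip L, wx z = uy z)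
    (hup : PerS L u) (hwp : PerS L w) (h0 : ∀ x, w (x, 0) = 0) (h1 : ∀ x, w (x, L) = 0)
    (hJ : ∫ y in (0:ℝ)..L, u (0, y) = 0) : ∀ z ∈ strip L, u z = 0 ∧ w z = 0 := by
  have m0 : (0:ℝ) ∈ Icc 0 L := ⟨le_rfl, hL.le⟩
  have mL : L ∈ Icc 0 L := ⟨hL.le, le_rfl⟩
  obtain ⟨p, hp, hp0⟩ := exists_potential hw hu.neg hdiv 0
  have huc := hu.continuousOn
  have hwc := hw.continuousOn
  have hpc := hp.continuousOn
  have hwx : ContinuousOn wx (strip L) := huy.congr hcurl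
  have hpx : ∀ y ∈ Icc 0 L, (∀ x, w (x, y) = 0) → ∀ x, p (x, y) = p (0, y) := fun y hy h x => by
    have := hp.ftc_x hwc hy 0 x
    simp only [h, intervalIntegral.integral_zero] at this
    linarith
  have hpb : ∀ x, p (x, 0) = 0 := fun x => (hpx 0 m0 h0 x).trans hp0
  have hpt : ∀ x, p (x, L) = 0 := fun x => by
    rw [hpx L mL h1 x]
    have := hp.ftc_y huc.neg 0 le_rfl hL.le le_rfl
    rw [intervalIntegral.integral_neg, hJ, hp0] at this
    linarith
  have hpp : PerS L p := fun x y hy => by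
    have hun : PerS L (fun z => -u z) := fun x y hy => by simp only [hup x y hy]
    have := hp.quasiperiodic hL hwp hun x y hy
    rw [this, hpb, hpb]; ring
  have hpu := hp.mul hu
  have hpw := hp.mul hw
  have hg : ∀ t ∈ Icc 0 L, (∫ x in (0:ℝ)..1, p (x, t) * u (x, t))
      - ∫ x in (0:ℝ)..1, p (x, 0) * u (x, 0)
      = ∫ y in (0:ℝ)..t, ∫ x in (0:ℝ)..1, ((-u (x, y) * u (x, y) + p (x, y) * uy (x, y))
        - (w (x, y) * w (x, y) + p (x, y) * wx (x, y))) := fun t ht =>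
    green hL hpu hpw ((huc.neg.mul huc).add (hpc.mul huy)) ((hwc.mul hwc).add (hpc.mul hwx))
      (fun x y hy => by simp only [hpp x y hy, hwp x y hy]) ht
  have hgL := hg L mL
  simp only [hpb, hpt, zero_mul, intervalIntegral.integral_zero, sub_zero] at hgL
  have hcong : ∫ y in (0:ℝ)..L, ∫ x in (0:ℝ)..1,
      (u (clamp L (x, y)) ^ 2 + w (clamp L (x, y)) ^ 2) = 0 := by
    rw [← neg_eq_zero, ← intervalIntegral.integral_neg]
    refine (intervalIntegral.integral_congr fun y hy => ?_).trans hgL.symm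
    rw [uIcc_of_le hL.le] at hy
    rw [← intervalIntegral.integral_neg]
    refine intervalIntegral.integral_congr fun x _ => ?_
    simp only [clamp_pair hy,
      hcurl (x, y) (mem_strip.2 hy)]
    ring
  have hcc : Continuous fun z : ℝ × ℝ => u (clamp L z) ^ 2 + w (clamp L z) ^ 2 :=
    ((continuous_comp_clamp hL huc).pow 2).add ((continuous_comp_clamp hL hwc).pow 2)
  have hcc' : Continuous fun y : ℝ => ∫ x in (0:ℝ)..1,
      (u (clamp L (x, y)) ^ 2 + w (clamp L (x, y)) ^ 2) := by
    refine intervalIntegral.continuous_parametric_intervalIntegral_of_continuous'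
      (f := fun y x => u (clamp L (x, y)) ^ 2 + w (clamp L (x, y)) ^ 2) ?_ 0 1
    exact hcc.comp (by fun_prop : Continuous fun q : ℝ × ℝ => (q.2, q.1))
  have hz1 := eq_zero_of_integral_eq_zero hL hcc'.continuousOn (fun y _ =>
    intervalIntegral.integral_nonneg zero_le_one fun x _ => by positivity) hcong
  have hz2 : ∀ z ∈ strip L, u z ^ 2 + w z ^ 2 = 0 := by
    refine PerS.eq_of_Icc (fun x y hy => by simp only [hup x y hy, hwp x y hy]) fun x hx y hy => ?_
    have := eq_zero_of_integral_eq_zero one_pos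
      (hcc.comp (by fun_prop : Continuous fun x : ℝ => (x, y))).continuousOn
      (fun x _ => by simp only [Function.comp]; positivity) (hz1 y hy) x hx
    simpa only [Function.comp, clamp_pair hy] using this
  intro z hz
  have := hz2 z hz
  constructor <;> nlinarith [sq_nonneg (u z), sq_nonneg (w z)]

open Complex in
/-- The nome `exp (2πiz)`. -/
def nome (z : ℂ) : ℂ := cexp (2 * Real.pi * I * z)

/-- The holomorphic Poisson kernel of the periodic upper half-plane. -/
def kern (z : ℂ) : ℂ := nome z / (1 - nome z)

/-- The derivative of `kern`. -/
def kern' (z : ℂ) : ℂ := 2 * Real.pi * Complex.I * nome z / (1 - nome z) ^ 2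

section Kernel

open Complex

theorem nome_norm (z : ℂ) : ‖nome z‖ = Real.exp (-(2 * Real.pi * z.im)) := by
  rw [nome, Complex.norm_exp]
  congr 1
  simp

theorem nome_add_one (z : ℂ) : nome (z + 1) = nome z := by
  rw [nome, mul_add, Complex.exp_add, mul_one, Complex.exp_two_pi_mul_I, mul_one, nome]

theorem kern_add_one (z : ℂ) : kern (z + 1) = kern z := by rw [kern, nome_add_one, kern]

theorem kern'_add_one (z : ℂ) : kern' (z + 1) = kern' z := by rw [kern', nome_add_one, kern']

theorem nome_norm_lt_one {z : ℂ} (hz : 0 < z.im) : ‖nome z‖ < 1 := by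
  rw [nome_norm, Real.exp_lt_one_iff]
  have := Real.pi_pos
  have : 0 < 2 * Real.pi * z.im := by positivity
  linarith

theorem one_sub_nome_re_pos {z : ℂ} (hz : 0 < z.im) : 0 < (1 - nome z).re := by
  have := (Complex.re_le_norm (nome z)).trans_lt (nome_norm_lt_one hz)
  simp only [sub_re, one_re]; linarith

theorem one_sub_nome_ne {z : ℂ} (hz : 0 < z.im) : 1 - nome z ≠ 0 := fun h => by
  have := one_sub_nome_re_pos hz
  rw [h] at this
  simp at this

theorem nome_hasDerivAt (z : ℂ) : HasDerivAt nome (2 * Real.pi * I * nome z) z := by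
  have h1 : HasDerivAt (fun z : ℂ => 2 * Real.pi * I * z) (2 * Real.pi * I) z := by
    simpa using (hasDerivAt_id z).const_mul (2 * Real.pi * I)
  refine h1.cexp.congr_deriv ?_
  rw [nome]; ring

theorem kern_hasDerivAt {z : ℂ} (hz : 0 < z.im) : HasDerivAt kern (kern' z) z := by
  have h := (nome_hasDerivAt z).div ((nome_hasDerivAt z).const_sub 1) (one_sub_nome_ne hz)
  refine h.congr_deriv ?_
  rw [kern']
  congr 1
  ring

theorem nome_continuous : Continuous nome := by unfold nome; fun_prop

theorem kern_measurable : Measurable kern :=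
  nome_continuous.measurable.div (measurable_const.sub nome_continuous.measurable)

theorem kern'_measurable : Measurable kern' :=
  (measurable_const.mul nome_continuous.measurable).div
    ((measurable_const.sub nome_continuous.measurable).pow_const 2)

theorem kern_continuousAt {z : ℂ} (hz : 0 < z.im) : ContinuousAt kern z :=
  (kern_hasDerivAt hz).continuousAt

theorem kern'_continuousAt {z : ℂ} (hz : 0 < z.im) : ContinuousAt kern' z :=
  (continuousAt_const.mul nome_continuous.continuousAt).div
    ((continuousAt_const.sub nome_continuous.continuousAt).pow 2)
    (pow_ne_zero 2 (one_sub_nome_ne hz))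

theorem one_sub_nome_normSq (z : ℂ) : ‖1 - nome z‖ ^ 2
    = (1 - ‖nome z‖) ^ 2 + 4 * ‖nome z‖ * Real.sin (Real.pi * z.re) ^ 2 := by
  have h1 : (nome z).re = ‖nome z‖ * Real.cos (2 * (Real.pi * z.re)) := by
    rw [nome_norm, nome, Complex.exp_re]
    simp
    rw [mul_assoc]
  have h2 : ‖1 - nome z‖ ^ 2 = 1 - 2 * (nome z).re + ‖nome z‖ ^ 2 := by
    rw [← Complex.normSq_eq_norm_sq, ← Complex.normSq_eq_norm_sq, Complex.normSq_apply,
      Complex.normSq_apply]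
    simp
    ring
  rw [h2, h1, Real.cos_two_mul', Real.cos_sq']
  ring

theorem one_sub_norm_sq (z : ℂ) :
    (1 - ‖nome z‖) ^ 2 = ‖nome z‖ * (4 * Real.sinh (Real.pi * z.im) ^ 2) := by
  rw [nome_norm, Real.sinh_eq]
  have h1 : Real.exp (-(2 * Real.pi * z.im)) = Real.exp (-(Real.pi * z.im)) ^ 2 := by
    rw [← Real.exp_nat_mul]; congr 1; push_cast; ring
  have h2 : Real.exp (Real.pi * z.im) * Real.exp (-(Real.pi * z.im)) = 1 := by
    rw [← Real.exp_add]; simp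
  rw [h1]
  set e := Real.exp (Real.pi * z.im)
  set r := Real.exp (-(Real.pi * z.im))
  have : r ^ 2 * (4 * ((e - r) / 2) ^ 2) = (e * r - r ^ 2) ^ 2 := by ring
  rw [this, h2]

theorem sinh_sq_ge {x : ℝ} (hx : 0 ≤ x) : x ^ 2 * (1 + x ^ 2 / 4) ≤ Real.sinh x ^ 2 := by
  have h1 : x / 2 ≤ Real.sinh (x / 2) := Real.self_le_sinh_iff.2 (by linarith)
  have h2 : Real.sinh x = 2 * Real.sinh (x / 2) * Real.cosh (x / 2) := by
    rw [← Real.sinh_two_mul]; ring_nf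
  rw [h2, mul_pow, Real.cosh_sq]
  have h3 : (x / 2) ^ 2 ≤ Real.sinh (x / 2) ^ 2 := by gcongr
  have h4 := mul_le_mul h3 (add_le_add_left h3 1) (by positivity) (by positivity)
  nlinarith

theorem kern'_norm (z : ℂ) : ‖kern' z‖ = 2 * Real.pi * ‖nome z‖ / ‖1 - nome z‖ ^ 2 := by
  rw [kern', norm_div, norm_mul, norm_pow, norm_mul, norm_mul]
  simp [abs_of_pos Real.pi_pos]

/-- Bound for `kern'` given a lower bound for the sine. -/
theorem kern'_bound_aux {z : ℂ} (hz : 0 < z.im) {t : ℝ} (ht : t ^ 2 ≤ 1 / 4)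
    (hs : 4 * t ^ 2 ≤ Real.sin (Real.pi * z.re) ^ 2) :
    ‖kern' z‖ ≤ 2 / ((1 + z.im ^ 2) * (z.im ^ 2 + t ^ 2)) := by
  have hpi := Real.pi_pos
  have hpi3 := Real.pi_gt_three
  have hpi4 := Real.pi_lt_d2
  have hD : 0 < ‖1 - nome z‖ ^ 2 := by
    have := norm_pos_iff.2 (one_sub_nome_ne hz); positivity
  have hX : 0 < (1 + z.im ^ 2) * (z.im ^ 2 + t ^ 2) := by positivity
  rw [kern'_norm, div_le_div_iff₀ hD hX, one_sub_nome_normSq, one_sub_norm_sq]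
  have hr : 0 ≤ ‖nome z‖ := norm_nonneg _
  have h1 := sinh_sq_ge (by positivity : 0 ≤ Real.pi * z.im)
  have h9 : 9 ≤ Real.pi ^ 2 := by nlinarith
  have h2 : 9 * z.im ^ 2 * (1 + z.im ^ 2) ≤ Real.sinh (Real.pi * z.im) ^ 2 := by
    refine le_trans ?_ h1
    rw [mul_pow]
    have := mul_le_mul_of_nonneg_right h9 (sq_nonneg z.im)
    gcongr
    nlinarith
  have key : Real.pi * ((1 + z.im ^ 2) * (z.im ^ 2 + t ^ 2))
      ≤ 4 * Real.sinh (Real.pi * z.im) ^ 2 + 4 * Real.sin (Real.pi * z.re) ^ 2 := by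
    have h5 : (1 + z.im ^ 2) * (z.im ^ 2 + t ^ 2) ≤ 2 * (z.im ^ 2 * (1 + z.im ^ 2)) + t ^ 2 := by
      nlinarith [sq_nonneg z.im, mul_le_mul_of_nonneg_left ht (sq_nonneg z.im),
        sq_nonneg (z.im ^ 2)]
    have h6 : 0 ≤ z.im ^ 2 * (1 + z.im ^ 2) := by positivity
    nlinarith [sq_nonneg t]
  nlinarith [mul_le_mul_of_nonneg_left key hr]

theorem kern'_bound {z : ℂ} (hz : 0 < z.im) (ht : |z.re| ≤ 1 / 2) :
    ‖kern' z‖ ≤ 2 / ((1 + z.im ^ 2) * (z.im ^ 2 + z.re ^ 2)) := by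
  refine kern'_bound_aux hz ?_ ?_
  · rw [← sq_abs]; nlinarith [abs_nonneg z.re]
  · have h1 : 2 * |z.re| ≤ |Real.sin (Real.pi * z.re)| := by
      have hpi := Real.pi_pos
      have h := Real.mul_le_sin (x := Real.pi * |z.re|) (by positivity) (by nlinarith)
      have h2 : 2 / Real.pi * (Real.pi * |z.re|) = 2 * |z.re| := by field_simp
      rw [h2] at h
      refine h.trans ?_
      rcases abs_cases z.re with ⟨h, _⟩ | ⟨h, _⟩
      · rw [h]; exact le_abs_self _
      · rw [h, mul_neg, Real.sin_neg]; exact neg_le_abs _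
    rw [← sq_abs z.re, ← sq_abs (Real.sin _)]
    nlinarith [abs_nonneg z.re]

theorem kern'_bound' {z : ℂ} (hz : 0 < z.im) :
    ‖kern' z‖ ≤ 2 / (z.im ^ 2 * (1 + z.im ^ 2)) := by
  refine (kern'_bound_aux (t := 0) hz (by norm_num) (by norm_num [sq_nonneg])).trans (le_of_eq ?_)
  congr 1; ring

theorem kern_bound {z : ℂ} {δ : ℝ} (hδ : 0 < δ) (hz : δ ≤ z.im) :
    ‖kern z‖ ≤ (1 + δ⁻¹) / (1 + z.im ^ 2) := by
  have hz0 : 0 < z.im := hδ.trans_le hz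
  have hr := nome_norm_lt_one hz0
  have h1 : 1 - ‖nome z‖ ≤ ‖1 - nome z‖ := by
    simpa using norm_sub_norm_le (1 : ℂ) (nome z)
  have hE : ‖nome z‖ * Real.exp (2 * Real.pi * z.im) = 1 := by
    rw [nome_norm, ← Real.exp_add]; simp
  have hpi3 := Real.pi_gt_three
  have hX : 0 ≤ 2 * Real.pi * z.im := by positivity
  have h2 := Real.quadratic_le_exp_of_nonneg hX
  have h3 : 6 * z.im ≤ 2 * Real.pi * z.im := by nlinarith
  have h4 : 6 * z.im + 18 * z.im ^ 2 ≤ Real.exp (2 * Real.pi * z.im) - 1 := by nlinarith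
  have h5 : 1 + z.im ^ 2 ≤ (1 + δ⁻¹) * (6 * z.im + 18 * z.im ^ 2) := by
    have : 1 ≤ δ⁻¹ * z.im := by rw [inv_mul_eq_div, one_le_div hδ]; exact hz
    have h6 : 0 < δ⁻¹ := by positivity
    nlinarith [mul_nonneg h6.le (sq_nonneg z.im)]
  rw [kern, norm_div, div_le_div_iff₀ (by linarith) (by positivity)]
  have h6 : 0 < 1 + δ⁻¹ := by positivity
  have h7 := norm_nonneg (nome z)
  calc ‖nome z‖ * (1 + z.im ^ 2)
      ≤ ‖nome z‖ * ((1 + δ⁻¹) * (Real.exp (2 * Real.pi * z.im) - 1)) := by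
        refine mul_le_mul_of_nonneg_left (h5.trans ?_) h7
        exact mul_le_mul_of_nonneg_left h4 h6.le
    _ = (1 + δ⁻¹) * (1 - ‖nome z‖) := by
        linear_combination (1 + δ⁻¹) * hE
    _ ≤ (1 + δ⁻¹) * ‖1 - nome z‖ := mul_le_mul_of_nonneg_left h1 h6.le

/-- The real Poisson kernel. -/
theorem poisson_eq {z : ℂ} (hz : 0 < z.im) :
    1 + 2 * (kern z).re = (1 - ‖nome z‖ ^ 2) / ‖1 - nome z‖ ^ 2 := by
  have hD : ‖1 - nome z‖ ^ 2 ≠ 0 := by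
    have := norm_pos_iff.2 (one_sub_nome_ne hz); positivity
  rw [eq_div_iff hD]
  have h1 : (kern z).re * ‖1 - nome z‖ ^ 2 = (nome z * (starRingEnd ℂ) (1 - nome z)).re := by
    have : kern z * ((‖1 - nome z‖ ^ 2 : ℝ) : ℂ) = nome z * (starRingEnd ℂ) (1 - nome z) := by
      rw [← Complex.normSq_eq_norm_sq, ← Complex.mul_conj, kern]
      field_simp [one_sub_nome_ne hz]
    rw [← this, Complex.re_mul_ofReal]
  rw [add_mul, mul_assoc, h1, ← Complex.normSq_eq_norm_sq, ← Complex.normSq_eq_norm_sq,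
    Complex.normSq_apply, Complex.normSq_apply]
  simp
  ring

theorem poisson_nonneg {z : ℂ} (hz : 0 < z.im) : 0 ≤ 1 + 2 * (kern z).re := by
  rw [poisson_eq hz]
  have := nome_norm_lt_one hz
  have h2 := norm_nonneg (nome z)
  exact div_nonneg (by nlinarith) (by positivity)

theorem poisson_le {z : ℂ} (hz : 0 < z.im) (hz1 : z.im ≤ 1) :
    1 + 2 * (kern z).re ≤ 2 * Real.exp (2 * Real.pi) * z.im * ‖kern' z‖ := by
  have hD : 0 < ‖1 - nome z‖ ^ 2 := by
    have := norm_pos_iff.2 (one_sub_nome_ne hz); positivity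
  have hpi := Real.pi_pos
  rw [poisson_eq hz, kern'_norm, ← mul_div_assoc]
  gcongr
  have hr := nome_norm_lt_one hz
  have h0 := norm_nonneg (nome z)
  have h1 : 1 - 2 * Real.pi * z.im ≤ ‖nome z‖ := by
    rw [nome_norm]; linarith [Real.add_one_le_exp (-(2 * Real.pi * z.im))]
  have h2 : 1 ≤ Real.exp (2 * Real.pi) * ‖nome z‖ := by
    rw [nome_norm, ← Real.exp_add]
    exact Real.one_le_exp (by nlinarith)
  have h3 : 0 < 4 * Real.pi * z.im := by positivity
  calc 1 - ‖nome z‖ ^ 2 ≤ 4 * Real.pi * z.im := by nlinarith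
    _ ≤ 4 * Real.pi * z.im * (Real.exp (2 * Real.pi) * ‖nome z‖) := by nlinarith
    _ = _ := by ring

end Kernel

/-- Holomorphic Poisson extension of a periodic density. -/
def gI (φ : ℝ → ℝ) (z : ℂ) : ℂ := ∫ t in (0:ℝ)..1, kern (z - t) * φ t

/-- Derivative of the holomorphic Poisson extension. -/
def hI (φ : ℝ → ℝ) (z : ℂ) : ℂ := ∫ t in (0:ℝ)..1, kern' (z - t) * φ t

section KernelIntegrals

open Complex MeasureTheory

variable {a N : ℝ} {φ : ℝ → ℝ}

theorem sub_ofReal_im (z : ℂ) (t : ℝ) : (z - t).im = z.im := by simp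

theorem kern_sub_continuous {z : ℂ} (hz : 0 < z.im) : Continuous fun t : ℝ => kern (z - t) :=
  continuous_iff_continuousAt.2 fun t =>
    ContinuousAt.comp (f := fun t : ℝ => z - t) (kern_continuousAt (by simpa using hz))
      (by fun_prop)

theorem kern'_sub_continuous {z : ℂ} (hz : 0 < z.im) : Continuous fun t : ℝ => kern' (z - t) :=
  continuous_iff_continuousAt.2 fun t =>
    ContinuousAt.comp (f := fun t : ℝ => z - t) (kern'_continuousAt (by simpa using hz))
      (by fun_prop)

theorem integral_kern' {z : ℂ} (hz : 0 < z.im) : ∫ t in (0:ℝ)..1, kern' (z - t) = 0 := by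
  have h : ∀ t : ℝ, HasDerivAt (fun t : ℝ => -kern (z - t)) (kern' (z - t)) t := fun t => by
    have h1 : HasDerivAt (fun t : ℝ => z - t) (-1) t := (HasDerivAt.ofReal_comp (hasDerivAt_id t)).const_sub z
    have := ((kern_hasDerivAt (z := z - t) (by simpa using hz)).comp t h1).neg
    exact this.congr_deriv (by ring)
  rw [intervalIntegral.integral_eq_sub_of_hasDerivAt (fun t _ => h t)
    ((kern'_sub_continuous hz).intervalIntegrable _ _)]
  have := kern_add_one (z - 1)
  rw [sub_add_cancel] at this
  simp [this]

theorem integral_kern {z : ℂ} (hz : 0 < z.im) : ∫ t in (0:ℝ)..1, kern (z - t) = 0 := by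
  have hne : (2 * Real.pi * I : ℂ) ≠ 0 := Complex.two_pi_I_ne_zero
  have h : ∀ t : ℝ, HasDerivAt (fun t : ℝ => (2 * Real.pi * I)⁻¹ * Complex.log (1 - nome (z - t)))
      (kern (z - t)) t := fun t => by
    have hz' : 0 < (z - t).im := by simpa using hz
    have h1 : HasDerivAt (fun t : ℝ => z - t) (-1) t := (HasDerivAt.ofReal_comp (hasDerivAt_id t)).const_sub z
    have h2 := ((nome_hasDerivAt (z - t)).comp t h1).const_sub 1
    have := (h2.clog_real (Or.inl (one_sub_nome_re_pos hz'))).const_mul (2 * Real.pi * I)⁻¹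
    refine this.congr_deriv ?_
    rw [kern]
    simp only [Function.comp]
    field_simp [one_sub_nome_ne hz']
  rw [intervalIntegral.integral_eq_sub_of_hasDerivAt (fun t _ => h t)
    ((kern_sub_continuous hz).intervalIntegrable _ _)]
  have := nome_add_one (z - 1)
  rw [sub_add_cancel] at this
  simp [this]

/-- A translate of a periodic convolution to a centred period. -/
theorem integral_center {K : ℂ → ℂ} (hK : ∀ z, K (z + 1) = K z) {f : ℝ → ℂ}
    (hf : ∀ x, f (x + 1) = f x) (z : ℂ) : ∫ t in (0:ℝ)..1, K (z - t) * f t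
      = ∫ t in (-1/2 : ℝ)..1/2, K (z.im * I - t) * f (z.re + t) := by
  have hp : Function.Periodic (fun t : ℝ => K (z - t) * f t) 1 := fun t => by
    have := hK (z - (t + 1 : ℝ))
    simp only [hf]
    rw [← this]
    push_cast
    ring_nf
  have h1 := hp.intervalIntegral_add_eq 0 (z.re + -1/2)
  rw [zero_add] at h1
  rw [h1, show z.re + -1/2 + 1 = z.re + 1/2 by ring, show z.re + -1/2 = z.re + (-1/2) by ring,
    ← intervalIntegral.integral_comp_add_left (fun t : ℝ => K (z - t) * f t)]
  refine intervalIntegral.integral_congr fun t _ => ?_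
  congr 2
  push_cast
  linear_combination -(Complex.re_add_im z)

theorem exists_integral_bound (ha : a ∈ Ioo (0:ℝ) 1) : ∃ c > (0:ℝ), ∀ σ > (0:ℝ),
    ∫ t in (-1/2 : ℝ)..1/2, |t| ^ a / (σ ^ 2 + t ^ 2) ≤ c * σ ^ (a - 1) := by
  set F : ℝ → ℝ := fun x => (1 + ‖x‖ ^ 2) ^ (-(2 - a) / 2) with hF
  have hFi : Integrable F := integrable_rpow_neg_one_add_norm_sq (by simp; linarith [ha.2])
  have hF0 : ∀ x, 0 ≤ F x := fun x => by positivity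
  refine ⟨(∫ x, F x) + 1, ?_, fun σ hσ => ?_⟩
  · have : 0 ≤ ∫ x, F x := MeasureTheory.integral_nonneg hF0
    positivity
  have hFc : Continuous F := by
    refine Continuous.rpow_const (by fun_prop) fun x => Or.inl ?_
    positivity
  have h1 : ∫ t in (-1/2 : ℝ)..1/2, |t| ^ a / (σ ^ 2 + t ^ 2)
      ≤ ∫ t in (-1/2 : ℝ)..1/2, σ ^ (a - 2) * F (t / σ) := by
    refine intervalIntegral.integral_mono_on (by norm_num) ?_ ?_ fun t _ => ?_
    · refine Continuous.intervalIntegrable (Continuous.div₀ ?_ (by fun_prop) fun t => ?_) _ _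
      · exact Continuous.rpow_const (by fun_prop) fun _ => Or.inr ha.1.le
      · positivity
    · exact Continuous.intervalIntegrable (continuous_const.mul (hFc.comp (by fun_prop))) _ _
    · have hX : 0 < σ ^ 2 + t ^ 2 := by positivity
      have h2 : |t| ^ a ≤ (σ ^ 2 + t ^ 2) ^ (a / 2) := by
        have : |t| ^ a = (t ^ 2) ^ (a / 2) := by
          rw [← sq_abs, ← Real.rpow_natCast, ← Real.rpow_mul (abs_nonneg t)]
          congr 1; push_cast; ring
        rw [this]
        exact Real.rpow_le_rpow (sq_nonneg t) (by nlinarith [sq_nonneg σ]) (by linarith [ha.1])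
      have h3 : σ ^ (a - 2) * F (t / σ) = (σ ^ 2 + t ^ 2) ^ (a / 2 - 1) := by
        have e1 : σ ^ 2 + t ^ 2 = σ ^ 2 * (1 + ‖t / σ‖ ^ 2) := by
          rw [Real.norm_eq_abs, sq_abs]; field_simp
        rw [e1, Real.mul_rpow (by positivity) (by positivity), hF]
        simp only
        congr 1
        · rw [← Real.rpow_natCast, ← Real.rpow_mul hσ.le]
          congr 1; push_cast; ring
        · congr 1; ring
      rw [h3, Real.rpow_sub_one hX.ne']
      gcongr
  refine h1.trans ?_
  rw [intervalIntegral.integral_const_mul, intervalIntegral.integral_comp_div _ hσ.ne', smul_eq_mul]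
  have h4 : ∫ x in (-1/2 / σ)..(1/2 / σ), F x ≤ ∫ x, F x := by
    rw [intervalIntegral.integral_of_le (by gcongr; norm_num)]
    exact setIntegral_le_integral hFi (Filter.Eventually.of_forall hF0)
  have h5 : σ ^ (a - 2) * (σ * ∫ x in (-1/2 / σ)..(1/2 / σ), F x)
      = σ ^ (a - 1) * ∫ x in (-1/2 / σ)..(1/2 / σ), F x := by
    rw [← mul_assoc, ← Real.rpow_add_one hσ.ne']
    congr 2; ring
  rw [h5, mul_comm]
  gcongr
  linarith

/-- The weighted kernel integral entering the Hölder estimates. -/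
theorem exists_kern'_integral (ha : a ∈ Ioo (0:ℝ) 1) : ∃ c > (0:ℝ), ∀ σ > (0:ℝ),
    ∫ t in (-1/2 : ℝ)..1/2, ‖kern' (σ * I - t)‖ * |t| ^ a ≤ c * σ ^ (a - 1) / (1 + σ ^ 2) := by
  obtain ⟨c, hc, h⟩ := exists_integral_bound ha
  refine ⟨2 * c, by positivity, fun σ hσ => ?_⟩
  have hs : 0 < (σ * I : ℂ).im := by simpa using hσ
  have h1 : ∫ t in (-1/2 : ℝ)..1/2, ‖kern' (σ * I - t)‖ * |t| ^ a
      ≤ ∫ t in (-1/2 : ℝ)..1/2, 2 / (1 + σ ^ 2) * (|t| ^ a / (σ ^ 2 + t ^ 2)) := by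
    have ca : Continuous fun t : ℝ => |t| ^ a :=
      Continuous.rpow_const (by fun_prop) fun _ => Or.inr ha.1.le
    refine intervalIntegral.integral_mono_on (by norm_num) ?_ ?_ fun t ht => ?_
    · exact ((kern'_sub_continuous hs).norm.mul ca).intervalIntegrable _ _
    · exact (continuous_const.mul (ca.div₀ (by fun_prop) fun t => by positivity)).intervalIntegrable
        _ _
    · have ht' : |t| ≤ 1 / 2 := abs_le.2 ⟨by linarith [ht.1], ht.2⟩
      have := kern'_bound (z := σ * I - t) (by simpa using hσ) (by simpa using ht')
      simp only [sub_im, mul_im, ofReal_re, I_im, ofReal_im, I_re, sub_re, mul_re, mul_zero,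
        mul_one, add_zero, sub_zero, zero_sub, even_two.neg_pow] at this
      have h0 : 0 ≤ |t| ^ a := by positivity
      calc _ ≤ 2 / ((1 + σ ^ 2) * (σ ^ 2 + t ^ 2)) * |t| ^ a := by gcongr
        _ = _ := by field_simp
  refine h1.trans ?_
  rw [intervalIntegral.integral_const_mul]
  have := h σ hσ
  calc _ ≤ 2 / (1 + σ ^ 2) * (c * σ ^ (a - 1)) := by gcongr
    _ = _ := by ring

theorem hI_bound (ha : a ∈ Ioo (0:ℝ) 1) : ∃ c > (0:ℝ), ∀ N φ, Hol univ a N φ → Per φ →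
    ∀ z : ℂ, 0 < z.im → ‖hI φ z‖ ≤ c * N * (z.im ^ (a - 1) / (1 + z.im ^ 2)) := by
  obtain ⟨c, hc, h⟩ := exists_kern'_integral ha
  refine ⟨c, hc, fun N φ hφ hper z hz => ?_⟩
  have hφc : Continuous φ := continuousOn_univ.1 (hφ.continuousOn ha.1)
  have hN := hφ.nonneg ⟨0, mem_univ _⟩
  have e1 : hI φ z = ∫ t in (0:ℝ)..1, kern' (z - t) * ((φ t : ℂ) - φ z.re) := by
    simp only [mul_sub]
    rw [intervalIntegral.integral_sub, intervalIntegral.integral_mul_const, integral_kern' hz,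
      zero_mul, sub_zero, hI]
    · exact ((kern'_sub_continuous hz).mul (by fun_prop)).intervalIntegrable _ _
    · exact ((kern'_sub_continuous hz).mul (by fun_prop)).intervalIntegrable _ _
  have hs : 0 < (z.im * I : ℂ).im := by simpa using hz
  rw [e1, integral_center kern'_add_one (f := fun t => (φ t : ℂ) - φ z.re)
    (fun x => by simp only [hper x])]
  refine (intervalIntegral.norm_integral_le_integral_norm (by norm_num)).trans ?_
  calc ∫ t in (-1/2 : ℝ)..1/2, ‖kern' (z.im * I - t) * ((φ (z.re + t) : ℂ) - φ z.re)‖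
      ≤ ∫ t in (-1/2 : ℝ)..1/2, N * (‖kern' (z.im * I - t)‖ * |t| ^ a) := by
        refine intervalIntegral.integral_mono_on (by norm_num) ?_ ?_ fun t ht => ?_
        · exact ((kern'_sub_continuous hs).mul (by fun_prop)).norm.intervalIntegrable _ _
        · exact (continuous_const.mul ((kern'_sub_continuous hs).norm.mul
            (Continuous.rpow_const (by fun_prop) fun _ => Or.inr ha.1.le))).intervalIntegrable _ _
        · rw [norm_mul, ← ofReal_sub, norm_real]
          have := hφ.2 (z.re + t) (mem_univ _) z.re (mem_univ _)
          rw [add_sub_cancel_left, Real.norm_eq_abs t] at this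
          calc _ ≤ ‖kern' (z.im * I - t)‖ * (N * |t| ^ a) := by gcongr
            _ = _ := by ring
    _ ≤ N * (c * z.im ^ (a - 1) / (1 + z.im ^ 2)) := by
        rw [intervalIntegral.integral_const_mul]
        exact mul_le_mul_of_nonneg_left (h _ hz) hN
    _ = _ := by ring

theorem gI_hasDerivAt (hφ : Continuous φ) {z : ℂ} (hz : 0 < z.im) :
    HasDerivAt (gI φ) (hI φ z) z := by
  have hball : ∀ w ∈ Metric.ball z (z.im / 2), z.im / 2 ≤ w.im := fun w hw => by
    have h1 : |w.im - z.im| ≤ dist w z := by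
      rw [Complex.dist_eq, ← sub_im]; exact abs_im_le_norm _
    have := (abs_le.1 (h1.trans (Metric.mem_ball.1 hw).le)).1
    linarith
  refine (intervalIntegral.hasDerivAt_integral_of_dominated_loc_of_deriv_le
    (F := fun w t => kern (w - t) * φ t) (F' := fun w t => kern' (w - t) * φ t)
    (bound := fun t => 2 / ((z.im / 2) ^ 2 * (1 + (z.im / 2) ^ 2)) * |φ t|)
    (Metric.ball_mem_nhds z (by linarith : 0 < z.im / 2)) ?_ ?_ ?_ ?_ ?_ ?_).2
  · filter_upwards [Metric.ball_mem_nhds z (by linarith : 0 < z.im / 2)] with w hw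
    have hw' : 0 < w.im := by linarith [hball w hw]
    exact ((kern_sub_continuous hw').mul (by fun_prop)).aestronglyMeasurable
  · exact ((kern_sub_continuous hz).mul (by fun_prop)).intervalIntegrable _ _
  · exact ((kern'_sub_continuous hz).mul (by fun_prop)).aestronglyMeasurable
  · refine Filter.Eventually.of_forall fun t _ w hw => ?_
    have hw' := hball w hw
    have hw0 : 0 < w.im := by linarith
    rw [norm_mul, norm_real, Real.norm_eq_abs]
    gcongr
    refine (kern'_bound' (z := w - t) (by simpa using hw0)).trans ?_
    rw [sub_ofReal_im]
    gcongr
  · exact (by fun_prop : Continuous fun t => 2 / ((z.im / 2) ^ 2 * (1 + (z.im / 2) ^ 2)) * |φ t|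
      ).intervalIntegrable _ _
  · refine Filter.Eventually.of_forall fun t _ w hw => ?_
    have hw0 : 0 < (w - t).im := by rw [sub_ofReal_im]; linarith [hball w hw]
    have := ((kern_hasDerivAt hw0).comp w ((hasDerivAt_id w).sub_const (t : ℂ))).mul_const (φ t : ℂ)
    simpa using this

theorem gI_bound {δ : ℝ} (hδ : 0 < δ) (hφ : ∀ t, |φ t| ≤ N) {z : ℂ} (hz : δ ≤ z.im) :
    ‖gI φ z‖ ≤ (1 + δ⁻¹) * N / (1 + z.im ^ 2) := by
  have := intervalIntegral.norm_integral_le_of_norm_le_const (a := 0) (b := 1)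
    (f := fun t : ℝ => kern (z - t) * φ t) (C := (1 + δ⁻¹) * N / (1 + z.im ^ 2)) fun t _ => by
      rw [norm_mul, norm_real]
      have h1 := kern_bound (z := z - t) hδ (by simpa using hz)
      rw [sub_ofReal_im] at h1
      calc _ ≤ (1 + δ⁻¹) / (1 + z.im ^ 2) * N :=
            mul_le_mul h1 (hφ t) (abs_nonneg _) (by positivity)
        _ = _ := by ring
  simpa [gI] using this

theorem gI_sub {ψ : ℝ → ℝ} (hφ : Continuous φ) (hψ : Continuous ψ) {z : ℂ} (hz : 0 < z.im) :
    gI φ z - gI ψ z = gI (fun t => φ t - ψ t) z := by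
  rw [gI, gI, gI, ← intervalIntegral.integral_sub]
  · refine intervalIntegral.integral_congr fun t _ => ?_
    push_cast; ring
  · exact ((kern_sub_continuous hz).mul (by fun_prop)).intervalIntegrable _ _
  · exact ((kern_sub_continuous hz).mul (by fun_prop)).intervalIntegrable _ _

theorem gI_add_one (z : ℂ) : gI φ (z + 1) = gI φ z := by
  rw [gI, gI]
  refine intervalIntegral.integral_congr fun t _ => ?_
  simp only [add_sub_right_comm, kern_add_one]

theorem gI_neg (z : ℂ) : gI (fun t => -φ t) z = -gI φ z := by
  rw [gI, gI, ← intervalIntegral.integral_neg]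
  refine intervalIntegral.integral_congr fun t _ => ?_
  simp

theorem halfplane_convex (σ : ℝ) : Convex ℝ {z : ℂ | σ ≤ z.im} :=
  (convex_halfSpace_im_ge σ)

theorem hI_lip (ha : a ∈ Ioo (0:ℝ) 1) : ∃ c > (0:ℝ), ∀ N φ, Hol univ a N φ → Per φ →
    ∀ σ > (0:ℝ), ∀ z : ℂ, σ ≤ z.im → ∀ z' : ℂ, σ ≤ z'.im →
      ‖hI φ z - hI φ z'‖ ≤ c * N * σ ^ (a - 2) * ‖z - z'‖ := by
  obtain ⟨c, hc, hb⟩ := hI_bound ha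
  refine ⟨8 * c, by positivity, fun N φ hφ hper σ hσ z hz z' hz' => ?_⟩
  have hφc : Continuous φ := continuousOn_univ.1 (hφ.continuousOn ha.1)
  have hN := hφ.nonneg ⟨0, mem_univ _⟩
  have ho : IsOpen {z : ℂ | 0 < z.im} := isOpen_lt continuous_const Complex.continuous_im
  have hd : DifferentiableOn ℂ (hI φ) {z : ℂ | 0 < z.im} := by
    have h1 : DifferentiableOn ℂ (gI φ) {z : ℂ | 0 < z.im} := fun w hw =>
      (gI_hasDerivAt hφc hw).differentiableAt.differentiableWithinAt
    exact (h1.deriv ho).congr fun w hw => (gI_hasDerivAt hφc hw).deriv.symm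
  have hder : ∀ w ∈ {z : ℂ | σ ≤ z.im}, ‖deriv (hI φ) w‖ ≤ 8 * c * N * σ ^ (a - 2) := fun w hw => by
    have hw' : σ ≤ w.im := hw
    have hcb : ∀ v ∈ Metric.closedBall w (σ / 2), σ / 2 ≤ v.im := fun v hv => by
      have h1 : |v.im - w.im| ≤ dist v w := by
        rw [Complex.dist_eq, ← sub_im]; exact abs_im_le_norm _
      have := (abs_le.1 (h1.trans (Metric.mem_closedBall.1 hv))).1
      linarith
    have := Complex.norm_deriv_le_of_forall_mem_sphere_norm_le (c := w) (R := σ / 2)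
      (C := c * N * (σ / 2) ^ (a - 1)) (f := hI φ) (by positivity) ?_ ?_
    · refine this.trans ?_
      have h2 : (σ / 2) ^ (a - 1) / (σ / 2) = (σ / 2) ^ (a - 2) := by
        rw [← Real.rpow_sub_one (by positivity)]; congr 1; ring
      rw [mul_div_assoc, h2, Real.div_rpow hσ.le (by norm_num)]
      have h3 : (1 / 8 : ℝ) ≤ 2 ^ (a - 2) := by
        calc (1 / 8 : ℝ) ≤ (2:ℝ) ^ (-2 : ℝ) := by
              rw [Real.rpow_neg (by norm_num)]; norm_num
          _ ≤ 2 ^ (a - 2) := Real.rpow_le_rpow_of_exponent_le (by norm_num) (by linarith [ha.1])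
      have h4 : 0 < (2:ℝ) ^ (a - 2) := by positivity
      rw [← mul_div_assoc, div_le_iff₀ h4]
      have h5 : 0 ≤ c * N * σ ^ (a - 2) := by positivity
      nlinarith
    · refine (hd.mono ?_).diffContOnCl
      rw [closure_ball _ (by positivity)]
      exact fun v hv => by have := hcb v hv; show 0 < v.im; linarith
    · intro v hv
      have hv' := hcb v (Metric.sphere_subset_closedBall hv)
      refine (hb N φ hφ hper v (by linarith)).trans ?_
      gcongr
      have hv0 : 0 < v.im := by linarith
      calc v.im ^ (a - 1) / (1 + v.im ^ 2) ≤ v.im ^ (a - 1) :=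
            div_le_self (by positivity) (by nlinarith)
        _ ≤ (σ / 2) ^ (a - 1) :=
            Real.rpow_le_rpow_of_nonpos (by positivity) hv' (by linarith [ha.2])
  exact (halfplane_convex σ).norm_image_sub_le_of_norm_deriv_le (f := hI φ) (𝕜 := ℂ)
    (fun w hw => hd.differentiableAt (ho.mem_nhds (hσ.trans_le hw))) hder hz' hz

/-- Real part of the extension as a Poisson integral. -/
theorem two_re_gI (hφ : Continuous φ) (hm : ∫ t in (0:ℝ)..1, φ t = 0) {z : ℂ} (hz : 0 < z.im) :
    2 * (gI φ z).re = ∫ t in (0:ℝ)..1, (1 + 2 * (kern (z - t)).re) * φ t := by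
  have hk := kern_sub_continuous hz
  have h1 : (gI φ z).re = ∫ t in (0:ℝ)..1, (kern (z - t)).re * φ t := by
    have := Complex.reCLM.intervalIntegral_comp_comm (μ := volume) (a := 0) (b := 1)
      (f := fun t : ℝ => kern (z - t) * φ t) ((hk.mul (by fun_prop)).intervalIntegrable _ _)
    simp only [Complex.reCLM_apply, Complex.re_mul_ofReal] at this
    rw [this, gI]
  have hkr : Continuous fun t : ℝ => (kern (z - t)).re := Complex.continuous_re.comp hk
  have h2 : ∀ t : ℝ, (1 + 2 * (kern (z - t)).re) * φ t = φ t + 2 * ((kern (z - t)).re * φ t) :=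
    fun t => by ring
  simp only [h2]
  rw [intervalIntegral.integral_add (hφ.intervalIntegrable _ _)
    ((by fun_prop : Continuous fun t : ℝ => 2 * ((kern (z - t)).re * φ t)).intervalIntegrable _ _),
    intervalIntegral.integral_const_mul, hm, h1, zero_add]

theorem integral_poisson {z : ℂ} (hz : 0 < z.im) :
    ∫ t in (0:ℝ)..1, (1 + 2 * (kern (z - t)).re) = 1 := by
  have hk := kern_sub_continuous hz
  have hkr : Continuous fun t : ℝ => (kern (z - t)).re := Complex.continuous_re.comp hk
  have := Complex.reCLM.intervalIntegral_comp_comm (μ := volume) (a := 0) (b := 1)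
      (f := fun t : ℝ => kern (z - t)) (hk.intervalIntegrable _ _)
  simp only [Complex.reCLM_apply, integral_kern hz, zero_re] at this
  rw [intervalIntegral.integral_add (by simp)
    ((by fun_prop : Continuous fun t : ℝ => 2 * (kern (z - t)).re).intervalIntegrable _ _),
    intervalIntegral.integral_const_mul, this]
  simp

end KernelIntegrals

section SliceIntegrals

open Complex MeasureTheory

variable {a N : ℝ}

/-- Majorant for differences of slices of the gradient of the potential. -/
def mm (a ρ σ : ℝ) : ℝ := if σ ≤ ρ then σ ^ (a - 1) else ρ * σ ^ (a - 2)

theorem mm_integral (ha : a ∈ Ioo (0:ℝ) 1) {ρ : ℝ} (hρ : 0 < ρ) :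
    IntegrableOn (mm a ρ) (Ioi 0) ∧ ∫ σ in Ioi 0, mm a ρ σ = (1 / a + 1 / (1 - a)) * ρ ^ a := by
  have e1 : EqOn (fun σ : ℝ => σ ^ (a - 1)) (mm a ρ) (Ioc 0 ρ) := fun σ hσ => by
    rw [mm, if_pos hσ.2]
  have e2 : EqOn (fun σ : ℝ => ρ * σ ^ (a - 2)) (mm a ρ) (Ioi ρ) := fun σ hσ => by
    rw [mm, if_neg (not_le.2 hσ)]
  have i1 : IntegrableOn (mm a ρ) (Ioc 0 ρ) := by
    refine IntegrableOn.congr_fun ?_ e1 measurableSet_Ioc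
    exact (intervalIntegrable_iff_integrableOn_Ioc_of_le hρ.le).1
      (intervalIntegral.intervalIntegrable_rpow' (by linarith [ha.1]))
  have i2 : IntegrableOn (mm a ρ) (Ioi ρ) := by
    refine IntegrableOn.congr_fun ?_ e2 measurableSet_Ioi
    exact (integrableOn_Ioi_rpow_of_lt (by linarith [ha.2]) hρ).const_mul ρ
  rw [← Ioc_union_Ioi_eq_Ioi hρ.le]
  refine ⟨i1.union i2, ?_⟩
  rw [setIntegral_union (Ioc_disjoint_Ioi le_rfl) measurableSet_Ioi i1 i2,
    ← setIntegral_congr_fun measurableSet_Ioc e1, ← setIntegral_congr_fun measurableSet_Ioi e2,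
    ← intervalIntegral.integral_of_le hρ.le, integral_rpow (Or.inl (by linarith [ha.1])),
    integral_const_mul, integral_Ioi_rpow_of_lt (by linarith [ha.2]) hρ]
  have h1 : a - 1 + 1 = a := by ring
  have h2 : a - 2 + 1 = a - 1 := by ring
  rw [h1, h2, Real.zero_rpow ha.1.ne', Real.rpow_sub_one hρ.ne']
  have h3 : a ≠ 0 := ha.1.ne'
  have h4 : 1 - a ≠ 0 := by linarith [ha.2]
  have h5 : a - 1 ≠ 0 := by linarith [ha.2]
  have h6 : (-(1:ℝ)) / (a - 1) = 1 / (1 - a) := by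
    rw [div_eq_div_iff h5 h4]; ring
  have h7 : ρ * (-(ρ ^ a / ρ) / (a - 1)) = ρ ^ a * (-1 / (a - 1)) := by field_simp
  rw [h7, h6]; ring

theorem integral_Iio_sub (f : ℝ → ℝ) (y : ℝ) :
    ∫ s in Iio y, f (y - s) = ∫ σ in Ioi 0, f σ := by
  rw [← integral_indicator measurableSet_Iio, ← integral_indicator measurableSet_Ioi,
    ← integral_sub_left_eq_self (fun σ => (Ioi (0:ℝ)).indicator f σ) volume y]
  refine integral_congr_ae (Filter.Eventually.of_forall fun s => ?_)
  simp only [indicator, mem_Iio, mem_Ioi, sub_pos]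

theorem integrableOn_Iio_sub {f : ℝ → ℝ} (y : ℝ) (h : IntegrableOn f (Ioi 0)) :
    IntegrableOn (fun s => f (y - s)) (Iio y) := by
  rw [← integrable_indicator_iff measurableSet_Iio]
  rw [← integrable_indicator_iff measurableSet_Ioi] at h
  refine (h.comp_sub_left y).congr (Filter.Eventually.of_forall fun s => ?_)
  simp only [indicator, mem_Iio, mem_Ioi, sub_pos]

theorem hI_mm (ha : a ∈ Ioo (0:ℝ) 1) : ∃ c > (0:ℝ), ∀ N φ, Hol univ a N φ → Per φ →
    (∀ (z : ℂ) (σ : ℝ), 0 < σ → σ ≤ z.im → ‖hI φ z‖ ≤ c * N * mm a 1 σ) ∧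
    (∀ (z : ℂ) (σ ρ : ℝ), 0 < σ → σ ≤ ρ → σ ≤ z.im → ‖hI φ z‖ ≤ c * N * mm a ρ σ) ∧
    ∀ (z z' : ℂ) (σ ρ : ℝ), 0 < σ → ‖z - z'‖ ≤ ρ → σ ≤ z.im → σ ≤ z'.im →
      ‖hI φ z - hI φ z'‖ ≤ c * N * mm a ρ σ := by
  obtain ⟨c, hc, hb⟩ := hI_bound ha
  obtain ⟨c', hc', hl⟩ := hI_lip ha
  refine ⟨2 * c + c', by positivity, fun N φ hφ hper => ?_⟩
  have hN := hφ.nonneg ⟨0, mem_univ _⟩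
  have hr : ∀ (z : ℂ) (σ : ℝ), 0 < σ → σ ≤ z.im → ‖hI φ z‖ ≤ c * N * σ ^ (a - 1) :=
    fun z σ h0 hz => by
      refine (hb N φ hφ hper z (h0.trans_le hz)).trans ?_
      gcongr
      have hz0 := h0.trans_le hz
      calc z.im ^ (a - 1) / (1 + z.im ^ 2) ≤ z.im ^ (a - 1) :=
            div_le_self (by positivity) (by nlinarith)
        _ ≤ _ := Real.rpow_le_rpow_of_nonpos h0 hz (by linarith [ha.2])
  refine ⟨fun z σ h0 hz => ?_, fun z σ ρ h0 h1 hz => ?_, fun z z' σ ρ h0 hzz hz hz' => ?_⟩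
  · rw [mm]
    split_ifs with h
    · refine (hr z σ h0 hz).trans ?_
      gcongr; linarith
    · refine (hb N φ hφ hper z (h0.trans_le hz)).trans ?_
      have hz0 := h0.trans_le hz
      rw [one_mul]
      refine mul_le_mul (by nlinarith) ?_ (by positivity) (by positivity)
      calc z.im ^ (a - 1) / (1 + z.im ^ 2) ≤ z.im ^ (a - 1) / z.im := by
            gcongr; nlinarith
        _ = z.im ^ (a - 2) := by rw [← Real.rpow_sub_one hz0.ne']; congr 1; ring
        _ ≤ _ := Real.rpow_le_rpow_of_nonpos h0 hz (by linarith [ha.2])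
  · rw [mm, if_pos h1]
    refine (hr z σ h0 hz).trans ?_
    gcongr; linarith
  · rw [mm]
    split_ifs with h
    · refine (norm_sub_le _ _).trans ((add_le_add (hr z σ h0 hz) (hr z' σ h0 hz')).trans ?_)
      have : 0 ≤ N * σ ^ (a - 1) := by positivity
      nlinarith
    · refine (hl N φ hφ hper σ h0 z hz z' hz').trans ?_
      have : 0 ≤ N * σ ^ (a - 2) := by positivity
      calc c' * N * σ ^ (a - 2) * ‖z - z'‖ ≤ c' * N * σ ^ (a - 2) * ρ := by gcongr
        _ = c' * N * (ρ * σ ^ (a - 2)) := by ring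
        _ ≤ _ := by
          have hρ : 0 ≤ ρ := (norm_nonneg _).trans hzz
          gcongr
          linarith

/-- A measurable family of periodic Hölder densities. -/
structure Fam (a N : ℝ) (F : ℝ → ℝ → ℝ) : Prop where
  hol : ∀ s, Hol univ a N (F s)
  per : ∀ s, Per (F s)
  meas : Measurable (Function.uncurry F)

theorem Fam.continuous {F : ℝ → ℝ → ℝ} (h : Fam a N F) (ha : 0 < a) (s : ℝ) : Continuous (F s) :=
  continuousOn_univ.1 ((h.hol s).continuousOn ha)

/-- Superposition of the slice potentials below height `y`. -/
def Bc (F : ℝ → ℝ → ℝ) (y : ℝ) (ζ : ℂ) : ℂ := ∫ s in Iio y, gI (F s) (ζ - s * I)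

/-- Superposition of the derivatives of the slice potentials below height `y`. -/
def Gc (F : ℝ → ℝ → ℝ) (y : ℝ) (ζ : ℂ) : ℂ := ∫ s in Iio y, hI (F s) (ζ - s * I)

theorem slice_stronglyMeasurable {K : ℂ → ℂ} (hK : Measurable K) {F : ℝ → ℝ → ℝ}
    (hF : Measurable (Function.uncurry F)) (ζ : ℂ) :
    StronglyMeasurable fun s : ℝ => ∫ t in (0:ℝ)..1, K (ζ - s * I - t) * F s t := by
  have h1 : Measurable fun q : ℝ × ℝ => K (ζ - q.1 * I - q.2) * F q.1 q.2 := by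
    have h2 : Measurable fun q : ℝ × ℝ => (ζ - q.1 * I - q.2 : ℂ) := by fun_prop
    exact (hK.comp h2).mul (Complex.measurable_ofReal.comp hF)
  have := h1.stronglyMeasurable.integral_prod_right' (ν := volume.restrict (Ioc (0:ℝ) 1))
  simpa only [intervalIntegral.integral_of_le zero_le_one] using this

theorem gI_slice_meas {F : ℝ → ℝ → ℝ} (hF : Fam a N F) (ζ : ℂ) :
    StronglyMeasurable fun s : ℝ => gI (F s) (ζ - s * I) :=
  slice_stronglyMeasurable kern_measurable hF.meas ζ

theorem hI_slice_meas {F : ℝ → ℝ → ℝ} (hF : Fam a N F) (ζ : ℂ) :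
    StronglyMeasurable fun s : ℝ => hI (F s) (ζ - s * I) :=
  slice_stronglyMeasurable kern'_measurable hF.meas ζ

/-- Size and Hölder continuity of the superposed derivatives. -/
theorem Gc_estimates (ha : a ∈ Ioo (0:ℝ) 1) : ∃ c > (0:ℝ), ∀ N F, Fam a N F →
    (∀ (ζ : ℂ) (y : ℝ), y ≤ ζ.im → IntegrableOn (fun s : ℝ => hI (F s) (ζ - s * I)) (Iio y)) ∧
    (∀ (ζ : ℂ) (y : ℝ), y ≤ ζ.im → ‖Gc F y ζ‖ ≤ c * N) ∧
    ∀ (ζ ζ' : ℂ) (y y' ρ : ℝ), 0 < ρ → y ≤ ζ.im → y' ≤ ζ'.im → ‖ζ - ζ'‖ ≤ ρ → |y - y'| ≤ ρ →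
      ‖Gc F y ζ - Gc F y' ζ'‖ ≤ c * N * ρ ^ a := by
  obtain ⟨c, hc, hb⟩ := hI_mm ha
  set k : ℝ := 1 / a + 1 / (1 - a) with hk
  have hk0 : 0 < k := by
    have h1 := ha.1
    have h2 : 0 < 1 - a := by linarith [ha.2]
    positivity
  refine ⟨2 * (c * k), by positivity, fun N F hF => ?_⟩
  have hN := (hF.hol 0).nonneg ⟨0, mem_univ _⟩
  have him : ∀ (ζ : ℂ) (s : ℝ), (ζ - s * I).im = ζ.im - s := fun ζ s => by simp
  have hmi : ∀ y ρ : ℝ, 0 < ρ → IntegrableOn (fun s => c * N * mm a ρ (y - s)) (Iio y) :=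
    fun y ρ hρ => (integrableOn_Iio_sub y (mm_integral ha hρ).1).const_mul _
  have hmv : ∀ y ρ : ℝ, 0 < ρ → ∫ s in Iio y, c * N * mm a ρ (y - s) = c * k * N * ρ ^ a :=
    fun y ρ hρ => by
      rw [integral_const_mul, integral_Iio_sub, (mm_integral ha hρ).2]; ring
  have hb1 : ∀ (ζ : ℂ) (y : ℝ), y ≤ ζ.im → ∀ s ∈ Iio y,
      ‖hI (F s) (ζ - s * I)‖ ≤ c * N * mm a 1 (y - s) := fun ζ y hy s hs =>
    (hb N (F s) (hF.hol s) (hF.per s)).1 _ _ (sub_pos.2 hs) (by rw [him]; linarith)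
  have hint : ∀ (ζ : ℂ) (y : ℝ), y ≤ ζ.im →
      IntegrableOn (fun s : ℝ => hI (F s) (ζ - s * I)) (Iio y) := fun ζ y hy =>
    (hmi y 1 one_pos).mono' (hI_slice_meas hF ζ).aestronglyMeasurable
      ((ae_restrict_iff' measurableSet_Iio).2 (Filter.Eventually.of_forall (hb1 ζ y hy)))
  have key : ∀ (ζ ζ' : ℂ) (y y' ρ : ℝ), 0 < ρ → y ≤ ζ.im → y' ≤ ζ'.im → ‖ζ - ζ'‖ ≤ ρ →
      |y - y'| ≤ ρ → y ≤ y' → ‖Gc F y ζ - Gc F y' ζ'‖ ≤ 2 * (c * k) * N * ρ ^ a := by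
    intro ζ ζ' y y' ρ hρ hy hy' hζ hyy hle
    have hsub : Iio y ⊆ Iio y' := Iio_subset_Iio hle
    have e1 : Gc F y' ζ' = (∫ s in Iio y, hI (F s) (ζ' - s * I))
        + ∫ s in Ico y y', hI (F s) (ζ' - s * I) := by
      rw [Gc, ← Iio_union_Ico_eq_Iio hle, setIntegral_union (by
        rw [disjoint_left]; intro s hs hs'; exact absurd hs (not_lt.2 hs'.1)) measurableSet_Ico
        ((hint ζ' y' hy').mono_set hsub) ((hint ζ' y' hy').mono_set Ico_subset_Iio_self)]
    have e2 : Gc F y ζ - Gc F y' ζ' = (∫ s in Iio y, (hI (F s) (ζ - s * I) - hI (F s) (ζ' - s * I)))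
        - ∫ s in Ico y y', hI (F s) (ζ' - s * I) := by
      rw [e1, Gc, integral_sub (hint ζ y hy) ((hint ζ' y' hy').mono_set hsub)]; ring
    have n1 : ‖∫ s in Iio y, (hI (F s) (ζ - s * I) - hI (F s) (ζ' - s * I))‖
        ≤ c * k * N * ρ ^ a := by
      rw [← hmv y ρ hρ]
      refine norm_integral_le_of_norm_le (hmi y ρ hρ) ((ae_restrict_iff' measurableSet_Iio).2
        (Filter.Eventually.of_forall fun s hs => ?_))
      refine (hb N (F s) (hF.hol s) (hF.per s)).2.2 _ _ _ _ (sub_pos.2 hs) ?_ ?_ ?_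
      · rwa [sub_sub_sub_cancel_right]
      · rw [him]; linarith
      · rw [him]; linarith
    have n2 : ‖∫ s in Ico y y', hI (F s) (ζ' - s * I)‖ ≤ c * k * N * ρ ^ a := by
      refine (norm_integral_le_of_norm_le ((hmi y' ρ hρ).mono_set Ico_subset_Iio_self)
        ((ae_restrict_iff' measurableSet_Ico).2
        (Filter.Eventually.of_forall fun s hs => ?_))).trans ?_
      · refine (hb N (F s) (hF.hol s) (hF.per s)).2.1 _ (y' - s) ρ (sub_pos.2 hs.2) ?_ ?_
        · have := (abs_le.1 hyy).1
          linarith [hs.1]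
        · rw [him]; linarith
      · rw [← hmv y' ρ hρ]
        refine setIntegral_mono_set (hmi y' ρ hρ) ((ae_restrict_iff' measurableSet_Iio).2
          (Filter.Eventually.of_forall fun s hs => ?_)) (Ico_subset_Iio_self.eventuallyLE)
        have hs' : 0 < y' - s := sub_pos.2 hs
        have : 0 ≤ mm a ρ (y' - s) := by rw [mm]; split_ifs <;> positivity
        simp only [Pi.zero_apply]
        positivity
    rw [e2]
    exact (norm_sub_le _ _).trans (by linarith)
  refine ⟨hint, fun ζ y hy => ?_, fun ζ ζ' y y' ρ hρ hy hy' hζ hyy => ?_⟩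
  · have := norm_integral_le_of_norm_le (hmi y 1 one_pos) ((ae_restrict_iff' measurableSet_Iio).2
      (Filter.Eventually.of_forall (hb1 ζ y hy)))
    rw [hmv y 1 one_pos, Real.one_rpow] at this
    have h0 : 0 ≤ c * k * N := by positivity
    exact this.trans (by linarith)
  · rcases le_total y y' with h | h
    · exact key ζ ζ' y y' ρ hρ hy hy' hζ hyy h
    · rw [norm_sub_rev]
      exact key ζ' ζ y' y ρ hρ hy' hy (by rwa [norm_sub_rev]) (by rwa [abs_sub_comm]) h

end SliceIntegrals

section Potential

open Complex MeasureTheory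

variable {a N : ℝ} {F : ℝ → ℝ → ℝ}

theorem slice_im (ζ : ℂ) (s : ℝ) : (ζ - s * I).im = ζ.im - s := by simp

theorem gI_slice_bound (hF : Fam a N F) {ζ : ℂ} {s δ : ℝ} (hδ : 0 < δ) (h : δ ≤ ζ.im - s) :
    ‖gI (F s) (ζ - s * I)‖ ≤ (1 + δ⁻¹) * N / (1 + (ζ.im - s) ^ 2) := by
  have := gI_bound (φ := F s) (N := N) (z := ζ - s * I) hδ
    (fun t => (hF.hol s).1 t (mem_univ _)) (by rwa [slice_im])
  rwa [slice_im] at this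

theorem gI_slice_integrable (hF : Fam a N F) {ζ : ℂ} {y : ℝ} (hy : y < ζ.im) :
    IntegrableOn (fun s : ℝ => gI (F s) (ζ - s * I)) (Iio y) := by
  have h0 : 0 < ζ.im - y := sub_pos.2 hy
  have h1 : Integrable fun s : ℝ => (1 + (ζ.im - y)⁻¹) * N * (1 + (ζ.im - s) ^ 2)⁻¹ :=
    (integrable_inv_one_add_sq.comp_sub_left ζ.im).const_mul _
  refine h1.integrableOn.mono' (gI_slice_meas hF ζ).aestronglyMeasurable
    ((ae_restrict_iff' measurableSet_Iio).2 (Filter.Eventually.of_forall fun s hs => ?_))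
  have hs' : s < y := hs
  have := gI_slice_bound hF (s := s) h0 (by linarith)
  rwa [div_eq_mul_inv] at this

theorem Bc_hasDerivAt (ha : a ∈ Ioo (0:ℝ) 1) (hF : Fam a N F) {ζ : ℂ} {y : ℝ} (hy : y < ζ.im) :
    HasDerivAt (Bc F y) (Gc F y ζ) ζ := by
  obtain ⟨c, hc, hb⟩ := hI_mm ha
  have h0 : 0 < ζ.im - y := sub_pos.2 hy
  have hball : ∀ w ∈ Metric.ball ζ (ζ.im - y), y < w.im := fun w hw => by
    have h1 : |w.im - ζ.im| ≤ dist w ζ := by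
      rw [Complex.dist_eq, ← sub_im]; exact abs_im_le_norm _
    have := (abs_lt.1 (h1.trans_lt (Metric.mem_ball.1 hw))).1
    linarith
  refine (hasDerivAt_integral_of_dominated_loc_of_deriv_le (μ := volume.restrict (Iio y))
    (F := fun w (s : ℝ) => gI (F s) (w - s * I)) (F' := fun w (s : ℝ) => hI (F s) (w - s * I))
    (bound := fun s => c * N * mm a 1 (y - s)) (Metric.ball_mem_nhds ζ h0) ?_ ?_ ?_ ?_ ?_ ?_).2
  · exact Filter.Eventually.of_forall fun w => (gI_slice_meas hF w).aestronglyMeasurable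
  · exact gI_slice_integrable hF hy
  · exact (hI_slice_meas hF ζ).aestronglyMeasurable
  · refine (ae_restrict_iff' measurableSet_Iio).2 (Filter.Eventually.of_forall fun s hs w hw => ?_)
    exact (hb N (F s) (hF.hol s) (hF.per s)).1 _ _ (sub_pos.2 hs)
      (by rw [slice_im]; linarith [hball w hw])
  · exact (integrableOn_Iio_sub y (mm_integral ha one_pos).1).const_mul _
  · refine (ae_restrict_iff' measurableSet_Iio).2 (Filter.Eventually.of_forall fun s hs w hw => ?_)
    have hs' : s < y := hs
    exact HasDerivAt.comp_sub_const w (s * I : ℂ)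
      (gI_hasDerivAt (hF.continuous ha.1 s) (by rw [slice_im]; linarith [hball w hw]))

/-- The shifted complex coordinate. -/
def shiftC (δ : ℝ) (z : ℝ × ℝ) : ℂ := z.1 + (z.2 + δ : ℝ) * I

@[simp] theorem shiftC_im (δ : ℝ) (z : ℝ × ℝ) : (shiftC δ z).im = z.2 + δ := by
  simp [shiftC]

theorem shiftC_continuous (δ : ℝ) : Continuous (shiftC δ) := by unfold shiftC; fun_prop

theorem shiftC_sub (δ δ' : ℝ) (z z' : ℝ × ℝ) :
    ‖shiftC δ z - shiftC δ' z'‖ ≤ 2 * ‖z - z'‖ + |δ - δ'| := by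
  have h : shiftC δ z - shiftC δ' z' = ((z.1 - z'.1 : ℝ) : ℂ) + ((z.2 - z'.2 + (δ - δ') : ℝ) : ℂ) * I := by
    simp only [shiftC]; push_cast; ring
  rw [h]
  refine (norm_add_le _ _).trans ?_
  rw [norm_mul, norm_I, mul_one, norm_real, norm_real, Real.norm_eq_abs, Real.norm_eq_abs]
  have h1 : |z.1 - z'.1| ≤ ‖z - z'‖ := norm_fst_le (z - z')
  have h2 : |z.2 - z'.2| ≤ ‖z - z'‖ := norm_snd_le (z - z')
  have h3 := abs_add_le (z.2 - z'.2) (δ - δ')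
  linarith

/-- `(ξ, η) ↦ ξ + iη`. -/
def toC : ℝ × ℝ →L[ℝ] ℂ :=
  Complex.ofRealCLM.comp (ContinuousLinearMap.fst ℝ ℝ ℝ)
    + (Complex.ofRealCLM.comp (ContinuousLinearMap.snd ℝ ℝ ℝ)).smulRight I

@[simp] theorem toC_apply (z : ℝ × ℝ) : toC z = z.1 + z.2 * I := by simp [toC]

theorem shiftC_hasFDerivAt (δ : ℝ) (z : ℝ × ℝ) : HasFDerivAt (shiftC δ) toC z := by
  have : shiftC δ = fun z => toC z + δ * I := by
    ext z; simp only [shiftC, toC_apply]; push_cast; ring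
  rw [this]
  exact toC.hasFDerivAt.add_const _

/-- The shifted potential as a function on the plane. -/
def Bp (F : ℝ → ℝ → ℝ) (δ : ℝ) (z : ℝ × ℝ) : ℂ := Bc F z.2 (shiftC δ z)

/-- The remainder of the potential across a change of height. -/
theorem Bc_sub (hF : Fam a N F) {ζ : ℂ} {y y0 : ℝ} (hy : y < ζ.im) (hy0 : y0 < ζ.im) :
    Bc F y ζ = Bc F y0 ζ + ∫ s in y0..y, gI (F s) (ζ - s * I) := by
  rw [Bc, Bc, ← integral_Iic_eq_integral_Iio, ← integral_Iic_eq_integral_Iio,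
    ← intervalIntegral.integral_Iic_sub_Iic]
  · ring
  · exact (integrableOn_Iic_iff_integrableOn_Iio).2 (gI_slice_integrable hF hy0)
  · exact (integrableOn_Iic_iff_integrableOn_Iio).2 (gI_slice_integrable hF hy)

theorem Bp_near {δ : ℝ} (hδ : 0 < δ) (hF : Fam a N F) (z0 : ℝ × ℝ) :
    ∀ᶠ z in nhds z0, Bp F δ z = Bc F z0.2 (shiftC δ z)
      + ∫ s in z0.2..z.2, gI (F s) (shiftC δ z - s * I) := by
  have : ∀ᶠ z : ℝ × ℝ in nhds z0, z0.2 - δ < z.2 :=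
    continuous_snd.continuousAt.eventually (lt_mem_nhds (by linarith : z0.2 - δ < z0.2))
  filter_upwards [this] with z hz
  exact Bc_sub hF (by rw [shiftC_im]; linarith) (by rw [shiftC_im]; linarith)

theorem between_im {δ : ℝ} {z z0 : ℝ × ℝ} (h : |z.2 - z0.2| < δ / 2) {s : ℝ}
    (hs : s ∈ uIoc z0.2 z.2) : δ / 2 ≤ (shiftC δ z).im - s ∧ |s - z0.2| ≤ |z.2 - z0.2|
      ∧ |z.2 - s| ≤ |z.2 - z0.2| := by
  rw [shiftC_im]
  have h1 := abs_lt.1 h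
  rcases le_total z0.2 z.2 with h2 | h2
  · rw [uIoc_of_le h2] at hs
    rw [abs_of_nonneg (by linarith [hs.1] : 0 ≤ s - z0.2), abs_of_nonneg (sub_nonneg.2 h2),
      abs_of_nonneg (by linarith [hs.2] : 0 ≤ z.2 - s)]
    refine ⟨?_, ?_, ?_⟩ <;> linarith [hs.1, hs.2]
  · rw [uIoc_of_ge h2] at hs
    rw [abs_of_nonpos (by linarith [hs.2] : s - z0.2 ≤ 0), abs_of_nonpos (sub_nonpos.2 h2),
      abs_of_nonpos (by linarith [hs.1] : z.2 - s ≤ 0)]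
    refine ⟨?_, ?_, ?_⟩ <;> linarith [hs.1, hs.2]

theorem slice_norm_le (hF : Fam a N F) {δ : ℝ} (hδ : 0 < δ) {z z0 : ℝ × ℝ}
    (h : |z.2 - z0.2| < δ / 2) {s : ℝ} (hs : s ∈ uIoc z0.2 z.2) :
    ‖gI (F s) (shiftC δ z - s * I)‖ ≤ (1 + (δ / 2)⁻¹) * N := by
  have hN := (hF.hol 0).nonneg ⟨0, mem_univ _⟩
  refine (gI_slice_bound hF (half_pos hδ) (between_im h hs).1).trans
    (div_le_self (by positivity) ?_)
  nlinarith [sq_nonneg ((shiftC δ z).im - s)]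

theorem near_snd {δ : ℝ} (hδ : 0 < δ) (z0 : ℝ × ℝ) :
    ∀ᶠ z : ℝ × ℝ in nhds z0, |z.2 - z0.2| < δ / 2 := by
  have : ContinuousAt (fun z : ℝ × ℝ => |z.2 - z0.2|) z0 := by fun_prop
  exact this.eventually (gt_mem_nhds (by simpa using half_pos hδ))

theorem Bp_continuous (ha : a ∈ Ioo (0:ℝ) 1) {δ : ℝ} (hδ : 0 < δ) (hF : Fam a N F) :
    Continuous (Bp F δ) := by
  refine continuous_iff_continuousAt.2 fun z0 => ?_
  refine ContinuousAt.congr ?_ ((Bp_near hδ hF z0).mono fun _ h => h.symm)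
  refine ContinuousAt.add ?_ ?_
  · exact ContinuousAt.comp (f := shiftC δ)
      (Bc_hasDerivAt ha hF (by rw [shiftC_im]; linarith)).continuousAt
      (shiftC_continuous δ).continuousAt
  · have h0 : ∫ s in z0.2..z0.2, gI (F s) (shiftC δ z0 - s * I) = 0 := intervalIntegral.integral_same
    rw [ContinuousAt, h0]
    refine squeeze_zero_norm' (a := fun z => (1 + (δ / 2)⁻¹) * N * |z.2 - z0.2|) ?_ ?_
    · filter_upwards [near_snd hδ z0] with z hz
      exact intervalIntegral.norm_integral_le_of_norm_le_const fun s hs => slice_norm_le hF hδ hz hs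
    · have : Continuous fun z : ℝ × ℝ => (1 + (δ / 2)⁻¹) * N * |z.2 - z0.2| := by fun_prop
      simpa using this.tendsto z0

theorem Bp_hasFDerivAt (ha : a ∈ Ioo (0:ℝ) 1) {δ : ℝ} (hδ : 0 < δ) (hF : Fam a N F) {z0 : ℝ × ℝ}
    (hc : ∀ e > (0:ℝ), ∀ᶠ s in nhds z0.2, ∀ t, |F s t - F z0.2 t| ≤ e) :
    HasFDerivAt (Bp F δ) (Gc F z0.2 (shiftC δ z0) • toC
      + (Complex.ofRealCLM.comp (ContinuousLinearMap.snd ℝ ℝ ℝ)).smulRight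
        (gI (F z0.2) (z0.1 + δ * I))) z0 := by
  refine HasFDerivAt.congr_of_eventuallyEq ?_ (Bp_near hδ hF z0)
  refine HasFDerivAt.add ?_ ?_
  · have h1 := (Bc_hasDerivAt (y := z0.2) (ζ := shiftC δ z0) ha hF
      (by rw [shiftC_im]; linarith)).hasFDerivAt.restrictScalars ℝ
    refine (h1.comp z0 (shiftC_hasFDerivAt δ z0)).congr_fderiv ?_
    refine ContinuousLinearMap.ext fun z => ?_
    simp [mul_comm]
  · refine HasFDerivAt.of_isLittleO (Asymptotics.isLittleO_iff.2 fun e he => ?_)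
    set w0 : ℂ := z0.1 + δ * I with hw0
    have hw0im : 0 < w0.im := by simp [hw0, hδ]
    set k := (1 + (δ / 2)⁻¹) with hk
    have hk0 : 0 < k := by positivity
    have hg : ContinuousAt (gI (F z0.2)) w0 :=
      (gI_hasDerivAt (hF.continuous ha.1 _) hw0im).continuousAt
    obtain ⟨r, hr, hgr⟩ := Metric.continuousAt_iff.1 hg (e / 2) (half_pos he)
    obtain ⟨q, hq, hqq⟩ := Metric.eventually_nhds_iff.1 (hc (e / 2 / k) (by positivity))
    have hz1 : ∀ᶠ z : ℝ × ℝ in nhds z0, ‖z - z0‖ < min (r / 2) q := by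
      filter_upwards [Metric.ball_mem_nhds z0 (lt_min (half_pos hr) hq)] with z hz
      rwa [mem_ball_iff_norm] at hz
    filter_upwards [near_snd hδ z0, hz1] with z hz hzq
    rw [intervalIntegral.integral_same, sub_zero]
    have hmeas : IntervalIntegrable (fun s : ℝ => gI (F s) (shiftC δ z - s * I)) volume z0.2 z.2 := by
      refine (intervalIntegrable_const (c := k * N)).mono_fun
        (gI_slice_meas hF _).aestronglyMeasurable ?_
      refine (ae_restrict_iff' measurableSet_uIoc).2 (Filter.Eventually.of_forall fun s hs => ?_)
      exact (slice_norm_le hF hδ hz hs).trans (le_abs_self _)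
    have e1 : (∫ s in z0.2..z.2, gI (F s) (shiftC δ z - s * I))
        - ((Complex.ofRealCLM.comp (ContinuousLinearMap.snd ℝ ℝ ℝ)).smulRight
          (gI (F z0.2) w0)) (z - z0)
        = ∫ s in z0.2..z.2, (gI (F s) (shiftC δ z - s * I) - gI (F z0.2) w0) := by
      rw [intervalIntegral.integral_sub hmeas intervalIntegrable_const,
        intervalIntegral.integral_const]
      simp
    rw [e1]
    have hn : |z.2 - z0.2| ≤ ‖z - z0‖ := norm_snd_le (z - z0)
    have hn1 : |z.1 - z0.1| ≤ ‖z - z0‖ := norm_fst_le (z - z0)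
    refine (intervalIntegral.norm_integral_le_of_norm_le_const (C := e) fun s hs => ?_).trans
      (by gcongr)
    obtain ⟨hs1, hs2, hs3⟩ := between_im hz hs
    have him : δ / 2 ≤ (shiftC δ z - s * I).im := by rwa [slice_im]
    have him0 : 0 < (shiftC δ z - s * I).im := (half_pos hδ).trans_le him
    have t1 : ‖gI (F s) (shiftC δ z - s * I) - gI (F z0.2) (shiftC δ z - s * I)‖ ≤ e / 2 := by
      rw [gI_sub (hF.continuous ha.1 _) (hF.continuous ha.1 _) him0]
      have h1 := hqq (y := s) (by
        rw [Real.dist_eq]; exact (hs2.trans hn).trans_lt (hzq.trans_le (min_le_right _ _)))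
      refine (gI_bound (half_pos hδ) h1 him).trans ?_
      rw [← hk]
      have : k * (e / 2 / k) = e / 2 := by field_simp
      rw [this]
      exact div_le_self (by positivity) (by nlinarith [sq_nonneg (shiftC δ z - s * I).im])
    have t2 : ‖gI (F z0.2) (shiftC δ z - s * I) - gI (F z0.2) w0‖ ≤ e / 2 := by
      have hd : dist (shiftC δ z - s * I) w0 < r := by
        have : shiftC δ z - s * I - w0 = ((z.1 - z0.1 : ℝ) : ℂ) + ((z.2 - s : ℝ) : ℂ) * I := by
          simp only [shiftC, hw0]; push_cast; ring
        rw [dist_eq_norm, this]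
        refine (norm_add_le _ _).trans_lt ?_
        rw [norm_mul, norm_I, mul_one, norm_real, norm_real, Real.norm_eq_abs, Real.norm_eq_abs]
        linarith [hzq.trans_le (min_le_left _ _)]
      have := hgr hd
      rw [dist_eq_norm] at this
      exact this.le
    calc _ ≤ _ := norm_sub_le_norm_sub_add_norm_sub _ (gI (F z0.2) (shiftC δ z - s * I)) _
      _ ≤ e := by linarith

end Potential

section Poisson

open Complex MeasureTheory

variable {a N : ℝ} {φ ψ : ℝ → ℝ}

/-- The Poisson average of a periodic density. -/
def Pp (φ : ℝ → ℝ) (δ x : ℝ) : ℝ := 2 * (gI φ (x + δ * I)).re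

/-- The centred Poisson weight. -/
def Pw (δ t : ℝ) : ℝ := 1 + 2 * (kern (δ * I - t)).re

theorem Pw_continuous {δ : ℝ} (hδ : 0 < δ) : Continuous (Pw δ) := by
  have : Continuous fun t : ℝ => (kern (δ * I - t)).re :=
    Complex.continuous_re.comp (kern_sub_continuous (by simpa using hδ))
  unfold Pw; fun_prop

theorem Pw_nonneg {δ : ℝ} (hδ : 0 < δ) (t : ℝ) : 0 ≤ Pw δ t :=
  poisson_nonneg (by simpa using hδ)

theorem Pp_center (hφ : Continuous φ) (hper : Per φ) (hm : ∫ t in (0:ℝ)..1, φ t = 0) {δ : ℝ}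
    (hδ : 0 < δ) (x : ℝ) : Pp φ δ x = ∫ t in (-1/2 : ℝ)..1/2, Pw δ t * φ (x + t) := by
  have hz : 0 < ((x : ℂ) + δ * I).im := by simpa using hδ
  rw [Pp, two_re_gI hφ hm hz]
  have hp : Function.Periodic (fun t : ℝ => (1 + 2 * (kern (x + δ * I - t)).re) * φ t) 1 := fun t => by
    have := kern_add_one (x + δ * I - (t + 1 : ℝ))
    simp only [hper t]
    rw [← this]
    push_cast
    ring_nf
  have h1 := hp.intervalIntegral_add_eq 0 (x + -1/2)
  rw [zero_add] at h1
  rw [h1, show x + -1/2 + 1 = x + 1/2 by ring, show x + -1/2 = x + (-1/2) by ring,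
    ← intervalIntegral.integral_comp_add_left
      (fun t : ℝ => (1 + 2 * (kern (x + δ * I - t)).re) * φ t)]
  refine intervalIntegral.integral_congr fun t _ => ?_
  have : (x : ℂ) + δ * I - (x + t : ℝ) = δ * I - t := by push_cast; ring
  simp only [this, Pw]

theorem Pw_integral {δ : ℝ} (hδ : 0 < δ) : ∫ t in (-1/2 : ℝ)..1/2, Pw δ t = 1 := by
  have hz : 0 < ((δ : ℂ) * I).im := by simpa using hδ
  have h2 := integral_poisson hz
  have hp : Function.Periodic (fun t : ℝ => (1 + 2 * (kern (δ * I - t)).re)) 1 := fun t => by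
    have := kern_add_one (δ * I - (t + 1 : ℝ))
    simp only []
    rw [← this]
    push_cast
    ring_nf
  have h1 := hp.intervalIntegral_add_eq 0 (-1/2)
  rw [zero_add] at h1
  rw [h1, show (-1/2 : ℝ) + 1 = 1/2 by norm_num] at h2
  exact h2

theorem Pp_sub_le (hφ : Continuous φ) (hper : Per φ) (hm : ∫ t in (0:ℝ)..1, φ t = 0)
    (hψ : Continuous ψ) (hperψ : Per ψ) (hmψ : ∫ t in (0:ℝ)..1, ψ t = 0) {δ : ℝ}
    (hδ : 0 < δ) {x x' e : ℝ} (h : ∀ t, |φ (x + t) - ψ (x' + t)| ≤ e) :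
    |Pp φ δ x - Pp ψ δ x'| ≤ e := by
  have hc := Pw_continuous hδ
  rw [Pp_center hφ hper hm hδ, Pp_center hψ hperψ hmψ hδ, ← intervalIntegral.integral_sub
    ((by fun_prop : Continuous fun t => Pw δ t * φ (x + t)).intervalIntegrable _ _)
    ((by fun_prop : Continuous fun t => Pw δ t * ψ (x' + t)).intervalIntegrable _ _)]
  refine (intervalIntegral.abs_integral_le_integral_abs (by norm_num)).trans ?_
  have : ∫ t in (-1/2 : ℝ)..1/2, Pw δ t * e = e := by
    rw [intervalIntegral.integral_mul_const, Pw_integral hδ, one_mul]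
  rw [← this]
  refine intervalIntegral.integral_mono_on (by norm_num)
    ((by fun_prop : Continuous fun t => |Pw δ t * φ (x + t) - Pw δ t * ψ (x' + t)|
      ).intervalIntegrable _ _)
    ((by fun_prop : Continuous fun t => Pw δ t * e).intervalIntegrable _ _) fun t _ => ?_
  rw [← mul_sub, abs_mul, abs_of_nonneg (Pw_nonneg hδ t)]
  exact mul_le_mul_of_nonneg_left (h t) (Pw_nonneg hδ t)

theorem Pp_lim (ha : a ∈ Ioo (0:ℝ) 1) : ∃ c > (0:ℝ), ∀ N φ, Hol univ a N φ → Per φ →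
    ∫ t in (0:ℝ)..1, φ t = 0 → ∀ δ : ℝ, 0 < δ → δ ≤ 1 → ∀ x : ℝ,
      |Pp φ δ x - φ x| ≤ c * N * δ ^ a := by
  obtain ⟨c, hc, h⟩ := exists_kern'_integral ha
  refine ⟨2 * Real.exp (2 * Real.pi) * c, by positivity, fun N φ hφ hper hm δ hδ hδ1 x => ?_⟩
  have hφc : Continuous φ := continuousOn_univ.1 (hφ.continuousOn ha.1)
  have hN := hφ.nonneg ⟨0, mem_univ _⟩
  have hcw := Pw_continuous hδ
  have hs : 0 < ((δ : ℂ) * I).im := by simpa using hδ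
  have hca : Continuous fun t : ℝ => |t| ^ a :=
    Continuous.rpow_const (by fun_prop) fun _ => Or.inr ha.1.le
  have hk := (kern'_sub_continuous hs).norm
  have e1 : Pp φ δ x - φ x = ∫ t in (-1/2 : ℝ)..1/2, Pw δ t * (φ (x + t) - φ x) := by
    simp only [mul_sub]
    rw [intervalIntegral.integral_sub
      ((by fun_prop : Continuous fun t => Pw δ t * φ (x + t)).intervalIntegrable _ _)
      ((by fun_prop : Continuous fun t => Pw δ t * φ x).intervalIntegrable _ _),
      intervalIntegral.integral_mul_const, Pw_integral hδ, one_mul, Pp_center hφc hper hm hδ]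
  rw [e1]
  refine (intervalIntegral.abs_integral_le_integral_abs (by norm_num)).trans ?_
  calc ∫ t in (-1/2 : ℝ)..1/2, |Pw δ t * (φ (x + t) - φ x)|
      ≤ ∫ t in (-1/2 : ℝ)..1/2,
          2 * Real.exp (2 * Real.pi) * δ * N * (‖kern' (δ * I - t)‖ * |t| ^ a) := by
        refine intervalIntegral.integral_mono_on (by norm_num)
          ((by fun_prop : Continuous fun t => |Pw δ t * (φ (x + t) - φ x)|).intervalIntegrable _ _)
          ((continuous_const.mul (hk.mul hca)).intervalIntegrable _ _) fun t _ => ?_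
        rw [abs_mul, abs_of_nonneg (Pw_nonneg hδ t)]
        have h1 := hφ.2 (x + t) (mem_univ _) x (mem_univ _)
        rw [add_sub_cancel_left, Real.norm_eq_abs, Real.norm_eq_abs] at h1
        have h2 := poisson_le (z := δ * I - t) (by simpa using hδ) (by simpa using hδ1)
        have h3 : (δ * I - t : ℂ).im = δ := by simp
        rw [h3] at h2
        calc Pw δ t * |φ (x + t) - φ x|
            ≤ (2 * Real.exp (2 * Real.pi) * δ * ‖kern' (δ * I - t)‖) * (N * |t| ^ a) := by
              refine mul_le_mul h2 h1 (abs_nonneg _) (by positivity)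
          _ = _ := by ring
    _ ≤ 2 * Real.exp (2 * Real.pi) * δ * N * (c * δ ^ (a - 1) / (1 + δ ^ 2)) := by
        rw [intervalIntegral.integral_const_mul]
        exact mul_le_mul_of_nonneg_left (h δ hδ) (by positivity)
    _ ≤ 2 * Real.exp (2 * Real.pi) * δ * N * (c * δ ^ (a - 1)) := by
        gcongr
        exact div_le_self (by positivity) (by nlinarith [sq_nonneg δ])
    _ = _ := by
        have : δ ^ a = δ * δ ^ (a - 1) := by
          rw [mul_comm, ← Real.rpow_add_one hδ.ne']; congr 1; ring
        rw [this]; ring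

end Poisson

section OddExtension

open MeasureTheory

variable {L a N : ℝ} {f : ℝ × ℝ → ℝ}

/-- The odd `2 * L`-periodic extension in the second variable. -/
def oddExt (L : ℝ) (f : ℝ × ℝ → ℝ) (s t : ℝ) : ℝ :=
  if 2 * L * Int.fract (s / (2 * L)) ≤ L then f (clamp L (t, 2 * L * Int.fract (s / (2 * L))))
  else -f (clamp L (t, 2 * L - 2 * L * Int.fract (s / (2 * L))))

theorem oddExt_add (hL : 0 < L) (s t : ℝ) : oddExt L f (s + 2 * L) t = oddExt L f s t := by
  have : (s + 2 * L) / (2 * L) = s / (2 * L) + 1 := by field_simp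
  simp only [oddExt, this, Int.fract_add_one]

theorem oddExt_pos (hL : 0 < L) {y : ℝ} (hy : y ∈ Icc 0 L) (t : ℝ) : oddExt L f y t = f (t, y) := by
  have h : Int.fract (y / (2 * L)) = y / (2 * L) :=
    Int.fract_eq_self.2 ⟨by have := hy.1; positivity, by
      rw [div_lt_one (by linarith)]; linarith [hy.2]⟩
  have h1 : 2 * L * (y / (2 * L)) = y := by field_simp
  rw [oddExt, h, h1, if_pos hy.2, clamp_pair hy]

theorem oddExt_neg (hL : 0 < L) {y : ℝ} (hy : y ∈ Ioo 0 L) (t : ℝ) :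
    oddExt L f (-y) t = -f (t, y) := by
  have h : Int.fract (-y / (2 * L)) = 1 - y / (2 * L) := by
    rw [← Int.fract_add_one, Int.fract_eq_self.2]
    · ring
    · have h0 : 0 < y / (2 * L) := div_pos hy.1 (by linarith)
      have h1 : y / (2 * L) < 1 := by rw [div_lt_one (by linarith)]; linarith [hy.2, hy.1]
      rw [neg_div]
      constructor <;> linarith
  have h1 : 2 * L * (1 - y / (2 * L)) = 2 * L - y := by field_simp
  rw [oddExt, h, h1, if_neg (by linarith [hy.2]), sub_sub_cancel,
    clamp_pair ⟨hy.1.le, hy.2.le⟩]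

theorem slice_hol (hL : 0 < L) (hf : Hol (strip L) a N f) (y : ℝ) :
    Hol univ a N (fun t => f (clamp L (t, y))) := by
  refine ⟨fun t _ => hf.1 _ (clamp_mem hL _), fun t _ t' _ => ?_⟩
  refine (hf.2 _ (clamp_mem hL _) _ (clamp_mem hL _)).trans (le_of_eq ?_)
  congr 2
  simp [clamp, Prod.norm_def]

theorem oddExt_fam (hL : 0 < L) (ha : a ∈ Ioo (0:ℝ) 1) (hf : Hol (strip L) a N f)
    (hp : PerS L f) : Fam a N (oddExt L f) := by
  have hcl : ∀ x y, f (clamp L (x + 1, y)) = f (clamp L (x, y)) := fun x y =>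
    hp x _ (clamp_mem hL (x, y)).2
  refine ⟨fun s => ?_, fun s t => ?_, ?_⟩
  · unfold oddExt
    split_ifs
    · exact slice_hol hL hf _
    · exact (slice_hol hL hf _).neg
  · unfold oddExt
    simp only [hcl]
  · have hc := (continuous_comp_clamp hL (hf.continuousOn ha.1)).measurable
    have hr : Measurable fun q : ℝ × ℝ => 2 * L * Int.fract (q.1 / (2 * L)) :=
      (measurable_fract.comp (measurable_fst.div_const _)).const_mul _
    refine Measurable.ite (measurableSet_le hr measurable_const) ?_ ?_
    · exact hc.comp (measurable_snd.prodMk hr)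
    · exact (hc.comp (measurable_snd.prodMk (hr.const_sub _))).neg

theorem hol_snd_near (ha : a ∈ Ioo (0:ℝ) 1) (hf : Hol (strip L) a N f) {y : ℝ} (hy : y ∈ Ioo 0 L)
    {e : ℝ} (he : 0 < e) : ∀ᶠ s in nhds y, s ∈ Ioo 0 L ∧ ∀ t, |f (t, s) - f (t, y)| ≤ e := by
  have h1 : Filter.Tendsto (fun s : ℝ => N * |s - y| ^ a) (nhds y) (nhds 0) := by
    have : ContinuousAt (fun s : ℝ => N * |s - y| ^ a) y :=
      continuousAt_const.mul (ContinuousAt.rpow_const (by fun_prop) (Or.inr ha.1.le))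
    simpa [ContinuousAt, Real.zero_rpow ha.1.ne'] using this
  filter_upwards [h1.eventually (gt_mem_nhds he), Ioo_mem_nhds hy.1 hy.2] with s hs hs'
  refine ⟨hs', fun t => ?_⟩
  have := hf.2 (t, s) (mem_strip.2 ⟨hs'.1.le, hs'.2.le⟩) (t, y) (mem_strip.2 ⟨hy.1.le, hy.2.le⟩)
  refine this.trans (le_trans (le_of_eq ?_) hs.le)
  congr 2
  simp [Prod.norm_def]

theorem oddExt_cont_pos (hL : 0 < L) (ha : a ∈ Ioo (0:ℝ) 1) (hf : Hol (strip L) a N f) {y : ℝ}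
    (hy : y ∈ Ioo 0 L) : ∀ e > (0:ℝ), ∀ᶠ s in nhds y, ∀ t,
      |oddExt L f s t - oddExt L f y t| ≤ e := fun e he => by
  filter_upwards [hol_snd_near ha hf hy he] with s hs t
  rw [oddExt_pos hL (Ioo_subset_Icc_self hs.1), oddExt_pos hL (Ioo_subset_Icc_self hy)]
  exact hs.2 t

theorem oddExt_cont_neg (hL : 0 < L) (ha : a ∈ Ioo (0:ℝ) 1) (hf : Hol (strip L) a N f) {y : ℝ}
    (hy : y ∈ Ioo 0 L) : ∀ e > (0:ℝ), ∀ᶠ s in nhds (-y), ∀ t,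
      |oddExt L f s t - oddExt L f (-y) t| ≤ e := fun e he => by
  have h : Filter.Tendsto (fun s : ℝ => -s) (nhds (-y)) (nhds y) := by
    simpa using (continuous_neg (G := ℝ)).tendsto (-y)
  filter_upwards [h.eventually (hol_snd_near ha hf hy he)] with s hs t
  have := oddExt_neg (f := f) hL hs.1 t
  rw [neg_neg] at this
  rw [this, oddExt_neg hL hy, neg_sub_neg, abs_sub_comm]
  exact hs.2 t

end OddExtension

section StripLemmas

variable {L a N : ℝ} {f fx fy g gx gy : ℝ × ℝ → ℝ}

theorem origin_mem (hL : 0 < L) : ((0, 0) : ℝ × ℝ) ∈ strip L := mem_strip.2 ⟨le_rfl, hL.le⟩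

/-- A periodic function vanishing at the origin is controlled by its gradient. -/
theorem Grad.hol_of_per (ha : a ∈ Ioo (0:ℝ) 1) (hL : 0 < L) (h : Grad L f fx fy) (hp : PerS L f)
    (h0 : f (0, 0) = 0) (hx : ∀ z ∈ strip L, ‖fx z‖ ≤ N) (hy : ∀ z ∈ strip L, ‖fy z‖ ≤ N) :
    Hol (strip L) a (4 * (1 + L) * N) f := by
  have hN : 0 ≤ N := (norm_nonneg _).trans (hx _ (origin_mem hL))
  have h1 : N ≤ 2 * (1 + L) * N := by nlinarith
  refine (h.hol (N := 2 * (1 + L) * N) ha.1 ha.2.le (fun z hz => ?_) (fun z hz => (hx z hz).trans h1)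
    fun z hz => (hy z hz).trans h1).mono (by linarith)
  obtain ⟨x', hx', hxx⟩ := (hp.periodic hz.2).exists_mem_Ico₀ one_pos z.1
  have h2 := h.lip hx hy (x', z.2) (mem_strip.2 hz.2) (0, 0) (origin_mem hL)
  rw [h0, sub_zero] at h2
  have h3 : f z = f (x', z.2) := hxx
  rw [h3]
  refine h2.trans ?_
  have h4 : ‖((x', z.2) - (0, 0) : ℝ × ℝ)‖ ≤ 1 + L := by
    rw [Prod.mk_sub_mk, sub_zero, sub_zero, Prod.norm_mk, Real.norm_eq_abs, Real.norm_eq_abs,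
      abs_of_nonneg hx'.1, abs_of_nonneg hz.2.1]
    exact max_le (by linarith [hx'.2]) (by linarith [hz.2.2])
  calc 2 * N * ‖((x', z.2) - (0, 0) : ℝ × ℝ)‖ ≤ 2 * N * (1 + L) := by gcongr
    _ = _ := by ring

/-- Uniform convergence of gradients gives convergence of normalised potentials. -/
theorem Grad.exists_lim {fn fxn fyn : ℕ → ℝ × ℝ → ℝ} {e : ℕ → ℝ} (ha : 0 < a) (hL : 0 < L)
    (h : ∀ n, Grad L (fn n) (fxn n) (fyn n))
    (hx : ∀ n, Hol (strip L) a N (fxn n)) (hy : ∀ n, Hol (strip L) a N (fyn n))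
    (he : Filter.Tendsto e Filter.atTop (nhds 0))
    (hex : ∀ n, ∀ z ∈ strip L, |fxn n z - fx z| ≤ e n)
    (hey : ∀ n, ∀ z ∈ strip L, |fyn n z - fy z| ≤ e n) :
    ∃ f, Grad L f fx fy ∧ f (0, 0) = 0 ∧ Hol (strip L) a N fx ∧ Hol (strip L) a N fy ∧
      ∀ z ∈ strip L, Filter.Tendsto (fun n => fn n z - fn n (0, 0)) Filter.atTop (nhds (f z)) := by
  have hfx : ∀ z ∈ strip L, Filter.Tendsto (fun n => fxn n z) Filter.atTop (nhds (fx z)) :=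
    fun z hz => tendsto_iff_norm_sub_tendsto_zero.2
      (squeeze_zero (fun _ => norm_nonneg _) (fun n => hex n z hz) he)
  have hfy : ∀ z ∈ strip L, Filter.Tendsto (fun n => fyn n z) Filter.atTop (nhds (fy z)) :=
    fun z hz => tendsto_iff_norm_sub_tendsto_zero.2
      (squeeze_zero (fun _ => norm_nonneg _) (fun n => hey n z hz) he)
  have hc : ∀ z ∈ strip L, CauchySeq fun n => fn n z - fn n (0, 0) := fun z hz => by
    rw [Metric.cauchySeq_iff]
    intro ε hε
    have h1 : Filter.Tendsto (fun n => 4 * e n * ‖z - (0, 0)‖) Filter.atTop (nhds 0) := by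
      simpa using (he.const_mul 4).mul_const ‖z - (0, 0)‖
    obtain ⟨n0, hn0⟩ := Filter.eventually_atTop.1 (h1.eventually (gt_mem_nhds hε))
    refine ⟨n0, fun m hm n hn => ?_⟩
    have h2 := ((h m).sub (h n)).lip (N := e m + e n)
      (fun z hz => by
        have := abs_sub_le (fxn m z) (fx z) (fxn n z)
        rw [abs_sub_comm (fx z)] at this
        exact this.trans (add_le_add (hex m z hz) (hex n z hz)))
      (fun z hz => by
        have := abs_sub_le (fyn m z) (fy z) (fyn n z)
        rw [abs_sub_comm (fy z)] at this
        exact this.trans (add_le_add (hey m z hz) (hey n z hz))) z hz (0, 0) (origin_mem hL)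
    rw [Real.dist_eq]
    rw [Real.norm_eq_abs] at h2
    have h3 := hn0 m hm
    have h4 := hn0 n hn
    have h5 : fn m z - fn m (0, 0) - (fn n z - fn n (0, 0))
      = fn m z - fn n z - (fn m (0, 0) - fn n (0, 0)) := by ring
    rw [h5]
    refine h2.trans_lt ?_
    nlinarith
  choose! f hf using fun z hz => cauchySeq_tendsto_of_complete (hc z hz)
  have hg : Grad L f fx fy := Grad.lim (N := N) ha (fun n => (h n).add_const (-fn n (0, 0))) hx hy
    (fun z hz => by simpa only [sub_eq_add_neg] using hf z hz) hfx hfy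
  refine ⟨f, hg, ?_, Hol.lim hx hfx, Hol.lim hy hfy, hf⟩
  have := hf (0, 0) (origin_mem hL)
  simp only [sub_self] at this
  exact tendsto_nhds_unique this tendsto_const_nhds

/-- A periodic divergence-free field `(u, w)` of class `C^{1,a}`. -/
structure C1F (L a N : ℝ) (u w ux uy wx : ℝ × ℝ → ℝ) : Prop where
  gu : Grad L u ux uy
  gw : Grad L w wx (fun z => -ux z)
  pu : PerS L u
  pw : PerS L w
  hu : Hol (strip L) a N u
  hw : Hol (strip L) a N w
  hux : Hol (strip L) a N ux
  huy : Hol (strip L) a N uy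
  hwx : Hol (strip L) a N wx

end StripLemmas

section HorizontalMeanFree

open Complex MeasureTheory

variable {L a N : ℝ} {f : ℝ × ℝ → ℝ}

/-- The reflection across the lower boundary. -/
def refl : ℝ × ℝ →L[ℝ] ℝ × ℝ :=
  (ContinuousLinearMap.fst ℝ ℝ ℝ).prod (-ContinuousLinearMap.snd ℝ ℝ ℝ)

@[simp] theorem refl_apply (z : ℝ × ℝ) : refl z = (z.1, -z.2) := rfl

theorem Bp_translate (hL : 0 < L) (δ x y : ℝ) :
    Bp (oddExt L f) δ (x, y + 2 * L) = Bp (oddExt L f) δ (x, y) := by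
  simp only [Bp, Bc]
  have h : ∀ s : ℝ, gI (oddExt L f s) (shiftC δ (x, y + 2 * L) - s * I)
      = gI (oddExt L f (s - 2 * L)) (shiftC δ (x, y) - (s - 2 * L : ℝ) * I) := fun s => by
    have h1 : oddExt L f (s - 2 * L) = oddExt L f s := funext fun t => by
      rw [← oddExt_add hL, sub_add_cancel]
    rw [h1]
    congr 1
    simp only [shiftC]; push_cast; ring
  simp only [h]
  rw [← integral_indicator measurableSet_Iio, ← integral_indicator measurableSet_Iio,
    ← integral_sub_right_eq_self (fun s => (Iio y).indicator
      (fun s : ℝ => gI (oddExt L f s) (shiftC δ (x, y) - s * I)) s) (2 * L)]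
  refine integral_congr_ae (Filter.Eventually.of_forall fun s => ?_)
  by_cases hs : s < y + 2 * L
  · have hs' : s - 2 * L < y := by linarith
    simp [indicator, hs, hs']
  · have hs' : ¬ s - 2 * L < y := by linarith
    simp [indicator, hs, hs']

theorem Bp_add_one (F : ℝ → ℝ → ℝ) (δ x y : ℝ) : Bp F δ (x + 1, y) = Bp F δ (x, y) := by
  simp only [Bp, Bc]
  refine integral_congr_ae (Filter.Eventually.of_forall fun s => ?_)
  simp only []
  rw [← gI_add_one (shiftC δ (x, y) - s * I)]
  congr 1
  simp only [shiftC]; push_cast; ring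

/-- The gradient potential at height offset `δ`. -/
def Ac (F : ℝ → ℝ → ℝ) (δ : ℝ) (z : ℝ × ℝ) : ℂ := Gc F z.2 (shiftC δ z)

theorem Ac_estimates (ha : a ∈ Ioo (0:ℝ) 1) : ∃ c > (0:ℝ), ∀ N F, Fam a N F → ∀ δ, 0 ≤ δ →
    Hol univ a (c * N) (Ac F δ) ∧ (0 < δ → ∀ z, ‖Ac F δ z - Ac F 0 z‖ ≤ c * N * δ ^ a) := by
  obtain ⟨c, hc, h⟩ := Gc_estimates ha
  refine ⟨2 * c, by positivity, fun N F hF δ hδ => ?_⟩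
  obtain ⟨-, h1, h2⟩ := h N F hF
  have hN := (hF.hol 0).nonneg ⟨0, mem_univ _⟩
  have him : ∀ (δ : ℝ) (z : ℝ × ℝ), 0 ≤ δ → z.2 ≤ (shiftC δ z).im := fun δ z hδ => by
    rw [shiftC_im]; linarith
  refine ⟨⟨fun z _ => ?_, fun z _ z' _ => ?_⟩, fun hδ z => ?_⟩
  · exact (h1 _ _ (him δ z hδ)).trans (by nlinarith [mul_nonneg hc.le hN])
  · rcases eq_or_ne z z' with rfl | hzz
    · simp only [sub_self, norm_zero]; positivity
    have hpos : 0 < ‖z - z'‖ := norm_pos_iff.2 (sub_ne_zero.2 hzz)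
    refine (h2 _ _ z.2 z'.2 (2 * ‖z - z'‖) (by positivity) (him δ z hδ) (him δ z' hδ) ?_ ?_).trans ?_
    · simpa using shiftC_sub δ δ z z'
    · have : |z.2 - z'.2| ≤ ‖z - z'‖ := norm_snd_le (z - z')
      linarith
    · rw [Real.mul_rpow (by norm_num) hpos.le]
      have : (2:ℝ) ^ a ≤ 2 := by
        simpa using Real.rpow_le_rpow_of_exponent_le (one_le_two (α := ℝ)) ha.2.le
      calc c * N * (2 ^ a * ‖z - z'‖ ^ a) ≤ c * N * (2 * ‖z - z'‖ ^ a) := by gcongr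
        _ = _ := by ring
  · refine (h2 _ _ z.2 z.2 δ hδ (him δ z hδ.le) (him 0 z le_rfl) ?_ ?_).trans ?_
    · simpa [abs_of_pos hδ] using shiftC_sub δ 0 z z
    · simpa using hδ.le
    · have : 0 ≤ δ ^ a := by positivity
      nlinarith [mul_nonneg (mul_nonneg hc.le hN) this]

/-- The regularised flow. -/
def Ud (F : ℝ → ℝ → ℝ) (δ : ℝ) (z : ℝ × ℝ) : ℝ := -(Bp F δ z + Bp F δ (refl z)).re
/-- The regularised flow. -/
def Wd (F : ℝ → ℝ → ℝ) (δ : ℝ) (z : ℝ × ℝ) : ℝ := (Bp F δ z - Bp F δ (refl z)).im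
/-- Sum part of the gradient of the regularised flow. -/
def Sd (F : ℝ → ℝ → ℝ) (δ : ℝ) (z : ℝ × ℝ) : ℝ := (Ac F δ z + Ac F δ (refl z)).re
/-- Difference part of the gradient of the regularised flow. -/
def Dd (F : ℝ → ℝ → ℝ) (δ : ℝ) (z : ℝ × ℝ) : ℝ := (Ac F δ z - Ac F δ (refl z)).im

theorem slice_hol_of_mem (hf : Hol (strip L) a N f) {y : ℝ} (hy : y ∈ Icc 0 L) :
    Hol univ a N (fun t => f (t, y)) := by
  have hm : ∀ t : ℝ, (t, y) ∈ strip L := fun t => mem_strip.2 hy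
  refine ⟨fun t _ => hf.1 _ (hm t), fun t _ t' _ => ?_⟩
  refine (hf.2 _ (hm t) _ (hm t')).trans (le_of_eq ?_)
  congr 2
  simp [Prod.norm_def]

theorem Pd_hol (ha : a ∈ Ioo (0:ℝ) 1) (hL : 0 < L) (hf : Hol (strip L) a N f) (hp : PerS L f)
    (hm : ∀ y ∈ Icc 0 L, ∫ x in (0:ℝ)..1, f (x, y) = 0) {δ : ℝ} (hδ : 0 < δ) :
    Hol (strip L) a N (fun z => Pp (fun t => f (t, z.2)) δ z.1) := by
  have hc : ∀ y ∈ Icc 0 L, Continuous fun t => f (t, y) := fun y hy =>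
    continuousOn_univ.1 ((slice_hol_of_mem hf hy).continuousOn ha.1)
  have hN := hf.nonneg ⟨_, origin_mem hL⟩
  refine ⟨fun z hz => ?_, fun z hz z' hz' => ?_⟩
  · have h0 : Pp (fun _ => 0) δ z.1 = 0 := by simp [Pp, gI]
    have := Pp_sub_le (hc z.2 hz.2) (fun x => hp x z.2 hz.2) (hm z.2 hz.2) (ψ := fun _ => 0)
      continuous_const (fun _ => rfl) (by simp) hδ (x := z.1) (x' := z.1) (e := N)
      (fun t => by rw [sub_zero]; exact hf.1 _ (mem_strip.2 hz.2))
    rwa [h0, sub_zero] at this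
  · refine Pp_sub_le (hc z.2 hz.2) (fun x => hp x z.2 hz.2) (hm z.2 hz.2) (hc z'.2 hz'.2)
      (fun x => hp x z'.2 hz'.2) (hm z'.2 hz'.2) hδ fun t => ?_
    refine (hf.2 (z.1 + t, z.2) (mem_strip.2 hz.2) (z'.1 + t, z'.2) (mem_strip.2 hz'.2)).trans
      (le_of_eq ?_)
    congr 2
    simp [Prod.norm_def]

theorem oddExt_Bp_hasFDerivAt (ha : a ∈ Ioo (0:ℝ) 1) (hL : 0 < L) (hf : Hol (strip L) a N f)
    (hp : PerS L f) {δ : ℝ} (hδ : 0 < δ) {z : ℝ × ℝ} (hz : z ∈ univ ×ˢ Ioo 0 L) :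
    HasFDerivAt (Ud (oddExt L f) δ) (lin2 (-Sd (oddExt L f) δ z)
      (Dd (oddExt L f) δ z - Pp (fun t => f (t, z.2)) δ z.1)) z ∧
    HasFDerivAt (Wd (oddExt L f) δ) (lin2 (Dd (oddExt L f) δ z) (Sd (oddExt L f) δ z)) z := by
  have hF := oddExt_fam hL ha hf hp
  have h1 := Bp_hasFDerivAt ha hδ hF (oddExt_cont_pos hL ha hf hz.2)
  have h2 := (Bp_hasFDerivAt ha hδ hF (z0 := refl z) (oddExt_cont_neg hL ha hf hz.2)).comp z
    refl.hasFDerivAt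
  have e1 : oddExt L f z.2 = fun t => f (t, z.2) :=
    funext fun t => oddExt_pos hL (Ioo_subset_Icc_self hz.2) t
  have e2 : oddExt L f (refl z).2 = fun t => -f (t, z.2) :=
    funext fun t => oddExt_neg hL hz.2 t
  rw [e1] at h1
  rw [e2] at h2
  simp only [gI_neg] at h2
  constructor
  · refine ((Complex.reCLM.hasFDerivAt.comp z (h1.add h2)).neg).congr_fderiv ?_
    ext <;> simp [Sd, Dd, Ac, Pp] <;> ring
  · refine (Complex.imCLM.hasFDerivAt.comp z (h1.sub h2)).congr_fderiv ?_
    ext <;> simp [Sd, Dd, Ac]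

theorem regularised_grad (ha : a ∈ Ioo (0:ℝ) 1) (hL : 0 < L) (hf : Hol (strip L) a N f)
    (hp : PerS L f) (hm : ∀ y ∈ Icc 0 L, ∫ x in (0:ℝ)..1, f (x, y) = 0) {δ : ℝ} (hδ : 0 < δ)
    (hA : Continuous (Ac (oddExt L f) δ)) :
    Grad L (Ud (oddExt L f) δ) (fun z => -Sd (oddExt L f) δ z)
      (fun z => Dd (oddExt L f) δ z - Pp (fun t => f (t, z.2)) δ z.1) ∧
    Grad L (Wd (oddExt L f) δ) (Dd (oddExt L f) δ) (Sd (oddExt L f) δ) := by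
  have hF := oddExt_fam hL ha hf hp
  have hB := Bp_continuous ha hδ hF
  have hr := refl.continuous
  have hS : Continuous (Sd (oddExt L f) δ) := Complex.continuous_re.comp (hA.add (hA.comp hr))
  have hD : Continuous (Dd (oddExt L f) δ) := Complex.continuous_im.comp (hA.sub (hA.comp hr))
  have hU : Continuous (Ud (oddExt L f) δ) :=
    (Complex.continuous_re.comp (hB.add (hB.comp hr))).neg
  have hW : Continuous (Wd (oddExt L f) δ) := Complex.continuous_im.comp (hB.sub (hB.comp hr))
  exact ⟨Grad.of_interior hL hU.continuousOn hS.neg.continuousOn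
      (hD.continuousOn.sub ((Pd_hol ha hL hf hp hm hδ).continuousOn ha.1))
      fun z hz => (oddExt_Bp_hasFDerivAt ha hL hf hp hδ hz).1,
    Grad.of_interior hL hW.continuousOn hD.continuousOn hS.continuousOn
      fun z hz => (oddExt_Bp_hasFDerivAt ha hL hf hp hδ hz).2⟩

theorem Sd_Dd_hol {F : ℝ → ℝ → ℝ} {c δ : ℝ} (ha : a ∈ Ioo (0:ℝ) 1) (h : Hol univ a c (Ac F δ)) :
    Hol univ a (2 * c) (Sd F δ) ∧ Hol univ a (2 * c) (Dd F δ) := by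
  have h2 : Hol univ a c (fun z => Ac F δ (refl z)) := by
    have := h.comp_lip (p := refl) (t := univ) ha.1 ha.2.le (fun _ _ => mem_univ _) le_rfl
      (fun z _ z' _ => by
        rw [one_mul, ← map_sub, refl_apply, Prod.norm_mk, norm_neg]; exact le_rfl)
    rwa [one_mul] at this
  refine ⟨⟨fun z hz => ?_, fun z hz z' hz' => ?_⟩, ⟨fun z hz => ?_, fun z hz z' hz' => ?_⟩⟩
  · exact (Complex.abs_re_le_norm _).trans (((h.add h2).1 z hz).trans (by linarith))
  · rw [Sd, Sd, ← Complex.sub_re]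
    exact (Complex.abs_re_le_norm _).trans (((h.add h2).2 z hz z' hz').trans_eq (by ring))
  · exact (Complex.abs_im_le_norm _).trans (((h.sub h2).1 z hz).trans (by linarith))
  · rw [Dd, Dd, ← Complex.sub_im]
    exact (Complex.abs_im_le_norm _).trans (((h.sub h2).2 z hz z' hz').trans_eq (by ring))

theorem Sd_Dd_lim {F : ℝ → ℝ → ℝ} {c δ : ℝ} (h : ∀ z, ‖Ac F δ z - Ac F 0 z‖ ≤ c) (z : ℝ × ℝ) :
    |Sd F δ z - Sd F 0 z| ≤ 2 * c ∧ |Dd F δ z - Dd F 0 z| ≤ 2 * c := by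
  have h1 := h z
  have h2 := h (refl z)
  constructor
  · rw [Sd, Sd, ← Complex.sub_re, add_sub_add_comm]
    exact (Complex.abs_re_le_norm _).trans ((norm_add_le _ _).trans (by linarith))
  · rw [Dd, Dd, ← Complex.sub_im, sub_sub_sub_comm]
    exact (Complex.abs_im_le_norm _).trans ((norm_sub_le _ _).trans (by linarith))

/-- The div-curl system with horizontally mean-free curl and homogeneous boundary values. -/
theorem exists_divcurl_mean_free (ha : a ∈ Ioo (0:ℝ) 1) (hL : 0 < L) : ∃ C > (0:ℝ), ∀ N f,
    Hol (strip L) a N f → PerS L f → (∀ y ∈ Icc 0 L, ∫ x in (0:ℝ)..1, f (x, y) = 0) →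
    ∃ u w ux uy wx, C1F L a (C * N) u w ux uy wx ∧ (∀ z ∈ strip L, wx z - uy z = f z) ∧
      (∀ x, w (x, 0) = 0) ∧ ∀ x, w (x, L) = 0 := by
  obtain ⟨c, hc, hA⟩ := Ac_estimates ha
  obtain ⟨c', hc', hP⟩ := Pp_lim ha
  set K : ℝ := 2 * c + 1 with hK
  refine ⟨4 * (1 + L) * K, by positivity, fun N f hf hp hm => ?_⟩
  have hF := oddExt_fam hL ha hf hp
  have hN := hf.nonneg ⟨_, origin_mem hL⟩
  set δ : ℕ → ℝ := fun n => 1 / ((n : ℝ) + 1) with hδ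
  have hδ0 : ∀ n, 0 < δ n := fun n => by positivity
  have hδ1 : ∀ n, δ n ≤ 1 := fun n => by
    simp only [hδ]; rw [div_le_one (by positivity)]; linarith [(Nat.cast_nonneg n : (0:ℝ) ≤ n)]
  have hlim : Filter.Tendsto (fun n => (2 * c + c') * N * δ n ^ a) Filter.atTop (nhds 0) := by
    have h1 : Filter.Tendsto δ Filter.atTop (nhds 0) := tendsto_one_div_add_atTop_nhds_zero_nat
    have := (h1.rpow_const (p := a) (Or.inr ha.1.le)).const_mul ((2 * c + c') * N)
    simpa [Real.zero_rpow ha.1.ne'] using this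
  have hhol : ∀ n, Hol (strip L) a (K * N) (Sd (oddExt L f) (δ n)) ∧ Hol (strip L) a (2 * c * N) (Dd (oddExt L f) (δ n)) :=
    fun n => by
      have := Sd_Dd_hol ha (hA N (oddExt L f) hF (δ n) (hδ0 n).le).1
      exact ⟨(this.1.mono (by nlinarith)).subset (subset_univ _),
        (this.2.mono (by nlinarith)).subset (subset_univ _)⟩
  have hgr := fun n => regularised_grad ha hL hf hp hm (hδ0 n)
    (continuousOn_univ.1 ((hA N (oddExt L f) hF (δ n) (hδ0 n).le).1.continuousOn ha.1))
  have hcv := fun n => Sd_Dd_lim ((hA N (oddExt L f) hF (δ n) (hδ0 n).le).2 (hδ0 n))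
  have hpos : ∀ n, 0 ≤ δ n ^ a := fun n => Real.rpow_nonneg (hδ0 n).le _
  have hDl : ∀ n, Hol (strip L) a (K * N) (Dd (oddExt L f) (δ n)) := fun n => (hhol n).2.mono (by nlinarith)
  obtain ⟨u, gu, u0, hux, huy, hul⟩ := Grad.exists_lim (N := K * N) (fx := fun z => -Sd (oddExt L f) 0 z)
    (fy := fun z => Dd (oddExt L f) 0 z - f z) ha.1 hL (fun n => (hgr n).1) (fun n => (hhol n).1.neg)
    (fun n => ((hhol n).2.sub (Pd_hol ha hL hf hp hm (hδ0 n))).mono (by nlinarith)) hlim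
    (fun n z hz => by
      rw [neg_sub_neg, abs_sub_comm]
      exact (hcv n z).1.trans (by nlinarith [hpos n, mul_nonneg (mul_nonneg hc'.le hN) (hpos n)]))
    (fun n z hz => by
      have h1 := hP N (fun t => f (t, z.2)) (slice_hol_of_mem hf hz.2) (fun x => hp x z.2 hz.2)
        (hm z.2 hz.2) (δ n) (hδ0 n) (hδ1 n) z.1
      rw [sub_sub_sub_comm]
      refine (abs_sub _ _).trans ?_
      have := (hcv n z).2
      have h2 : f (z.1, z.2) = f z := rfl
      rw [h2] at h1
      linarith)
  obtain ⟨w, gw, w0, hwx, -, hwl⟩ := Grad.exists_lim (N := K * N) (fx := Dd (oddExt L f) 0)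
    (fy := Sd (oddExt L f) 0) ha.1 hL (fun n => (hgr n).2) hDl (fun n => (hhol n).1) hlim
    (fun n z hz => (hcv n z).2.trans
      (by nlinarith [hpos n, mul_nonneg (mul_nonneg hc'.le hN) (hpos n)]))
    (fun n z hz => (hcv n z).1.trans
      (by nlinarith [hpos n, mul_nonneg (mul_nonneg hc'.le hN) (hpos n)]))
  have hB1 : ∀ δ x y, Bp (oddExt L f) δ (refl (x + 1, y)) = Bp (oddExt L f) δ (refl (x, y)) := fun δ x y =>
    Bp_add_one (oddExt L f) δ x (-y)
  have pu : PerS L u := fun x y hy => by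
    refine tendsto_nhds_unique (hul _ (mem_strip.2 hy)) ?_
    have := hul (x, y) (mem_strip.2 hy)
    simpa only [Ud, hB1, Bp_add_one] using this
  have pw : PerS L w := fun x y hy => by
    refine tendsto_nhds_unique (hwl _ (mem_strip.2 hy)) ?_
    have := hwl (x, y) (mem_strip.2 hy)
    simpa only [Wd, hB1, Bp_add_one] using this
  have hW0 : ∀ δ x, Wd (oddExt L f) δ (x, 0) = 0 := fun δ x => by simp [Wd]
  have hWL : ∀ δ x, Wd (oddExt L f) δ (x, L) = 0 := fun δ x => by
    have := Bp_translate (f := f) hL δ x (-L)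
    rw [show -L + 2 * L = L by ring] at this
    simp [Wd, this]
  have hSL : K * N ≤ 4 * (1 + L) * K * N := by
    have : 0 ≤ K * N := by positivity
    nlinarith
  refine ⟨u, w, fun z => -Sd (oddExt L f) 0 z, fun z => Dd (oddExt L f) 0 z - f z, Dd (oddExt L f) 0, ⟨gu, ?_, pu, pw, ?_, ?_,
    hux.mono hSL, huy.mono hSL, hwx.mono hSL⟩, fun z _ => by ring, fun x => ?_, fun x => ?_⟩
  · simpa only [neg_neg] using gw
  · rw [mul_assoc]; exact gu.hol_of_per ha hL pu u0 hux.1 huy.1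
  · rw [mul_assoc]; exact gw.hol_of_per ha hL pw w0 hwx.1 (fun z hz => by
      have := hux.1 z hz; rwa [norm_neg] at this)
  · refine tendsto_nhds_unique (hwl _ (mem_strip.2 ⟨le_rfl, hL.le⟩)) ?_
    simp only [hW0, sub_self]; exact tendsto_const_nhds
  · refine tendsto_nhds_unique (hwl _ (mem_strip.2 ⟨hL.le, le_rfl⟩)) ?_
    simp only [hW0, hWL, sub_self]; exact tendsto_const_nhds

end HorizontalMeanFree

section DivCurl

variable {L a N M : ℝ}

theorem Hol.fst {s : Set (ℝ × ℝ)} {φ : ℝ → ℝ} (ha : a ∈ Ioo (0:ℝ) 1) (h : Hol univ a N φ) :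
    Hol s a N (fun z : ℝ × ℝ => φ z.1) := by
  have := h.comp_lip (p := Prod.fst) (t := s) ha.1 ha.2.le (fun _ _ => mem_univ _) le_rfl
    (fun z _ z' _ => by rw [one_mul]; exact norm_fst_le (z - z'))
  rwa [one_mul] at this

theorem Hol.snd {s : Set (ℝ × ℝ)} {φ : ℝ → ℝ} (ha : a ∈ Ioo (0:ℝ) 1) (h : Hol univ a N φ) :
    Hol s a N (fun z : ℝ × ℝ => φ z.2) := by
  have := h.comp_lip (p := Prod.snd) (t := s) ha.1 ha.2.le (fun _ _ => mem_univ _) le_rfl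
    (fun z _ z' _ => by rw [one_mul]; exact norm_snd_le (z - z'))
  rwa [one_mul] at this

/-- A `C^{1,a}` function on the circle of size `N`. -/
structure B1 (a N : ℝ) (φ φ1 : ℝ → ℝ) : Prop where
  der : ∀ x, HasDerivAt φ (φ1 x) x
  per : Per φ
  h0 : Hol univ a N φ
  h1 : Hol univ a N φ1

theorem per_of_deriv {φ φ1 : ℝ → ℝ} (hd : ∀ x, HasDerivAt φ (φ1 x) x) (hp : Per φ) : Per φ1 :=
  fun x => by
  have h1 : HasDerivAt (fun t => φ (t + 1)) (φ1 (x + 1)) x := (hd (x + 1)).comp_add_const x 1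
  have h2 : (fun t => φ (t + 1)) = φ := funext hp
  rw [h2] at h1
  exact h1.unique (hd x)

theorem B1.per1 {φ φ1 : ℝ → ℝ} (h : B1 a N φ φ1) : Per φ1 := per_of_deriv h.der h.per

theorem B1.mono {φ φ1 : ℝ → ℝ} (h : B1 a N φ φ1) (hNM : N ≤ M) : B1 a M φ φ1 :=
  ⟨h.der, h.per, h.h0.mono hNM, h.h1.mono hNM⟩

theorem B1.cont {φ φ1 : ℝ → ℝ} (ha : 0 < a) (h : B1 a N φ φ1) : Continuous φ ∧ Continuous φ1 :=
  ⟨continuousOn_univ.1 (h.h0.continuousOn ha), continuousOn_univ.1 (h.h1.continuousOn ha)⟩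

theorem B1.zero (hN : 0 ≤ N) : B1 a N (fun _ => 0) (fun _ => 0) :=
  ⟨fun x => hasDerivAt_const x 0, fun _ => rfl, Hol.const 0 (by simpa), Hol.const 0 (by simpa)⟩

theorem B1.integral {φ φ1 : ℝ → ℝ} (ha : 0 < a) (h : B1 a N φ φ1) : ∫ x in (0:ℝ)..1, φ1 x = 0 := by
  rw [intervalIntegral.integral_eq_sub_of_hasDerivAt (fun x _ => h.der x)
    ((h.cont ha).2.intervalIntegrable _ _)]
  have := h.per 0
  rw [zero_add] at this
  rw [this, sub_self]

theorem C1F.mono {u w ux uy wx : ℝ × ℝ → ℝ} (h : C1F L a N u w ux uy wx) (hNM : N ≤ M) :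
    C1F L a M u w ux uy wx :=
  ⟨h.gu, h.gw, h.pu, h.pw, h.hu.mono hNM, h.hw.mono hNM, h.hux.mono hNM, h.huy.mono hNM,
    h.hwx.mono hNM⟩

theorem C1F.add_const {u w ux uy wx : ℝ × ℝ → ℝ} (h : C1F L a N u w ux uy wx) {c : ℝ}
    (hc : |c| ≤ M) : C1F L a (N + M) (fun z => u z + c) w ux uy wx := by
  have hNM : N ≤ N + M := by linarith [abs_nonneg c]
  exact ⟨h.gu.add_const c, h.gw, fun x y hy => by simp only [h.pu x y hy], h.pw,
    h.hu.add (Hol.const c hc), h.hw.mono hNM, h.hux.mono hNM, h.huy.mono hNM, h.hwx.mono hNM⟩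

theorem mean_hol (ha : a ∈ Ioo (0:ℝ) 1) (hL : 0 < L) {f : ℝ × ℝ → ℝ} (hf : Hol (strip L) a N f) :
    Hol univ a N (fun y => ∫ x in (0:ℝ)..1, f (clamp L (x, y))) := by
  have hc := continuous_comp_clamp hL (hf.continuousOn ha.1)
  refine ⟨fun y _ => ?_, fun y _ y' _ => ?_⟩
  · have := intervalIntegral.norm_integral_le_of_norm_le_const (a := 0) (b := 1) (C := N)
      (f := fun x => f (clamp L (x, y))) fun x _ => hf.1 _ (clamp_mem hL _)
    simpa using this
  · have hcy : ∀ y : ℝ, Continuous fun x : ℝ => f (clamp L (x, y)) := fun y =>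
      hc.comp (by fun_prop : Continuous fun x : ℝ => (x, y))
    simp only
    rw [← intervalIntegral.integral_sub
      ((hcy y).intervalIntegrable _ _)
      ((hcy y').intervalIntegrable _ _)]
    have hN := hf.nonneg ⟨_, origin_mem hL⟩
    have := intervalIntegral.norm_integral_le_of_norm_le_const (a := 0) (b := 1)
      (C := N * ‖y - y'‖ ^ a)
      (f := fun x => f (clamp L (x, y)) - f (clamp L (x, y'))) fun x _ => by
        refine (hf.2 _ (clamp_mem hL _) _ (clamp_mem hL _)).trans ?_
        have : ‖clamp L (x, y) - clamp L (x, y')‖ ≤ ‖y - y'‖ := by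
          simp only [clamp, Prod.mk_sub_mk, sub_self, Prod.norm_mk, norm_zero]
          refine max_le (norm_nonneg _) ?_
          rw [Real.norm_eq_abs, Real.norm_eq_abs, max_comm 0, max_comm 0]
          exact (abs_max_sub_max_le_abs _ _ _).trans (abs_min_sub_min_le_max y L y' L |>.trans
            (by simp))
        have := ha.1.le
        gcongr
    simpa using this

theorem height_hol (ha : a ∈ Ioo (0:ℝ) 1) (hL : 0 < L) :
    Hol (strip L) a (2 + L⁻¹) (fun z => z.2 / L) := by
  have hi : 0 < L⁻¹ := inv_pos.2 hL
  refine Hol.of_lip (N := 1) ha.1 ha.2.le (fun z hz => ?_) (fun z _ z' _ => ?_) (by linarith)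
  · rw [Real.norm_eq_abs, abs_of_nonneg (div_nonneg hz.2.1 hL.le)]
    exact (div_le_one hL).2 hz.2.2
  · rw [← sub_div, div_eq_inv_mul, norm_mul, Real.norm_of_nonneg hi.le]
    have : ‖z.2 - z'.2‖ ≤ ‖z - z'‖ := norm_snd_le (z - z')
    nlinarith [norm_nonneg (z - z')]

/-- Solvability of the div-curl system with prescribed normal boundary values. -/
theorem exists_divcurl (ha : a ∈ Ioo (0:ℝ) 1) (hL : 0 < L) : ∃ C > (0:ℝ), ∀ N ω φ φ1 d d1,
    Hol (strip L) a N ω → PerS L ω → B1 a N φ φ1 → B1 a N d d1 →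
    ∫ x in (0:ℝ)..1, φ x = ∫ x in (0:ℝ)..1, d x →
    ∃ u w ux uy wx, C1F L a (C * N) u w ux uy wx ∧ (∀ z ∈ strip L, wx z - uy z = ω z) ∧
      (∀ x, w (x, 0) = φ x) ∧ ∀ x, w (x, L) = d x := by
  obtain ⟨C, hC, hT⟩ := exists_divcurl_mean_free ha hL
  have hi : 0 < L⁻¹ := inv_pos.2 hL
  set k : ℝ := 1 + 4 * (2 + L⁻¹) with hk
  set K : ℝ := C * (2 + k) + k + 2 * L⁻¹ + 1 with hK
  refine ⟨4 * (1 + L) * K, by positivity, fun N ω φ φ1 d d1 hω hωp hφ hd hm => ?_⟩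
  have hN := hω.nonneg ⟨_, origin_mem hL⟩
  have hωc := continuous_comp_clamp hL (hω.continuousOn ha.1)
  have hmh := mean_hol ha hL hω
  set m : ℝ → ℝ := fun y => ∫ x in (0:ℝ)..1, ω (clamp L (x, y)) with hmd
  have hmc : Continuous m := continuousOn_univ.1 (hmh.continuousOn ha.1)
  obtain ⟨φc, φ1c⟩ := hφ.cont ha.1
  obtain ⟨dc, d1c⟩ := hd.cont ha.1
  have blend : ∀ {p q : ℝ → ℝ}, Hol univ a N p → Hol univ a N q →
      Hol (strip L) a (k * N) (fun z => p z.1 + z.2 / L * (q z.1 - p z.1)) := fun hp hq =>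
    ((hp.fst ha).add ((height_hol ha hL).mul ((hq.sub hp).fst ha))).mono (le_of_eq (by rw [hk]; ring))
  set f : ℝ × ℝ → ℝ := fun z => ω z - m z.2 - (φ1 z.1 + z.2 / L * (d1 z.1 - φ1 z.1)) with hf
  have hfh : Hol (strip L) a ((2 + k) * N) f :=
    ((hω.sub (hmh.snd ha)).sub (blend hφ.h1 hd.h1)).mono (by linarith)
  have hfm : ∀ y ∈ Icc 0 L, ∫ x in (0:ℝ)..1, f (x, y) = 0 := fun y hy => by
    have h1 : ∫ x in (0:ℝ)..1, ω (x, y) = m y := by simp only [hmd, clamp_pair hy]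
    have hω' : Continuous fun x : ℝ => ω (x, y) := by
      have := hωc.comp (by fun_prop : Continuous fun x : ℝ => (x, y))
      simpa only [Function.comp_def, clamp_pair hy] using this
    simp only [hf]
    set g : ℝ → ℝ := fun x => ω (x, y)
    change ∫ x in (0:ℝ)..1, (g x - m y - (φ1 x + y / L * (d1 x - φ1 x))) = 0
    change ∫ x in (0:ℝ)..1, g x = m y at h1
    rw [intervalIntegral.integral_sub, intervalIntegral.integral_sub, intervalIntegral.integral_add,
      intervalIntegral.integral_const_mul, intervalIntegral.integral_sub, hφ.integral ha.1,
      hd.integral ha.1, h1, intervalIntegral.integral_const]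
    · simp
    all_goals exact Continuous.intervalIntegrable (by fun_prop) _ _
  obtain ⟨u, w, ux, uy, wx, h, hcurl, hw0, hwL⟩ := hT _ f hfh
    (fun x y hy => by simp only [hf, hωp x y hy, hφ.per1 x, hd.per1 x]) hfm
  set e : ℝ → ℝ := fun x => ∫ t in (0:ℝ)..x, (φ t - d t) * L⁻¹ with he
  have hec : Continuous fun t => (φ t - d t) * L⁻¹ := by fun_prop
  have hed : ∀ x, HasDerivAt e ((φ x - d x) * L⁻¹) x := fun x =>
    intervalIntegral.integral_hasDerivAt_right (hec.intervalIntegrable _ _)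
      (hec.stronglyMeasurableAtFilter _ _) hec.continuousAt
  set r : ℝ → ℝ := fun y => ∫ t in (0:ℝ)..y, m t with hr
  have hrd : ∀ y, HasDerivAt r (m y) y := fun y =>
    intervalIntegral.integral_hasDerivAt_right (hmc.intervalIntegrable _ _)
      (hmc.stronglyMeasurableAtFilter _ _) hmc.continuousAt
  have hep : ∀ x, e (x + 1) = e x := fun x => by
    have h1 : ∫ t in x..(x + 1), (φ t - d t) * L⁻¹ = 0 := by
      have hper : Function.Periodic (fun t => (φ t - d t) * L⁻¹) 1 := fun t => by
        simp only [hφ.per t, hd.per t]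
      rw [hper.intervalIntegral_add_eq x 0, zero_add, intervalIntegral.integral_mul_const,
        intervalIntegral.integral_sub (φc.intervalIntegrable _ _) (dc.intervalIntegrable _ _), hm,
        sub_self, zero_mul]
    have := intervalIntegral.integral_add_adjacent_intervals (a := 0) (b := x) (c := x + 1)
      (hec.intervalIntegrable (μ := MeasureTheory.volume) _ _) (hec.intervalIntegrable _ _)
    simp only [he]; linarith
  have gu : Grad L (fun z => u z + e z.1 - r z.2 + -(u (0, 0) + e 0 - r 0))
      (fun z => ux z + (φ z.1 - d z.1) * L⁻¹) (fun z => uy z - m z.2) :=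
    (((h.gu.add (Grad.of_fst hed)).sub
      (Grad.of_snd fun y _ => (hrd y).hasDerivWithinAt)).add_const _).congr
      (fun _ _ => rfl) (fun _ _ => by ring) (fun _ _ => by ring)
  have hy : Grad L (fun z => z.2 / L) (fun _ => 0) (fun _ => L⁻¹) := by
    refine (Grad.of_snd (H := fun y => y / L) (H' := fun _ => L⁻¹) fun y _ => ?_)
    simpa using ((hasDerivAt_id y).div_const L).hasDerivWithinAt
  have gw : Grad L (fun z => w z + (φ z.1 + z.2 / L * (d z.1 - φ z.1)))
      (fun z => wx z + (φ1 z.1 + z.2 / L * (d1 z.1 - φ1 z.1)))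
      (fun z => -(ux z + (φ z.1 - d z.1) * L⁻¹)) :=
    (h.gw.add ((Grad.of_fst hφ.der).add
      (hy.mul ((Grad.of_fst hd.der).sub (Grad.of_fst hφ.der))))).congr
      (fun _ _ => rfl) (fun _ _ => by ring) (fun _ _ => by ring)
  have pu : PerS L (fun z => u z + e z.1 - r z.2 + -(u (0, 0) + e 0 - r 0)) := fun x y hy => by
    simp only [h.pu x y hy, hep]
  have pw : PerS L (fun z => w z + (φ z.1 + z.2 / L * (d z.1 - φ z.1))) := fun x y hy => by
    simp only [h.pw x y hy, hφ.per x, hd.per x]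
  have hCN : 0 ≤ C * N := by positivity
  have hiN : 0 ≤ L⁻¹ * N := by positivity
  have hkN : 0 ≤ k * N := by positivity
  have hCkN : 0 ≤ C * (k * N) := by positivity
  have hux : Hol (strip L) a (K * N) (fun z => ux z + (φ z.1 - d z.1) * L⁻¹) := by
    refine (h.hux.add ((((hφ.h0.sub hd.h0).const_mul L⁻¹).fst ha).congr
      (g := fun z => (φ z.1 - d z.1) * L⁻¹) fun z _ => mul_comm _ _)).mono ?_
    rw [abs_of_pos hi, hK]; nlinarith
  have huy : Hol (strip L) a (K * N) (fun z => uy z - m z.2) :=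
    (h.huy.sub (hmh.snd ha)).mono (by rw [hK]; nlinarith)
  have hwx : Hol (strip L) a (K * N) (fun z => wx z + (φ1 z.1 + z.2 / L * (d1 z.1 - φ1 z.1))) :=
    (h.hwx.add (blend hφ.h1 hd.h1)).mono (by rw [hK]; nlinarith)
  have hw : Hol (strip L) a (K * N) (fun z => w z + (φ z.1 + z.2 / L * (d z.1 - φ z.1))) :=
    (h.hw.add (blend hφ.h0 hd.h0)).mono (by rw [hK]; nlinarith)
  have hKK : K * N ≤ 4 * (1 + L) * K * N := by
    have : 0 ≤ K * N := by positivity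
    nlinarith
  refine ⟨_, _, _, _, _, ⟨gu, gw, pu, pw, ?_, hw.mono hKK, hux.mono hKK, huy.mono hKK,
    hwx.mono hKK⟩, fun z hz => ?_, fun x => ?_, fun x => ?_⟩
  · rw [mul_assoc]; exact gu.hol_of_per ha hL pu (by ring) hux.1 huy.1
  · have := hcurl z hz
    simp only [hf] at this
    linarith
  · simp [hw0]
  · simp [hwL, hL.ne']

theorem abs_integral_le_of_hol {s : Set (ℝ × ℝ)} {u : ℝ × ℝ → ℝ} (h : Hol s a N u) {γ : ℝ → ℝ × ℝ}
    {b c : ℝ} (hbc : b ≤ c) (hγ : ∀ t ∈ Icc b c, γ t ∈ s) : |∫ t in b..c, u (γ t)| ≤ N * (c - b) := by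
  have := intervalIntegral.norm_integral_le_of_norm_le_const (a := b) (b := c) (C := N)
    (f := fun t => u (γ t)) fun t ht => h.1 _ (hγ t (by
      rw [uIoc_of_le hbc] at ht; exact ⟨ht.1.le, ht.2⟩))
  rwa [abs_of_nonneg (sub_nonneg.2 hbc)] at this

theorem C1F.exists_flux (hL : 0 < L) {u w ux uy wx : ℝ × ℝ → ℝ}
    (h : C1F L a N u w ux uy wx) (J : ℝ) :
    ∃ c : ℝ, (∫ y in (0:ℝ)..L, (u (0, y) + c)) = J ∧ |c| ≤ N + L⁻¹ * |J| := by
  have hi : 0 < L⁻¹ := inv_pos.2 hL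
  have hmem : ∀ t ∈ Icc 0 L, ((0, t) : ℝ × ℝ) ∈ strip L := fun t ht => mem_strip.2 ht
  have h1 := abs_integral_le_of_hol h.hu (γ := fun t => (0, t)) hL.le hmem
  have hint : IntervalIntegrable (fun y => u (0, y)) MeasureTheory.volume 0 L :=
    ContinuousOn.intervalIntegrable_of_Icc hL.le (cont_y h.gu.continuousOn 0)
  refine ⟨(J - ∫ y in (0:ℝ)..L, u (0, y)) * L⁻¹, ?_, ?_⟩
  · rw [intervalIntegral.integral_add hint intervalIntegrable_const, intervalIntegral.integral_const,
      smul_eq_mul, sub_zero]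
    field_simp; ring
  · rw [abs_mul, abs_of_pos hi]
    have h2 := abs_sub J (∫ y in (0:ℝ)..L, u (0, y))
    calc |J - ∫ y in (0:ℝ)..L, u (0, y)| * L⁻¹ ≤ (|J| + N * L) * L⁻¹ := by
          gcongr; exact h2.trans (by linarith)
      _ = _ := by field_simp; ring

/-- Schauder estimate for the div-curl system. -/
theorem divcurl_estimate (ha : a ∈ Ioo (0:ℝ) 1) (hL : 0 < L) : ∃ C > (0:ℝ),
    ∀ N u w ux uy wx d d1, Grad L u ux uy → Grad L w wx (fun z => -ux z) → PerS L u → PerS L w →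
    ContinuousOn uy (strip L) →
    Hol (strip L) a N (fun z => wx z - uy z) → (∀ x, w (x, 0) = 0) → (∀ x, w (x, L) = d x) →
    B1 a N d d1 → ∫ x in (0:ℝ)..1, d x = 0 → ∫ y in (0:ℝ)..L, u (0, y) = 0 →
    C1F L a (C * N) u w ux uy wx := by
  obtain ⟨C, hC, hT⟩ := exists_divcurl ha hL
  refine ⟨2 * C, by positivity, fun N u w ux uy wx d d1 gu gw pu pw huy hω hw0 hwL hd hdm hJ => ?_⟩
  have hN := hω.nonneg ⟨_, origin_mem hL⟩
  obtain ⟨-, puy⟩ := gu.perS hL pu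
  obtain ⟨pwx, -⟩ := gw.perS hL pw
  obtain ⟨u', w', ux', uy', wx', h, hc, h0', hL'⟩ := hT N (fun z => wx z - uy z) (fun _ => 0)
    (fun _ => 0) d d1 hω (fun x y hy => by simp only [pwx x y hy, puy x y hy]) (B1.zero hN) hd
    (by simp [hdm])
  obtain ⟨c, hc1, hc2⟩ := h.exists_flux hL 0
  rw [abs_zero, mul_zero, add_zero] at hc2
  have h' := (h.add_const hc2).mono (M := 2 * C * N) (by linarith)
  have key := divcurl_unique hL (gu.sub h'.gu) (gw.sub h'.gw) (huy.sub (h'.huy.continuousOn ha.1))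
    (fun z _ => by ring) (fun z hz => by have := hc z hz; linarith)
    (fun x y hy => by simp only [pu x y hy, h.pu x y hy])
    (fun x y hy => by simp only [pw x y hy, h.pw x y hy]) (fun x => by rw [hw0, h0', sub_self])
    (fun x => by rw [hwL, hL', sub_self]) (by
      have i1 := ContinuousOn.intervalIntegrable_of_Icc (μ := MeasureTheory.volume) hL.le
        (cont_y gu.continuousOn 0)
      have i2 := ContinuousOn.intervalIntegrable_of_Icc (μ := MeasureTheory.volume) hL.le
        (cont_y h'.gu.continuousOn 0)
      rw [intervalIntegral.integral_sub i1 i2, hJ, hc1, sub_self])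
  have eu : ∀ z ∈ strip L, u z = u' z + c := fun z hz => sub_eq_zero.1 (key z hz).1
  have ew : ∀ z ∈ strip L, w z = w' z := fun z hz => sub_eq_zero.1 (key z hz).2
  have du := (gu.congr (fun z hz => (eu z hz).symm) (fun _ _ => rfl) fun _ _ => rfl).unique hL h'.gu
  have dw := (gw.congr (fun z hz => (ew z hz).symm) (fun _ _ => rfl) fun _ _ => rfl).unique hL h'.gw
  exact ⟨gu, gw, pu, pw, h'.hu.congr eu, h'.hw.congr ew, h'.hux.congr fun z hz => (du z hz).1,
    h'.huy.congr fun z hz => (du z hz).2, h'.hwx.congr fun z hz => (dw z hz).1⟩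

end DivCurl

section StrongDivCurl

variable {L a N M : ℝ}

/-- The partial derivatives up to order two of a divergence free field `(u, w)`. -/
structure Jet where
  u : ℝ × ℝ → ℝ
  w : ℝ × ℝ → ℝ
  ux : ℝ × ℝ → ℝ
  uy : ℝ × ℝ → ℝ
  wx : ℝ × ℝ → ℝ
  uxx : ℝ × ℝ → ℝ
  uxy : ℝ × ℝ → ℝ
  uyy : ℝ × ℝ → ℝ
  wxx : ℝ × ℝ → ℝ

/-- A periodic divergence free field of class `C^{2,a}` and size `N`. -/
structure C2F (L a N : ℝ) (j : Jet) : Prop where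
  c1 : C1F L a N j.u j.w j.ux j.uy j.wx
  gux : Grad L j.ux j.uxx j.uxy
  guy : Grad L j.uy j.uxy j.uyy
  gwx : Grad L j.wx j.wxx (fun z => -j.uxx z)
  huxx : Hol (strip L) a N j.uxx
  huxy : Hol (strip L) a N j.uxy
  huyy : Hol (strip L) a N j.uyy
  hwxx : Hol (strip L) a N j.wxx

/-- A `C^{2,a}` function on the circle of size `N`. -/
structure B2 (a N : ℝ) (φ φ1 φ2 : ℝ → ℝ) : Prop where
  b0 : B1 a N φ φ1
  b1 : B1 a N φ1 φ2

theorem C2F.mono {j : Jet} (h : C2F L a N j) (hNM : N ≤ M) : C2F L a M j :=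
  ⟨h.c1.mono hNM, h.gux, h.guy, h.gwx, h.huxx.mono hNM, h.huxy.mono hNM, h.huyy.mono hNM,
    h.hwxx.mono hNM⟩

theorem mean_eq (hL : 0 < L) {u w ux uy wx : ℝ × ℝ → ℝ} (gu : Grad L u ux uy)
    (gw : Grad L w wx (fun z => -ux z)) (pu : PerS L u) (hux : ContinuousOn ux (strip L)) :
    ∫ x in (0:ℝ)..1, w (x, L) = ∫ x in (0:ℝ)..1, w (x, 0) := by
  have := green hL gw gu.neg hux.neg hux.neg (fun x y hy => by simp only [pu x y hy])
    (right_mem_Icc.2 hL.le)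
  simp only [sub_self, intervalIntegral.integral_zero] at this
  exact sub_eq_zero.1 this

theorem eq_of_deriv_eq {f g f' : ℝ → ℝ} (hf : ∀ x, HasDerivAt f (f' x) x)
    (hg : ∀ x, HasDerivAt g (f' x) x) (x y : ℝ) : f x - g x = f y - g y := by
  have h : ∀ x, HasDerivAt (fun x => f x - g x) 0 x := fun x => by
    rw [← sub_self (f' x)]; exact (hf x).sub (hg x)
  exact is_const_of_deriv_eq_zero (fun x => (h x).differentiableAt) (fun x => (h x).deriv) x y

/-- Strong solvability of the div-curl system with flux condition. -/
theorem exists_divcurl_strong (ha : a ∈ Ioo (0:ℝ) 1) (hL : 0 < L) : ∃ C > (0:ℝ),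
    ∀ N ω ωx ωy φ φ1 φ2 d d1 d2 J, Grad L ω ωx ωy → PerS L ω → Hol (strip L) a N ω →
    Hol (strip L) a N ωx → Hol (strip L) a N ωy → B2 a N φ φ1 φ2 → B2 a N d d1 d2 →
    ∫ x in (0:ℝ)..1, φ x = ∫ x in (0:ℝ)..1, d x → |J| ≤ N →
    ∃ j : Jet, C2F L a (C * N) j ∧ (∀ z ∈ strip L, j.wx z - j.uy z = ω z) ∧
      (∀ x, j.w (x, 0) = φ x) ∧ (∀ x, j.w (x, L) = d x) ∧ -∫ y in (0:ℝ)..L, j.u (0, y) = J := by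
  obtain ⟨C, hC, hT⟩ := exists_divcurl ha hL
  have hi : 0 < L⁻¹ := inv_pos.2 hL
  set K := 2 * C + 1 with hK
  refine ⟨8 * (1 + L) * K + 2 + L⁻¹, by positivity,
    fun N ω ωx ωy φ φ1 φ2 d d1 d2 J gω pω hω hωx hωy hφ hd hm hJ => ?_⟩
  have hN := hω.nonneg ⟨_, origin_mem hL⟩
  have h0 : (0:ℝ) ∈ Icc 0 L := left_mem_Icc.2 hL.le
  have hLm : L ∈ Icc 0 L := right_mem_Icc.2 hL.le
  obtain ⟨u', w, ux, uy, wx, h', hc, hw0, hwL⟩ := hT N ωx φ1 φ2 d1 d2 hωx (gω.perS hL pω).1 hφ.b1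
    hd.b1 (by rw [hφ.b0.integral ha.1, hd.b0.integral ha.1])
  set c := ∫ x in (0:ℝ)..1, u' (x, 0) with hcd
  have hcb : |-c| ≤ C * N := by
    rw [abs_neg]
    simpa using abs_integral_le_of_hol h'.hu (γ := fun x => (x, 0)) zero_le_one
      fun t _ => mem_strip.2 ⟨le_rfl, hL.le⟩
  have h := h'.add_const hcb
  set u : ℝ × ℝ → ℝ := fun z => u' z + -c with hu
  have hum : ∫ x in (0:ℝ)..1, u (x, 0) = 0 := by
    simp only [hu]
    rw [intervalIntegral.integral_add ((cont_x h'.gu.continuousOn h0).intervalIntegrable _ _)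
      intervalIntegrable_const, intervalIntegral.integral_const]
    simp [hcd]
  have guy : Grad L (fun z => w z - ω z) uy (fun z => -ux z - ωy z) :=
    (h.gw.sub gω).congr (fun _ _ => rfl) (fun z hz => by linarith [hc z hz]) fun _ _ => rfl
  obtain ⟨U, gU, hU0⟩ := exists_potential h.gu guy (fun _ _ => rfl) 0
  obtain ⟨W, gW, hW0⟩ := exists_potential h.gw h.gu.neg (fun _ _ => rfl) (φ 0)
  have pU : PerS L U := fun x y hy => by
    rw [gU.quasiperiodic hL h.pu (fun x y hy => by simp only [h.pw x y hy, pω x y hy]) x y hy,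
      ← gU.ftc_x h.gu.continuousOn h0 0 1, hum, add_zero]
  have pW : PerS L W := fun x y hy => by
    rw [gW.quasiperiodic hL h.pw (fun x y hy => by simp only [h.pu x y hy]) x y hy,
      ← gW.ftc_x h.gw.continuousOn h0 0 1]
    simp only [hw0, hφ.b0.integral ha.1, add_zero]
  have W0 : ∀ x, W (x, 0) = φ x := fun x => by
    have := eq_of_deriv_eq (fun x => gW.hasDerivAt_x (x := x) h0)
      (fun x => by rw [hw0]; exact hφ.b0.der x) x 0
    linarith
  have WL : ∀ x, W (x, L) = d x := by
    have h1 : ∀ x, W (x, L) = d x + (W (0, L) - d 0) := fun x => by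
      have := eq_of_deriv_eq (fun x => gW.hasDerivAt_x (x := x) hLm)
        (fun x => by rw [hwL]; exact hd.b0.der x) x 0
      linarith
    have h2 := mean_eq hL gU gW pU h.gu.continuousOn
    simp only [W0] at h2
    rw [hm, intervalIntegral.integral_congr (g := fun x => d x + (W (0, L) - d 0)) fun x _ => h1 x,
      intervalIntegral.integral_add ((hd.b0.cont ha.1).1.intervalIntegrable _ _)
      intervalIntegrable_const, intervalIntegral.integral_const] at h2
    simp only [sub_zero, one_smul] at h2
    intro x
    rw [h1]; linarith
  have hKN : C * N + C * N ≤ K * N := by rw [hK]; nlinarith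
  have huy : Hol (strip L) a (K * N) (fun z => w z - ω z) :=
    (h.hw.sub hω).mono (by rw [hK]; linarith)
  have hUh := gU.hol_of_per ha hL pU hU0 (h.hu.mono hKN).1 huy.1
  have hWh := (gW.add_const (-φ 0)).hol_of_per ha hL (fun x y hy => by simp only [pW x y hy])
    (by rw [hW0]; ring) (h.hw.mono hKN).1 (h.hu.neg.mono hKN).1
  have hWh' : Hol (strip L) a (4 * (1 + L) * (K * N) + N) W :=
    (hWh.add (Hol.const (φ 0) (hφ.b0.h0.1 0 (mem_univ _)))).congr fun z _ => by ring
  have hKN0 : 0 ≤ K * N := by positivity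
  have hKN1 : K * N ≤ 4 * (1 + L) * (K * N) + N := by nlinarith
  have hC1 : C1F L a (4 * (1 + L) * (K * N) + N) U W u (fun z => w z - ω z) w :=
    ⟨gU, gW, pU, pW, hUh.mono (by linarith), hWh', h.hu.mono (hKN.trans hKN1), huy.mono hKN1,
      h.hw.mono (hKN.trans hKN1)⟩
  obtain ⟨e, he, heb⟩ := hC1.exists_flux hL (-J)
  rw [abs_neg] at heb
  have hJ' : L⁻¹ * |J| ≤ L⁻¹ * N := by gcongr
  set R := (8 * (1 + L) * K + 2 + L⁻¹) * N with hR
  have hfin : 4 * (1 + L) * (K * N) + N + (4 * (1 + L) * (K * N) + N + L⁻¹ * |J|) ≤ R := by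
    rw [hR]; linarith
  have hKf : K * N ≤ R := by
    have := abs_nonneg J
    have : 0 ≤ L⁻¹ * |J| := by positivity
    linarith
  refine ⟨⟨fun z => U z + e, W, u, fun z => w z - ω z, w, ux, uy, fun z => -ux z - ωy z, wx⟩,
    ⟨(hC1.add_const heb).mono hfin, h.gu, guy, h.gw, h.hux.mono (hKN.trans hKf),
      h.huy.mono (hKN.trans hKf), (h.hux.neg.sub hωy).mono (by rw [hK] at hKf; linarith),
      h.hwx.mono (hKN.trans hKf)⟩, fun z _ => by simp, W0, WL, ?_⟩
  simp only
  rw [he, neg_neg]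

end StrongDivCurl

section Footpoints

variable {L a D M N : ℝ} {φ φ1 : ℝ → ℝ} {u w ux uy wx X : ℝ × ℝ → ℝ}

theorem B1.small (h : B1 a D φ φ1) (hD : D ≤ 1 / 4) (x : ℝ) : 1 / 2 ≤ 1 + φ x := by
  have := h.h0.1 x (mem_univ _)
  rw [Real.norm_eq_abs] at this
  linarith [neg_abs_le (φ x)]

theorem B1.inv_hol (h : B1 a D φ φ1) (hD : D ≤ 1 / 4) : Hol univ a 2 fun x => (1 + φ x)⁻¹ :=
  h.h0.inv_one_add (by linarith)

/-- The flux `Ψ` through `[0, x]` and its inverse function `Θ`. -/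
theorem exists_flux_inverse (ha : 0 < a) (h : B1 a D φ φ1) (hD : D ≤ 1 / 4) : ∃ Ψ Θ : ℝ → ℝ,
    Ψ 0 = 0 ∧ (∀ x, HasDerivAt Ψ (1 + φ x) x) ∧ (∀ x, Ψ (x + 1) = Ψ x + Ψ 1) ∧
    (∀ x, Θ (Ψ x) = x) ∧ (∀ s, Ψ (Θ s) = s) ∧ (∀ s, HasDerivAt Θ (1 + φ (Θ s))⁻¹ s) ∧
    ∀ s t, ‖Θ s - Θ t‖ ≤ 2 * ‖s - t‖ := by
  have hc : Continuous fun x => 1 + φ x := continuous_const.add (h.cont ha).1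
  set Ψ : ℝ → ℝ := fun x => ∫ t in (0:ℝ)..x, (1 + φ t) with hΨ
  have hd : ∀ x, HasDerivAt Ψ (1 + φ x) x := fun x =>
    intervalIntegral.integral_hasDerivAt_right (hc.intervalIntegrable _ _)
      (hc.stronglyMeasurableAtFilter _ _) hc.continuousAt
  have hΨ0 : Ψ 0 = 0 := intervalIntegral.integral_same
  have hΨc : Continuous Ψ := continuous_iff_continuousAt.2 fun x => (hd x).continuousAt
  have hmono : Monotone fun x => Ψ x - 1 / 2 * x := by
    have hd' : ∀ x, HasDerivAt (fun x => Ψ x - 1 / 2 * x) (1 + φ x - 1 / 2) x := fun x => by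
      have := (hd x).sub ((hasDerivAt_id x).const_mul (1 / 2 : ℝ))
      rw [mul_one] at this
      exact this
    refine monotone_of_deriv_nonneg (fun x => (hd' x).differentiableAt) fun x => ?_
    rw [(hd' x).deriv]
    linarith [h.small hD x]
  have hgap : ∀ x y, x ≤ y → y - x ≤ 2 * (Ψ y - Ψ x) := fun x y hxy => by
    have := hmono hxy
    simp only at this
    linarith
  have hlow : ∀ x y, |x - y| ≤ 2 * |Ψ x - Ψ y| := fun x y => by
    rcases le_total x y with hxy | hxy
    · rw [abs_sub_comm, abs_of_nonneg (sub_nonneg.2 hxy), abs_sub_comm]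
      exact (hgap x y hxy).trans (by linarith [le_abs_self (Ψ y - Ψ x)])
    · rw [abs_of_nonneg (sub_nonneg.2 hxy)]
      exact (hgap y x hxy).trans (by linarith [le_abs_self (Ψ x - Ψ y)])
  have hsurj : Function.Surjective Ψ := by
    refine hΨc.surjective ?_ ?_
    · refine Filter.tendsto_atTop_mono' _ ?_
        (Filter.tendsto_id.const_mul_atTop (by norm_num : (0:ℝ) < 1 / 2))
      filter_upwards [Filter.eventually_ge_atTop 0] with x hx
      have := hgap 0 x hx
      simp only [id]; linarith
    · refine Filter.tendsto_atBot_mono' _ ?_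
        (Filter.tendsto_id.const_mul_atBot (by norm_num : (0:ℝ) < 1 / 2))
      filter_upwards [Filter.eventually_le_atBot 0] with x hx
      have := hgap x 0 hx
      simp only [id]; linarith
  have hr : ∀ s, Ψ (Function.surjInv hsurj s) = s := Function.surjInv_eq hsurj
  set Θ := Function.surjInv hsurj
  have hlip : ∀ s t, ‖Θ s - Θ t‖ ≤ 2 * ‖s - t‖ := fun s t => by
    have := hlow (Θ s) (Θ t)
    rwa [hr, hr] at this
  have hΘc : Continuous Θ :=
    (LipschitzWith.of_dist_le_mul (K := 2) fun s t => by
      rw [dist_eq_norm, dist_eq_norm]; exact hlip s t).continuous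
  refine ⟨Ψ, Θ, hΨ0, hd, fun x => ?_, fun x => ?_, hr, fun s => ?_, hlip⟩
  · have := eq_of_deriv_eq (f := fun x => Ψ (x + 1)) (g := Ψ) (f' := fun x => 1 + φ x)
      (fun x => by
        have := (hd (x + 1)).comp_add_const x 1
        rwa [h.per] at this) hd x 0
    rw [hΨ0, zero_add] at this
    linarith
  · have := hlow (Θ (Ψ x)) x
    rw [hr, sub_self, abs_zero, mul_zero] at this
    exact sub_eq_zero.1 (abs_nonpos_iff.1 this)
  · exact HasDerivAt.of_local_left_inverse hΘc.continuousAt (hd (Θ s))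
      (by linarith [h.small hD (Θ s)]) (Filter.Eventually.of_forall hr)

/-- `X z` is the label of the streamline of `(u, 1 + w)` through `z`, i.e. its abscissa on the
bottom boundary, where `w = φ`. -/
structure Foot (L : ℝ) (φ : ℝ → ℝ) (u w X : ℝ × ℝ → ℝ) : Prop where
  grad : Grad L X (fun z => (1 + w z) * (1 + φ (X z))⁻¹) (fun z => -u z * (1 + φ (X z))⁻¹)
  bot : ∀ x, X (x, 0) = x
  per : ∀ x, ∀ y ∈ Icc 0 L, X (x + 1, y) = X (x, y) + 1

theorem exists_foot (ha : 0 < a) (hL : 0 < L) (h : B1 a D φ φ1) (hD : D ≤ 1 / 4)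
    (hj : C1F L a N u w ux uy wx) (hw0 : ∀ x, w (x, 0) = φ x) : ∃ X, Foot L φ u w X := by
  obtain ⟨Ψ, Θ, hΨ0, hΨd, hΨp, hΘΨ, hΨΘ, hΘd, -⟩ := exists_flux_inverse ha h hD
  have h0 : (0:ℝ) ∈ Icc 0 L := left_mem_Icc.2 hL.le
  have gV : Grad L (fun z => 1 + w z) wx (fun z => -ux z) :=
    (hj.gw.add_const 1).congr (fun z _ => add_comm _ _) (fun _ _ => rfl) fun _ _ => rfl
  obtain ⟨ψ, gψ, hψ0⟩ := exists_potential gV hj.gu.neg (fun _ _ => rfl) 0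
  have hψb : ∀ x, ψ (x, 0) = Ψ x := fun x => by
    have := eq_of_deriv_eq (f := fun x => ψ (x, 0)) (g := Ψ) (f' := fun x => 1 + φ x) (fun x => by
      have := gψ.hasDerivAt_x (x := x) h0
      rwa [hw0] at this) hΨd x 0
    rw [hψ0, hΨ0] at this
    linarith
  have hψp : ∀ x, ∀ y ∈ Icc 0 L, ψ (x + 1, y) = ψ (x, y) + Ψ 1 := fun x y hy => by
    rw [gψ.quasiperiodic hL (fun x y hy => by simp only [hj.pw x y hy])
      (fun x y hy => by simp only [hj.pu x y hy]) x y hy, hψb, hψ0, sub_zero]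
  refine ⟨fun z => Θ (ψ z), ?_, fun x => by simp only [hψb, hΘΨ], fun x y hy => ?_⟩
  · exact (gψ.comp (H' := fun s => (1 + φ (Θ s))⁻¹) fun z _ => hΘd (ψ z)).congr (fun _ _ => rfl) (fun z _ => mul_comm _ _)
      fun z _ => mul_comm _ _
  · rw [hψp x y hy, ← hΨΘ (ψ (x, y)), ← hΨp, hΘΨ, hΘΨ]

theorem Foot.potential (hX : Foot L φ u w X) (h : B1 a D φ φ1) (hD : D ≤ 1 / 4) {Ψ : ℝ → ℝ}
    (hΨ : ∀ x, HasDerivAt Ψ (1 + φ x) x) :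
    Grad L (fun z => Ψ (X z)) (fun z => 1 + w z) fun z => -u z := by
  refine (hX.grad.comp (H' := fun x => 1 + φ x) fun z _ => hΨ (X z)).congr (fun _ _ => rfl)
    (fun z _ => ?_) fun z _ => ?_
  all_goals have := h.small hD (X z); field_simp

theorem Foot.lip (hX : Foot L φ u w X) (h : B1 a D φ φ1) (hD : D ≤ 1 / 4)
    (hj : C1F L a N u w ux uy wx) (hN : N ≤ 1 / 4) :
    ∀ z ∈ strip L, ∀ z' ∈ strip L, ‖X z - X z'‖ ≤ 5 * ‖z - z'‖ := by
  have hb : ∀ z, ‖(1 + φ (X z))⁻¹‖ ≤ 2 := fun z => (h.inv_hol hD).1 _ (mem_univ _)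
  have := hX.grad.lip (N := 5 / 2) (fun z hz => ?_) (fun z hz => ?_)
  · intro z hz z' hz'
    refine (this z hz z' hz').trans (le_of_eq (by ring))
  · have h1 := hj.hw.1 z hz
    have h2 : ‖1 + w z‖ ≤ 5 / 4 := (norm_add_le _ _).trans (by rw [norm_one]; linarith)
    rw [norm_mul]
    nlinarith [hb z, norm_nonneg (1 + w z), norm_nonneg (1 + φ (X z))⁻¹]
  · have h1 := hj.hu.1 z hz
    rw [norm_mul, norm_neg]
    nlinarith [hb z, norm_nonneg (u z), norm_nonneg (1 + φ (X z))⁻¹]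

theorem Foot.comp_hol (hX : Foot L φ u w X) (ha : a ∈ Ioo (0:ℝ) 1) (h : B1 a D φ φ1)
    (hD : D ≤ 1 / 4) (hj : C1F L a N u w ux uy wx) (hN : N ≤ 1 / 4) {f : ℝ → ℝ}
    (hf : Hol univ a M f) : Hol (strip L) a (5 * M) fun z => f (X z) :=
  hf.comp_lip ha.1 ha.2.le (fun _ _ => mem_univ _) (by norm_num) (hX.lip h hD hj hN)

/-- Footpoints depend Lipschitz continuously on the field. -/
theorem Foot.sub_hol (ha : a ∈ Ioo (0:ℝ) 1) (hL : 0 < L) (h : B1 a D φ φ1) (hD : D ≤ 1 / 4)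
    {u' w' ux' uy' wx' X' : ℝ × ℝ → ℝ} (hX : Foot L φ u w X) (hX' : Foot L φ u' w' X')
    (hj : C1F L a M u w ux uy wx) (hj' : C1F L a M u' w' ux' uy' wx') (hM : M ≤ 1 / 4)
    (hu : Hol (strip L) a N fun z => u z - u' z) (hw : Hol (strip L) a N fun z => w z - w' z) :
    Hol (strip L) a (80 * (1 + L) * N) fun z => X z - X' z := by
  obtain ⟨Ψ, Θ, hΨ0, hΨd, hΨp, hΘΨ, hΨΘ, hΘd, hΘl⟩ := exists_flux_inverse ha.1 h hD
  have g := hX.potential h hD hΨd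
  have g' := hX'.potential h hD hΨd
  have hdiff : Hol (strip L) a (4 * (1 + L) * N) fun z => Ψ (X z) - Ψ (X' z) := by
    refine (g.sub g').hol_of_per ha hL (fun x y hy => ?_) ?_ (fun z hz => ?_) fun z hz => ?_
    · simp only [hX.per x y hy, hX'.per x y hy, hΨp]; ring
    · rw [hX.bot, hX'.bot, sub_self]
    · rw [add_sub_add_left_eq_sub]; exact hw.1 z hz
    · rw [← norm_neg, neg_sub, sub_neg_eq_add, neg_add_eq_sub]; exact hu.1 z hz
  have hΘh : Hol univ a (2 * 2) fun s => (1 + φ (Θ s))⁻¹ :=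
    (h.inv_hol hD).comp_lip ha.1 ha.2.le (fun _ _ => mem_univ _) one_le_two
      fun s _ t _ => hΘl s t
  have hl : ∀ {u w ux uy wx X : ℝ × ℝ → ℝ}, C1F L a M u w ux uy wx →
      Grad L (fun z => Ψ (X z)) (fun z => 1 + w z) (fun z => -u z) →
      ∀ z ∈ strip L, ∀ z' ∈ strip L, ‖Ψ (X z) - Ψ (X z')‖ ≤ 5 / 2 * ‖z - z'‖ := fun {u w _ _ _ _} hj g => by
    have := g.lip (N := 5 / 4)
      (fun z hz => (norm_add_le _ _).trans (by rw [norm_one]; linarith [hj.hw.1 z hz]))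
      (fun z hz => by rw [norm_neg]; linarith [hj.hu.1 z hz])
    intro z hz z' hz'
    exact (this z hz z' hz').trans (le_of_eq (by ring))
  refine ((Hol.comp_sub ha.1 ha.2.le hΘd hΘh (by norm_num) (hl hj g) (hl hj' g') hdiff).mono
    (le_of_eq (by ring))).congr fun z _ => by simp only [hΘΨ]

theorem Foot.comp_per {f : ℝ → ℝ} (hX : Foot L φ u w X) (hf : Per f) :
    PerS L fun z => f (X z) := fun x y hy => by
  simp only [hX.per x y hy, hf (X (x, y))]

end Footpoints

section FixedPointMap

variable {L a D M N : ℝ}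

/-- Boundary data, with derivatives: `w = φ` and `p = m` on the bottom, `∂ₓp = ∂ₓk` on the top,
and flux `J`. -/
structure BdryData where
  φ : ℝ → ℝ
  φ1 : ℝ → ℝ
  φ2 : ℝ → ℝ
  m : ℝ → ℝ
  μ : ℝ → ℝ
  μ1 : ℝ → ℝ
  k : ℝ → ℝ
  κ : ℝ → ℝ
  κ1 : ℝ → ℝ
  J : ℝ

structure BdryData.Good (a D : ℝ) (b : BdryData) : Prop where
  hφ : B2 a D b.φ b.φ1 b.φ2
  dm : ∀ x, HasDerivAt b.m (b.μ x) x
  pm : Per b.m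
  hμ : B1 a D b.μ b.μ1
  dk : ∀ x, HasDerivAt b.k (b.κ x) x
  pk : Per b.k
  hκ : B1 a D b.κ b.κ1
  hJ : |b.J| ≤ D

/-- The vorticity on the bottom boundary, as determined by the tangential momentum equation. -/
def botVort (b : BdryData) (j : Jet) (x : ℝ) : ℝ :=
  (b.μ x + j.u (x, 0) * j.ux (x, 0)) * (1 + b.φ x)⁻¹ + b.φ1 x

def botVort' (b : BdryData) (j : Jet) (x : ℝ) : ℝ :=
  (b.μ1 x + (j.ux (x, 0) * j.ux (x, 0) + j.u (x, 0) * j.uxx (x, 0))) * (1 + b.φ x)⁻¹ +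
    (b.μ x + j.u (x, 0) * j.ux (x, 0)) * (-(b.φ1 x * ((1 + b.φ x)⁻¹ * (1 + b.φ x)⁻¹))) + b.φ2 x

/-- The Bernoulli function on the bottom boundary. -/
def botHead (b : BdryData) (j : Jet) (x : ℝ) : ℝ :=
  b.m x + 1 / 2 * (j.u (x, 0) * j.u (x, 0) + (1 + b.φ x) * (1 + b.φ x))

variable {b : BdryData} {j : Jet}

theorem botVort_hasDerivAt (hL : 0 < L) (hb : b.Good a D) (hD : D ≤ 1 / 4) (hj : C2F L a M j)
    (x : ℝ) : HasDerivAt (botVort b j) (botVort' b j x) x := by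
  have h0 : (0:ℝ) ∈ Icc 0 L := left_mem_Icc.2 hL.le
  have hV := hb.hφ.b0.small hD x
  have h1 := (hj.c1.gu.hasDerivAt_x (x := x) h0).mul (hj.gux.hasDerivAt_x (x := x) h0)
  have h2 := (((hb.hφ.b0.der x).const_add 1).inv (by linarith))
  have h3 := (((hb.hμ.der x).add h1).mul h2).add (hb.hφ.b1.der x)
  refine h3.congr_deriv ?_
  simp only [botVort', Pi.add_apply, Pi.mul_apply, Pi.inv_apply]
  field_simp

theorem botHead_hasDerivAt (hL : 0 < L) (hb : b.Good a D) (hD : D ≤ 1 / 4) (hj : C2F L a M j)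
    (x : ℝ) : HasDerivAt (botHead b j) ((1 + b.φ x) * botVort b j x) x := by
  have h0 : (0:ℝ) ∈ Icc 0 L := left_mem_Icc.2 hL.le
  have hV := hb.hφ.b0.small hD x
  have h1 := hj.c1.gu.hasDerivAt_x (x := x) h0
  have h2 := (hb.hφ.b0.der x).const_add 1
  have h3 := (hb.dm x).add (((h1.mul h1).add (h2.mul h2)).const_mul (1 / 2 : ℝ))
  refine h3.congr_deriv ?_
  simp only [botVort]
  field_simp
  ring

theorem botVort_per (hL : 0 < L) (hb : b.Good a D) (hj : C2F L a M j) : Per (botVort b j) :=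
  fun x => by
  have h0 : (0:ℝ) ∈ Icc 0 L := left_mem_Icc.2 hL.le
  have := (hj.c1.gu.perS hL hj.c1.pu).1 x 0 h0
  simp only [botVort, hb.hμ.per x, hj.c1.pu x 0 h0, this, hb.hφ.b0.per x, hb.hφ.b1.per x]

theorem botHead_per (hL : 0 < L) (hb : b.Good a D) (hj : C2F L a M j) : Per (botHead b j) :=
  fun x => by
  simp only [botHead, hb.pm x, hj.c1.pu x 0 (left_mem_Icc.2 hL.le), hb.hφ.b0.per x]

theorem bot_hol (hL : 0 < L) (hb : b.Good a D) (hD : D ≤ 1 / 4) (hj : C2F L a M j) :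
    Hol univ a (33 * (D + M ^ 2)) (botVort b j) ∧ Hol univ a (33 * (D + M ^ 2)) (botVort' b j) := by
  have h0 : (0:ℝ) ∈ Icc 0 L := left_mem_Icc.2 hL.le
  have hi := hb.hφ.b0.inv_hol hD
  have hu := slice_hol_of_mem hj.c1.hu h0
  have hux := slice_hol_of_mem hj.c1.hux h0
  have huxx := slice_hol_of_mem hj.huxx h0
  have hD0 := hb.hμ.h0.nonneg ⟨0, mem_univ 0⟩
  have hA := hb.hμ.h0.add (hu.mul hux)
  have hM := sq_nonneg M
  constructor
  · refine ((hA.mul hi).add hb.hφ.b1.h0).mono ?_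
    nlinarith
  · refine ((((hb.hμ.h1.add ((hux.mul hux).add (hu.mul huxx))).mul hi).add
      (hA.mul ((hb.hφ.b1.h0.mono hD).mul (hi.mul hi)).neg)).add hb.hφ.b1.h1).mono ?_
    nlinarith

/-- `j'` is the image of `j` under the fixed point map; `X` is the footpoint map of `j`. -/
structure Step (L : ℝ) (b : BdryData) (X : ℝ × ℝ → ℝ) (j j' : Jet) : Prop where
  foot : Foot L b.φ j.u j.w X
  curl : ∀ z ∈ strip L, j'.wx z - j'.uy z = botVort b j (X z)
  bot : ∀ x, j'.w (x, 0) = b.φ x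
  top : ∀ x, j'.wx (x, L) = (1 + j.w (x, L)) * botVort b j (X (x, L)) -
    j.w (x, L) * j.wx (x, L) - j.u (x, L) * j.ux (x, L) - b.κ x
  flux : -∫ y in (0:ℝ)..L, j'.u (0, y) = b.J

theorem hol_of_mean {f f1 : ℝ → ℝ} (ha : a ∈ Ioo (0:ℝ) 1) (hd : ∀ x, HasDerivAt f (f1 x) x)
    (hp : Per f) (h1 : ∀ x, |f1 x| ≤ N) (hm : |∫ x in (0:ℝ)..1, f x| ≤ N) : Hol univ a (4 * N) f := by
  have hN : 0 ≤ N := (abs_nonneg _).trans hm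
  have hlip : ∀ x y, |f x - f y| ≤ N * |x - y| := fun x y => by
    have := convex_univ.norm_image_sub_le_of_norm_hasDerivWithin_le (C := N) (f := f)
      (fun x _ => (hd x).hasDerivWithinAt) (fun x _ => h1 x) (mem_univ y) (mem_univ x)
    exact this
  have hc : Continuous f := continuous_iff_continuousAt.2 fun x => (hd x).continuousAt
  have hb : ∀ x ∈ Icc (0:ℝ) 1, |f x| ≤ 2 * N := fun x hx => by
    have e : f x = (∫ t in (0:ℝ)..1, (f x - f t)) + ∫ t in (0:ℝ)..1, f t := by
      rw [intervalIntegral.integral_sub intervalIntegrable_const (hc.intervalIntegrable _ _),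
        intervalIntegral.integral_const]
      simp
    have h2 := intervalIntegral.norm_integral_le_of_norm_le_const (a := 0) (b := 1) (C := N)
      (f := fun t => f x - f t) fun t ht => by
        rw [uIoc_of_le zero_le_one] at ht
        refine (hlip x t).trans (mul_le_of_le_one_right hN (abs_le.2 ⟨?_, ?_⟩)) <;>
          linarith [hx.1, hx.2, ht.1, ht.2]
    rw [Real.norm_eq_abs, sub_zero, abs_one, mul_one] at h2
    rw [e]
    exact (abs_add_le _ _).trans (by linarith)
  refine Hol.of_lip (N := 2 * N) ha.1 ha.2.le (fun x _ => ?_) (fun x _ y _ => ?_) (by linarith)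
  · have hp' : Function.Periodic f 1 := hp
    have := hb (Int.fract x) ⟨Int.fract_nonneg x, (Int.fract_lt_one x).le⟩
    rwa [Int.fract, ← mul_one (⌊x⌋ : ℝ), hp'.sub_int_mul_eq] at this
  · refine (hlip x y).trans ?_
    rw [Real.norm_eq_abs]
    nlinarith [abs_nonneg (x - y)]

/-- The fixed point map is well defined. -/
theorem exists_step (ha : a ∈ Ioo (0:ℝ) 1) (hL : 0 < L) : ∃ C > (0:ℝ), ∀ D M b X j,
    BdryData.Good a D b → D ≤ 1 / 4 → C2F L a M j → M ≤ 1 / 4 → Foot L b.φ j.u j.w X →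
    ∃ j', Step L b X j j' ∧ C2F L a (C * (D + M ^ 2)) j' := by
  obtain ⟨C, hC, hT⟩ := exists_divcurl_strong ha hL
  refine ⟨C * 40000, by positivity, fun D M b X j hb hD hj hM hX => ?_⟩
  have hLm : L ∈ Icc 0 L := right_mem_Icc.2 hL.le
  have hφ := hb.hφ.b0
  have hD0 : 0 ≤ D := hb.hμ.h0.nonneg ⟨0, mem_univ 0⟩
  have hM0 : 0 ≤ M := hj.c1.hu.nonneg ⟨_, origin_mem hL⟩
  have hM2 := sq_nonneg M
  set S := D + M ^ 2 with hS
  have hS0 : 0 ≤ S := by positivity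
  obtain ⟨hW, hW'⟩ := bot_hol hL hb hD hj
  have hω := hX.comp_hol ha hφ hD hj.c1 hM hW
  have hω' := hX.comp_hol ha hφ hD hj.c1 hM hW'
  have hi := hX.comp_hol ha hφ hD hj.c1 hM (hφ.inv_hol hD)
  have h1w : Hol (strip L) a (5 / 4) fun z => 1 + j.w z :=
    ((Hol.const (N := 1) 1 (by simp)).add hj.c1.hw).mono (by linarith)
  have gω := hX.grad.comp (H' := botVort' b j) fun z _ => botVort_hasDerivAt hL hb hD hj (X z)
  have pω : PerS L fun z => botVort b j (X z) := hX.comp_per (botVort_per hL hb hj)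
  set ω : ℝ × ℝ → ℝ := fun z => botVort b j (X z) with hωd
  set ωx : ℝ × ℝ → ℝ := fun z => botVort' b j (X z) * ((1 + j.w z) * (1 + b.φ (X z))⁻¹) with hωxd
  have hωx : Hol (strip L) a (8250 * S) ωx := (hω'.mul (h1w.mul hi)).mono (by linarith)
  have hωy := hω'.mul (hj.c1.hu.neg.mul hi)
  have gH := hX.grad.comp (H' := fun x => (1 + b.φ x) * botVort b j x)
    fun z _ => botHead_hasDerivAt hL hb hD hj (X z)
  have pH := hX.comp_per (botHead_per hL hb hj)
  -- the normal velocity on the top boundary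
  have gE := gH.sub ((((hj.c1.gw.mul hj.c1.gw).add (hj.c1.gu.mul hj.c1.gu))).const_mul (1 / 2))
  set E : ℝ × ℝ → ℝ := fun z => botHead b j (X z) - 1 / 2 * (j.w z * j.w z + j.u z * j.u z) with hE
  set Ex : ℝ × ℝ → ℝ := fun z => (1 + j.w z) * ω z - j.w z * j.wx z - j.u z * j.ux z with hEx
  have gE' : Grad L E Ex _ := gE.congr (fun _ _ => rfl) (fun z _ => by
    have := hφ.small hD (X z)
    simp only [hEx, hωd]; field_simp; ring) fun _ _ => rfl
  have g1w : Grad L (fun z => 1 + j.w z) j.wx (fun z => -j.ux z) :=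
    (hj.c1.gw.add_const 1).congr (fun z _ => add_comm _ _) (fun _ _ => rfl) fun _ _ => rfl
  have gEx := ((g1w.mul gω).sub (hj.c1.gw.mul hj.gwx)).sub (hj.c1.gu.mul hj.gux)
  have hExh : Hol (strip L) a (420 * S) Ex :=
    (((h1w.mul hω).sub (hj.c1.hw.mul hj.c1.hwx)).sub (hj.c1.hu.mul hj.c1.hux)).mono (by nlinarith)
  have hExx := (((hj.c1.hwx.mono hM).mul hω).add (h1w.mul hωx)).sub
      ((hj.c1.hwx.mul hj.c1.hwx).add (hj.c1.hw.mul hj.hwxx)) |>.sub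
      ((hj.c1.hux.mul hj.c1.hux).add (hj.c1.hu.mul hj.huxx))
  have pE : PerS L E := fun x y hy => by
    simp only [hE, pH x y hy, hj.c1.pw x y hy, hj.c1.pu x y hy]
  set e := (∫ x in (0:ℝ)..1, b.φ x) - ∫ x in (0:ℝ)..1, (E (x, L) - b.k x) with he
  have dd0 : ∀ x, HasDerivAt (fun x => E (x, L) - b.k x + e) (Ex (x, L) - b.κ x) x := fun x =>
    ((gE'.hasDerivAt_x hLm).sub (hb.dk x)).add_const e
  have dd1 := fun x => (gEx.hasDerivAt_x (x := x) hLm).sub (hb.hκ.der x)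
  have hd1 := (slice_hol_of_mem hExh hLm).sub hb.hκ.h0
  have hmean : ∫ x in (0:ℝ)..1, (E (x, L) - b.k x + e) = ∫ x in (0:ℝ)..1, b.φ x := by
    have hc : Continuous fun x => E (x, L) - b.k x :=
      (cont_x gE'.continuousOn hLm).sub (continuous_iff_continuousAt.2 fun x => (hb.dk x).continuousAt)
    rw [intervalIntegral.integral_add (hc.intervalIntegrable _ _) intervalIntegrable_const,
      intervalIntegral.integral_const, he]
    simp
  have pd : Per fun x => E (x, L) - b.k x + e := fun x => by simp only [pE x L hLm, hb.pk x]
  have hφm : |∫ x in (0:ℝ)..1, b.φ x| ≤ D := by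
    simpa using intervalIntegral.norm_integral_le_of_norm_le_const (a := 0) (b := 1) (C := D)
      (f := b.φ) fun x _ => hφ.h0.1 x (mem_univ x)
  have hd0 := hol_of_mean (N := 421 * S) ha dd0 pd
    (fun x => (hd1.1 x (mem_univ x)).trans (by linarith)) (by rw [hmean]; linarith)
  have hB0 : B1 a (40000 * S) (fun x => E (x, L) - b.k x + e) (fun x => Ex (x, L) - b.κ x) :=
    ⟨dd0, pd, hd0.mono (by linarith), hd1.mono (by linarith)⟩
  have hB1 : B1 a (40000 * S) (fun x => Ex (x, L) - b.κ x) _ :=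
    ⟨dd1, hB0.per1, hd1.mono (by linarith),
      ((slice_hol_of_mem hExx hLm).sub hb.hκ.h1).mono (by nlinarith)⟩
  have hDS : D ≤ 40000 * S := by linarith
  obtain ⟨j', h1, h2, h3, h4, h5⟩ := hT (40000 * S) ω ωx _ b.φ b.φ1 b.φ2 _ _ _ b.J gω pω
    (hω.mono (by linarith)) (hωx.mono (by linarith)) (hωy.mono (by nlinarith))
    ⟨hφ.mono hDS, hb.hφ.b1.mono hDS⟩ ⟨hB0, hB1⟩ hmean.symm (hb.hJ.trans hDS)
  refine ⟨j', ⟨hX, h2, h3, fun x => ?_, h5⟩, by rw [mul_assoc]; exact h1⟩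
  have t1 := h1.c1.gw.hasDerivAt_x (x := x) hLm
  simp only [h4] at t1
  rw [t1.unique (dd0 x)]

end FixedPointMap

section Contraction

variable {L a D M N : ℝ} {b : BdryData}

/-- The difference of two jets is a `C^{1,a}` field of size `N`. -/
def WDiff (L a N : ℝ) (j j' : Jet) : Prop :=
  C1F L a N (fun z => j.u z - j'.u z) (fun z => j.w z - j'.w z) (fun z => j.ux z - j'.ux z)
    (fun z => j.uy z - j'.uy z) (fun z => j.wx z - j'.wx z)

theorem C1F.sub {u w ux uy wx u' w' ux' uy' wx' : ℝ × ℝ → ℝ} (h : C1F L a M u w ux uy wx)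
    (h' : C1F L a N u' w' ux' uy' wx') :
    C1F L a (M + N) (fun z => u z - u' z) (fun z => w z - w' z) (fun z => ux z - ux' z)
      (fun z => uy z - uy' z) (fun z => wx z - wx' z) :=
  ⟨h.gu.sub h'.gu, (h.gw.sub h'.gw).congr (fun _ _ => rfl) (fun _ _ => rfl) fun z _ => by ring,
    fun x y hy => by simp only [h.pu x y hy, h'.pu x y hy],
    fun x y hy => by simp only [h.pw x y hy, h'.pw x y hy],
    h.hu.sub h'.hu, h.hw.sub h'.hw, h.hux.sub h'.hux, h.huy.sub h'.huy, h.hwx.sub h'.hwx⟩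

theorem mul_sub_mul_hol {E : Type*} [NormedAddCommGroup E] {s : Set E} {f g f' g' : E → ℝ}
    {F G : ℝ} (hf : Hol s a F f) (hg' : Hol s a G g')
    (h : Hol s a M fun z => f z - f' z) (h' : Hol s a N fun z => g z - g' z) :
    Hol s a (2 * F * N + 2 * M * G) fun z => f z * g z - f' z * g' z :=
  ((hf.mul h').add (h.mul hg')).congr fun z _ => by ring

theorem botVort_sub_hol (hL : 0 < L) (hb : b.Good a D) (hD : D ≤ 1 / 4) {j₁ j₂ : Jet}
    (h₁ : C2F L a M j₁) (h₂ : C2F L a M j₂) (h : WDiff L a N j₁ j₂) :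
    Hol univ a (16 * M * N) fun x => botVort b j₁ x - botVort b j₂ x := by
  have h0 : (0:ℝ) ∈ Icc 0 L := left_mem_Icc.2 hL.le
  have := (mul_sub_mul_hol h₁.c1.hu h₂.c1.hux h.hu h.hux)
  exact (((slice_hol_of_mem this h0).mul (hb.hφ.b0.inv_hol hD)).mono (le_of_eq (by ring))).congr
    fun x _ => by simp only [botVort]; ring

theorem step_contract (ha : a ∈ Ioo (0:ℝ) 1) (hL : 0 < L) : ∃ C > (0:ℝ),
    ∀ D M N R b X₁ X₂ j₁ j₂ j₁' j₂', BdryData.Good a D b → D ≤ 1 / 4 → C2F L a M j₁ →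
    C2F L a M j₂ → M ≤ 1 / 4 → WDiff L a N j₁ j₂ → Step L b X₁ j₁ j₁' → Step L b X₂ j₂ j₂' →
    C2F L a R j₁' → C2F L a R j₂' → WDiff L a (C * (D + M) * N) j₁' j₂' := by
  obtain ⟨C, hC, hT⟩ := divcurl_estimate ha hL
  set c := 80 + 330 * (80 * (1 + L)) with hc
  refine ⟨C * (8 * (3 * c + 10 * 165 + 20)), by positivity,
    fun D M N R b X₁ X₂ j₁ j₂ j₁' j₂' hb hD h₁ h₂ hM h s₁ s₂ h₁' h₂' => ?_⟩
  have hLm : L ∈ Icc 0 L := right_mem_Icc.2 hL.le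
  have hφ := hb.hφ.b0
  have hD0 : 0 ≤ D := hb.hμ.h0.nonneg ⟨0, mem_univ 0⟩
  have hM0 : 0 ≤ M := h₁.c1.hu.nonneg ⟨_, origin_mem hL⟩
  have hN0 : 0 ≤ N := h.hu.nonneg ⟨_, origin_mem hL⟩
  have hS : D + M ^ 2 ≤ D + M := by nlinarith
  set S := D + M with hSd
  have hS0 : 0 ≤ S := by positivity
  have hMS : M ≤ S := by linarith
  obtain ⟨hW, hW'⟩ := bot_hol hL hb hD h₂
  have hδ := Foot.sub_hol ha hL hφ hD s₁.foot s₂.foot h₁.c1 h₂.c1 hM h.hu h.hw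
  have hω2 := s₂.foot.comp_hol ha hφ hD h₂.c1 hM (hW.mono (mul_le_mul_of_nonneg_left hS (by norm_num)))
  have hWd := Hol.comp_sub ha.1 ha.2.le (botVort_hasDerivAt hL hb hD h₂)
    (hW'.mono (mul_le_mul_of_nonneg_left hS (by norm_num))) (by norm_num)
    (s₁.foot.lip hφ hD h₁.c1 hM) (s₂.foot.lip hφ hD h₂.c1 hM) hδ
  have hωd : Hol (strip L) a (c * (S * N)) fun z => botVort b j₁ (X₁ z) - botVort b j₂ (X₂ z) := by
    refine (((s₁.foot.comp_hol ha hφ hD h₁.c1 hM (botVort_sub_hol hL hb hD h₁ h₂ h)).add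
      hWd).mono ?_).congr fun z _ => by ring
    have : M * N ≤ S * N := by gcongr
    rw [hc]; nlinarith
  have h1w : Hol (strip L) a (5 / 4) fun z => 1 + j₁.w z :=
    ((Hol.const (N := 1) 1 (by simp)).add h₁.c1.hw).mono (by linarith)
  have hSN : 0 ≤ S * N := by positivity
  have hMN : M * N ≤ S * N := by gcongr
  have hc0 : 0 ≤ c := by positivity
  have htop := ((mul_sub_mul_hol h1w hω2 (f' := fun z => 1 + j₂.w z)
    (h.hw.congr fun z _ => by ring) hωd).sub (mul_sub_mul_hol h₁.c1.hw h₂.c1.hwx h.hw h.hwx)).sub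
    (mul_sub_mul_hol h₁.c1.hu h₂.c1.hux h.hu h.hux)
  have hd1 : Hol univ a ((3 * c + 10 * 165 + 20) * (S * N))
      fun x => j₁'.wx (x, L) - j₂'.wx (x, L) := by
    refine ((slice_hol_of_mem htop hLm).mono ?_).congr fun x _ => by rw [s₁.top, s₂.top]; ring
    have := mul_nonneg hc0 hSN
    nlinarith
  set B := (3 * c + 10 * 165 + 20) * (S * N) with hB
  have hB0 : 0 ≤ B := by positivity
  have hcB : c * (S * N) ≤ 8 * B := by
    rw [hB]; nlinarith [mul_nonneg hc0 hSN]
  have hdiff := h₁'.c1.sub h₂'.c1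
  have hmean : ∫ x in (0:ℝ)..1, (j₁'.w (x, L) - j₂'.w (x, L)) = 0 := by
    rw [mean_eq hL hdiff.gu hdiff.gw hdiff.pu (hdiff.hux.continuousOn ha.1)]
    simp [s₁.bot, s₂.bot]
  have hd : ∀ x, HasDerivAt (fun x => j₁'.w (x, L) - j₂'.w (x, L))
      (j₁'.wx (x, L) - j₂'.wx (x, L)) x := fun x => hdiff.gw.hasDerivAt_x hLm
  have hp : Per fun x => j₁'.w (x, L) - j₂'.w (x, L) := fun x => hdiff.pw x L hLm
  have hd0 := hol_of_mean ha hd hp (fun x => hd1.1 x (mem_univ x)) (by rw [hmean, abs_zero]; exact hB0)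
  have key := hT (8 * B) _ _ _ _ _ _ _ hdiff.gu hdiff.gw hdiff.pu hdiff.pw
    (hdiff.huy.continuousOn ha.1) ((hωd.mono hcB).congr fun z hz => by
      rw [← s₁.curl z hz, ← s₂.curl z hz]; ring) (fun x => by rw [s₁.bot, s₂.bot, sub_self])
    (fun x => rfl) ⟨hd, hp, hd0.mono (by linarith), hd1.mono (by linarith)⟩ hmean (by
      have i1 := ContinuousOn.intervalIntegrable_of_Icc (μ := MeasureTheory.volume) hL.le
        (cont_y h₁'.c1.gu.continuousOn 0)
      have i2 := ContinuousOn.intervalIntegrable_of_Icc (μ := MeasureTheory.volume) hL.le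
        (cont_y h₂'.c1.gu.continuousOn 0)
      rw [intervalIntegral.integral_sub i1 i2]
      linarith [s₁.flux, s₂.flux])
  exact key.mono (le_of_eq (by rw [hB]; ring))

end Contraction

section FixedPoint

variable {L a D M N : ℝ} {b : BdryData}

theorem cauchySeq_of_approx {g : ℕ → ℝ}
    (h : ∀ ε > 0, ∃ q : ℕ → ℝ, CauchySeq q ∧ ∀ n, |g n - q n| ≤ ε) : CauchySeq g := by
  refine Metric.cauchySeq_iff.2 fun ε hε => ?_
  obtain ⟨q, hq, hgq⟩ := h (ε / 4) (by positivity)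
  obtain ⟨n₀, hn⟩ := Metric.cauchySeq_iff.1 hq (ε / 4) (by positivity)
  refine ⟨n₀, fun m hm n hn' => ?_⟩
  have h1 := hn m hm n hn'
  rw [Real.dist_eq] at h1 ⊢
  have e : g m - g n = (g m - q m) + (q m - q n) - (g n - q n) := by ring
  rw [e]
  have h2 := abs_sub (g m - q m + (q m - q n)) (g n - q n)
  have h3 := abs_add_le (g m - q m) (q m - q n)
  linarith [hgq m, hgq n]

/-- Interpolation: uniform Hölder bounds on the gradients turn pointwise convergence of functions
into pointwise convergence of gradients. -/
theorem Grad.tendsto_grad {fn fxn fyn : ℕ → ℝ × ℝ → ℝ} {f : ℝ × ℝ → ℝ} (ha : 0 < a) (hL : 0 < L)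
    (h : ∀ n, Grad L (fn n) (fxn n) (fyn n)) (hx : ∀ n, Hol (strip L) a N (fxn n))
    (hy : ∀ n, Hol (strip L) a N (fyn n))
    (hf : ∀ z ∈ strip L, Filter.Tendsto (fun n => fn n z) Filter.atTop (nhds (f z))) :
    ∃ fx fy : ℝ × ℝ → ℝ,
      (∀ z ∈ strip L, Filter.Tendsto (fun n => fxn n z) Filter.atTop (nhds (fx z))) ∧
      ∀ z ∈ strip L, Filter.Tendsto (fun n => fyn n z) Filter.atTop (nhds (fy z)) := by
  have hsmall : ∀ ε > 0, ∃ s : ℝ, 0 < s ∧ s < L / 2 ∧ 2 * N * s ^ a ≤ ε := fun ε hε => by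
    have h1 : Filter.Tendsto (fun s : ℝ => 2 * N * s ^ a) (nhdsWithin 0 (Ioi 0)) (nhds 0) := by
      have := ((Real.continuousAt_rpow_const 0 a (Or.inr ha.le)).tendsto.const_mul (2 * N))
      rw [Real.zero_rpow ha.ne', mul_zero] at this
      exact this.mono_left nhdsWithin_le_nhds
    obtain ⟨s, hs1, hs2, hs3⟩ := ((h1.eventually (gt_mem_nhds hε)).and
      (((Filter.tendsto_id.mono_left nhdsWithin_le_nhds : Filter.Tendsto id (nhdsWithin (0:ℝ) (Ioi 0))
        (nhds 0)).eventually (gt_mem_nhds (half_pos hL))).and self_mem_nhdsWithin)).exists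
    exact ⟨s, hs3, hs2, hs1.le⟩
  have hc : ∀ z ∈ strip L, ∀ z' ∈ strip L, ∀ t : ℝ, CauchySeq fun n => (fn n z' - fn n z) / t :=
    fun z hz z' hz' t => (((hf z' hz').sub (hf z hz)).div_const t).cauchySeq
  have key : ∀ z ∈ strip L, ∀ z' ∈ strip L, ∀ t : ℝ, t ≠ 0 → ‖z' - z‖ = |t| → ∀ n g,
      fxn n z * (z'.1 - z.1) + fyn n z * (z'.2 - z.2) = g * t →
      |g - (fn n z' - fn n z) / t| ≤ 2 * N * |t| ^ a := fun z hz z' hz' t ht hzt n g hg => by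
    have h1 := (h n).taylor ha (hx n) (hy n) hz hz'
    rw [hzt, hg] at h1
    have e : g - (fn n z' - fn n z) / t = -(fn n z' - fn n z - g * t) / t := by field_simp; ring
    rw [e, abs_div, abs_neg]
    exact (div_le_iff₀ (abs_pos.2 ht)).2 h1
  have cx : ∀ z ∈ strip L, CauchySeq fun n => fxn n z := fun z hz => cauchySeq_of_approx fun ε hε => by
    obtain ⟨s, hs0, hs1, hs2⟩ := hsmall ε hε
    have hz' : (z.1 + s, z.2) ∈ strip L := mem_strip.2 (mem_strip.1 hz)
    refine ⟨_, hc z hz _ hz' s, fun n => (key z hz _ hz' s hs0.ne' (by simp [Prod.norm_def]) n _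
      (by simp)).trans (by rwa [abs_of_pos hs0])⟩
  have cy : ∀ z ∈ strip L, CauchySeq fun n => fyn n z := fun z hz => cauchySeq_of_approx fun ε hε => by
    obtain ⟨s, hs0, hs1, hs2⟩ := hsmall ε hε
    obtain ⟨hz1, hz2⟩ := mem_strip.1 hz
    obtain ⟨t, ht, ht'⟩ : ∃ t : ℝ, |t| = s ∧ (z.1, z.2 + t) ∈ strip L := by
      rcases le_total z.2 (L / 2) with hzL | hzL
      · exact ⟨s, abs_of_pos hs0, mem_strip.2 ⟨by simp only; linarith, by simp only; linarith⟩⟩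
      · exact ⟨-s, by rw [abs_neg, abs_of_pos hs0],
          mem_strip.2 ⟨by simp only; linarith, by simp only; linarith⟩⟩
    have ht0 : t ≠ 0 := fun h0 => by rw [h0, abs_zero] at ht; linarith
    refine ⟨_, hc z hz _ ht' t, fun n => (key z hz _ ht' t ht0 (by simp [Prod.norm_def]) n _
      (by simp)).trans (by rwa [ht])⟩
  choose! fx hfx using fun z hz => cauchySeq_tendsto_of_complete (cx z hz)
  choose! fy hfy using fun z hz => cauchySeq_tendsto_of_complete (cy z hz)
  exact ⟨fx, fy, hfx, hfy⟩

theorem PerS.lim {fn : ℕ → ℝ × ℝ → ℝ} {f : ℝ × ℝ → ℝ} (h : ∀ n, PerS L (fn n))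
    (hf : ∀ z ∈ strip L, Filter.Tendsto (fun n => fn n z) Filter.atTop (nhds (f z))) :
    PerS L f := fun x y hy =>
  tendsto_nhds_unique (hf _ (mem_strip.2 hy))
    ((hf (x, y) (mem_strip.2 hy)).congr fun n => (h n x y hy).symm)

/-- Bounded sets in the strong norm are closed under pointwise limits. -/
theorem C2F.exists_lim (ha : 0 < a) (hL : 0 < L) {s : ℕ → Jet} (h : ∀ n, C2F L a M (s n))
    {U W : ℝ × ℝ → ℝ}
    (hU : ∀ z ∈ strip L, Filter.Tendsto (fun n => (s n).u z) Filter.atTop (nhds (U z)))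
    (hW : ∀ z ∈ strip L, Filter.Tendsto (fun n => (s n).w z) Filter.atTop (nhds (W z))) :
    ∃ j : Jet, C2F L a M j ∧ j.u = U ∧ j.w = W ∧
    (∀ z ∈ strip L, Filter.Tendsto (fun n => (s n).ux z) Filter.atTop (nhds (j.ux z))) ∧
    (∀ z ∈ strip L, Filter.Tendsto (fun n => (s n).uy z) Filter.atTop (nhds (j.uy z))) ∧
    ∀ z ∈ strip L, Filter.Tendsto (fun n => (s n).wx z) Filter.atTop (nhds (j.wx z)) := by
  obtain ⟨ux, uy, tux, tuy⟩ := Grad.tendsto_grad ha hL (fun n => (h n).c1.gu) (fun n => (h n).c1.hux)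
    (fun n => (h n).c1.huy) hU
  obtain ⟨wx, -, twx, -⟩ := Grad.tendsto_grad ha hL (fun n => (h n).c1.gw) (fun n => (h n).c1.hwx)
    (fun n => (h n).c1.hux.neg) hW
  obtain ⟨uxx, uxy, tuxx, tuxy⟩ := Grad.tendsto_grad ha hL (fun n => (h n).gux)
    (fun n => (h n).huxx) (fun n => (h n).huxy) tux
  obtain ⟨-, uyy, -, tuyy⟩ := Grad.tendsto_grad ha hL (fun n => (h n).guy)
    (fun n => (h n).huxy) (fun n => (h n).huyy) tuy
  obtain ⟨wxx, -, twxx, -⟩ := Grad.tendsto_grad ha hL (fun n => (h n).gwx)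
    (fun n => (h n).hwxx) (fun n => (h n).huxx.neg) twx
  exact ⟨⟨U, W, ux, uy, wx, uxx, uxy, uyy, wxx⟩,
    ⟨⟨Grad.lim ha (fun n => (h n).c1.gu) (fun n => (h n).c1.hux) (fun n => (h n).c1.huy) hU tux tuy,
      Grad.lim ha (fun n => (h n).c1.gw) (fun n => (h n).c1.hwx) (fun n => (h n).c1.hux.neg) hW twx
        fun z hz => (tux z hz).neg,
      PerS.lim (fun n => (h n).c1.pu) hU, PerS.lim (fun n => (h n).c1.pw) hW,
      Hol.lim (fun n => (h n).c1.hu) hU, Hol.lim (fun n => (h n).c1.hw) hW,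
      Hol.lim (fun n => (h n).c1.hux) tux, Hol.lim (fun n => (h n).c1.huy) tuy,
      Hol.lim (fun n => (h n).c1.hwx) twx⟩,
    Grad.lim ha (fun n => (h n).gux) (fun n => (h n).huxx) (fun n => (h n).huxy) tux tuxx tuxy,
    Grad.lim ha (fun n => (h n).guy) (fun n => (h n).huxy) (fun n => (h n).huyy) tuy tuxy tuyy,
    Grad.lim ha (fun n => (h n).gwx) (fun n => (h n).hwxx) (fun n => (h n).huxx.neg) twx twxx
      fun z hz => (tuxx z hz).neg,
    Hol.lim (fun n => (h n).huxx) tuxx, Hol.lim (fun n => (h n).huxy) tuxy,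
    Hol.lim (fun n => (h n).huyy) tuyy, Hol.lim (fun n => (h n).hwxx) twxx⟩,
    rfl, rfl, tux, tuy, twx⟩

theorem WDiff.lim {j j' : Jet} {s : ℕ → Jet} (hj : C2F L a M j)
    (hj' : C2F L a M j') (h : ∀ n, WDiff L a N j (s n))
    (hu : ∀ z ∈ strip L, Filter.Tendsto (fun n => (s n).u z) Filter.atTop (nhds (j'.u z)))
    (hw : ∀ z ∈ strip L, Filter.Tendsto (fun n => (s n).w z) Filter.atTop (nhds (j'.w z)))
    (hux : ∀ z ∈ strip L, Filter.Tendsto (fun n => (s n).ux z) Filter.atTop (nhds (j'.ux z)))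
    (huy : ∀ z ∈ strip L, Filter.Tendsto (fun n => (s n).uy z) Filter.atTop (nhds (j'.uy z)))
    (hwx : ∀ z ∈ strip L, Filter.Tendsto (fun n => (s n).wx z) Filter.atTop (nhds (j'.wx z))) :
    WDiff L a N j j' := by
  have hd := hj.c1.sub hj'.c1
  exact ⟨hd.gu, hd.gw, hd.pu, hd.pw,
    Hol.lim (fun n => (h n).hu) fun z hz => (hu z hz).const_sub _,
    Hol.lim (fun n => (h n).hw) fun z hz => (hw z hz).const_sub _,
    Hol.lim (fun n => (h n).hux) fun z hz => (hux z hz).const_sub _,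
    Hol.lim (fun n => (h n).huy) fun z hz => (huy z hz).const_sub _,
    Hol.lim (fun n => (h n).hwx) fun z hz => (hwx z hz).const_sub _⟩

/-- Two jets are limits of the same sequence in the weak norm only if they agree. -/
theorem WDiff.eq {j₁ j₂ : Jet} {s : ℕ → Jet} {e : ℕ → ℝ}
    (he : Filter.Tendsto e Filter.atTop (nhds 0)) (h₁ : ∀ n, WDiff L a (e n) (s n) j₁)
    (h₂ : ∀ n, WDiff L a (e n) (s n) j₂) : ∀ z ∈ strip L, j₁.u z = j₂.u z ∧ j₁.w z = j₂.w z ∧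
      j₁.ux z = j₂.ux z ∧ j₁.uy z = j₂.uy z ∧ j₁.wx z = j₂.wx z := fun z hz => by
  have key : ∀ (x y : ℝ) (q : ℕ → ℝ), (∀ n, |q n - x| ≤ e n) → (∀ n, |q n - y| ≤ e n) → x = y :=
    fun x y q hx hy => by
    have t1 : Filter.Tendsto q Filter.atTop (nhds x) := tendsto_iff_norm_sub_tendsto_zero.2
      (squeeze_zero (fun _ => norm_nonneg _) hx he)
    have t2 : Filter.Tendsto q Filter.atTop (nhds y) := tendsto_iff_norm_sub_tendsto_zero.2
      (squeeze_zero (fun _ => norm_nonneg _) hy he)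
    exact tendsto_nhds_unique t1 t2
  exact ⟨key _ _ _ (fun n => (h₁ n).hu.1 z hz) fun n => (h₂ n).hu.1 z hz,
    key _ _ _ (fun n => (h₁ n).hw.1 z hz) fun n => (h₂ n).hw.1 z hz,
    key _ _ _ (fun n => (h₁ n).hux.1 z hz) fun n => (h₂ n).hux.1 z hz,
    key _ _ _ (fun n => (h₁ n).huy.1 z hz) fun n => (h₂ n).huy.1 z hz,
    key _ _ _ (fun n => (h₁ n).hwx.1 z hz) fun n => (h₂ n).hwx.1 z hz⟩

theorem Step.congr (hL : 0 < L) {j j₁ j₂ : Jet} {X : ℝ × ℝ → ℝ} (h : Step L b X j j₁)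
    (he : ∀ z ∈ strip L, j₁.u z = j₂.u z ∧ j₁.w z = j₂.w z ∧
      j₁.ux z = j₂.ux z ∧ j₁.uy z = j₂.uy z ∧ j₁.wx z = j₂.wx z) : Step L b X j j₂ := by
  have hm : ∀ x, ∀ y ∈ Icc 0 L, (x, y) ∈ strip L := fun x y hy => mem_strip.2 hy
  refine ⟨h.foot, fun z hz => ?_, fun x => ?_, fun x => ?_, ?_⟩
  · obtain ⟨-, -, -, h4, h5⟩ := he z hz
    rw [← h4, ← h5]; exact h.curl z hz
  · rw [← (he _ (hm x 0 (left_mem_Icc.2 hL.le))).2.1]; exact h.bot x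
  · rw [← (he _ (hm x L (right_mem_Icc.2 hL.le))).2.2.2.2]; exact h.top x
  · rw [← h.flux]
    congr 1
    refine intervalIntegral.integral_congr fun y hy => ?_
    rw [uIcc_of_le hL.le] at hy
    exact (he _ (hm 0 y hy)).1.symm

/-- Existence and uniqueness of fixed points for small data. -/
theorem exists_fixed_point (ha : a ∈ Ioo (0:ℝ) 1) (hL : 0 < L) : ∃ C > (0:ℝ), ∃ δ > (0:ℝ), δ ≤ 1 / 4 ∧
    (∀ D b, BdryData.Good a D b → D ≤ δ → ∃ j X, Step L b X j j ∧ C2F L a (C * D) j) ∧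
    ∀ D M b j₁ j₂ X₁ X₂, BdryData.Good a D b → D ≤ δ → M ≤ δ → C2F L a M j₁ → C2F L a M j₂ →
      Step L b X₁ j₁ j₁ → Step L b X₂ j₂ j₂ → ∀ z ∈ strip L, j₁.u z = j₂.u z ∧ j₁.w z = j₂.w z := by
  obtain ⟨C₀, hC₀, hT₀⟩ := exists_divcurl_strong ha hL
  obtain ⟨C₁, hC₁, hT₁⟩ := exists_step ha hL
  obtain ⟨C₂, hC₂, hT₂⟩ := step_contract ha hL
  set K := C₀ + C₁ with hK
  have hKp : 0 < K := by positivity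
  have hpow : ∀ R : ℝ, Filter.Tendsto (fun n : ℕ => (1 / 2 : ℝ) ^ n * R) Filter.atTop (nhds 0) :=
    fun R => by
    simpa using (tendsto_pow_atTop_nhds_zero_of_lt_one (by norm_num : (0:ℝ) ≤ 1 / 2)
      (by norm_num)).mul_const R
  refine ⟨2 * K, by positivity, min (1 / 4) (min (1 / (4 * K ^ 2)) (min (1 / (8 * K))
    (min (1 / (2 * C₂ * (1 + 2 * K))) (1 / (4 * C₂))))), by positivity, min_le_left _ _,
    fun D b hb hD => ?_, fun D M b j₁ j₂ X₁ X₂ hb hD hM h₁ h₂ s₁ s₂ => ?_⟩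
  · simp only [le_min_iff] at hD
    obtain ⟨hD1, hD2, hD3, hD4, -⟩ := hD
    rw [le_div_iff₀ (by positivity)] at hD2 hD3 hD4
    have hD0 : 0 ≤ D := hb.hμ.h0.nonneg ⟨0, mem_univ 0⟩
    set M := 2 * K * D with hM
    have hM0 : 0 ≤ M := by positivity
    have hM4 : M ≤ 1 / 4 := by rw [hM]; linarith
    have hball : C₁ * (D + M ^ 2) ≤ M := by
      have h1 : D + M ^ 2 ≤ 2 * D := by
        have : M ^ 2 = D * (4 * K ^ 2) * D := by rw [hM]; ring
        nlinarith
      calc C₁ * (D + M ^ 2) ≤ C₁ * (2 * D) := by gcongr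
        _ ≤ M := by rw [hM, hK]; nlinarith
    have hcon : C₂ * (D + M) ≤ 1 / 2 := by rw [hM]; linarith
    set S := {j : Jet // C2F L a M j ∧ ∀ x, j.w (x, 0) = b.φ x} with hS
    have hstep : ∀ j : S, ∃ j' : S, ∃ X, Step L b X j.1 j'.1 := fun ⟨j, hj, hj0⟩ => by
      obtain ⟨X, hX⟩ := exists_foot ha.1 hL hb.hφ.b0 hD1 hj.c1 hj0
      obtain ⟨j', hs, hj'⟩ := hT₁ D M b X j hb hD1 hj hM4 hX
      exact ⟨⟨j', hj'.mono hball, hs.bot⟩, X, hs⟩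
    choose T X hTX using hstep
    obtain ⟨j₀, hj₀, -, hj₀', -, -⟩ := hT₀ D (fun _ => 0) (fun _ => 0) (fun _ => 0) b.φ b.φ1 b.φ2 b.φ
      b.φ1 b.φ2 b.J (Grad.const 0) (fun _ _ _ => rfl) (Hol.const 0 (by simpa))
      (Hol.const 0 (by simpa)) (Hol.const 0 (by simpa)) hb.hφ hb.hφ rfl hb.hJ
    set s : ℕ → S := fun n => T^[n] ⟨j₀, hj₀.mono (by rw [hM, hK]; nlinarith), hj₀'⟩ with hs
    have hsT : ∀ n, s (n + 1) = T (s n) := fun n => Function.iterate_succ_apply' _ _ _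
    have hsb : ∀ n, C2F L a M (s n).1 := fun n => (s n).2.1
    have hstp : ∀ {N} (i j : S), WDiff L a N i.1 j.1 → WDiff L a (1 / 2 * N) (T i).1 (T j).1 :=
      fun {N} i j hij => (hT₂ D M N M b _ _ _ _ _ _ hb hD1 i.2.1 j.2.1 hM4 hij (hTX i) (hTX j)
        (T i).2.1 (T j).2.1).mono
          (mul_le_mul_of_nonneg_right hcon (hij.hu.nonneg ⟨_, origin_mem hL⟩))
    have hdist : ∀ n k, WDiff L a ((1 / 2) ^ n * (M + M)) (s n).1 (s (n + k)).1 := by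
      intro n
      induction n with
      | zero =>
        intro k
        rw [pow_zero, one_mul]
        exact (hsb 0).c1.sub (hsb (0 + k)).c1
      | succ n ih =>
        intro k
        rw [add_right_comm, hsT, hsT, pow_succ', mul_assoc]
        exact hstp _ _ (ih k)
    have hcau : ∀ q : Jet → ℝ, (∀ n k, |q (s n).1 - q (s (n + k)).1| ≤ (1 / 2) ^ n * (M + M)) →
        CauchySeq fun n => q (s n).1 := fun q hq =>
      cauchySeq_of_le_tendsto_0' _ (fun n m hnm => by
        obtain ⟨k, rfl⟩ := Nat.exists_eq_add_of_le hnm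
        rw [Real.dist_eq]; exact hq n k) (hpow (M + M))
    choose! U tu using fun z (hz : z ∈ strip L) => cauchySeq_tendsto_of_complete
      (hcau (fun j => j.u z) fun n k => (hdist n k).hu.1 z hz)
    choose! W tw using fun z (hz : z ∈ strip L) => cauchySeq_tendsto_of_complete
      (hcau (fun j => j.w z) fun n k => (hdist n k).hw.1 z hz)
    obtain ⟨j, hj, ju, jw, tux, tuy, twx⟩ := C2F.exists_lim ha.1 hL hsb tu tw
    have hj0 : ∀ x, j.w (x, 0) = b.φ x := fun x => by
      have := tw (x, 0) (mem_strip.2 ⟨le_rfl, hL.le⟩)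
      simp only [(s _).2.2] at this
      rw [jw]
      exact tendsto_nhds_unique this tendsto_const_nhds
    have hlim : ∀ n, WDiff L a ((1 / 2) ^ n * (M + M)) (s n).1 j := fun n => by
      have sh : ∀ {q : ℕ → ℝ} {c : ℝ}, Filter.Tendsto q Filter.atTop (nhds c) →
          Filter.Tendsto (fun k => q (n + k)) Filter.atTop (nhds c) := fun {q c} h => by
        simpa only [add_comm] using (Filter.tendsto_add_atTop_iff_nat n).2 h
      exact WDiff.lim (hsb n) hj (fun k => hdist n k)
        (fun z hz => by rw [ju]; exact sh (tu z hz)) (fun z hz => by rw [jw]; exact sh (tw z hz))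
        (fun z hz => sh (tux z hz)) (fun z hz => sh (tuy z hz)) fun z hz => sh (twx z hz)
    set js : S := ⟨j, hj, hj0⟩ with hjs
    refine ⟨j, X js, (hTX js).congr hL (WDiff.eq (a := a) (s := fun n => (s (n + 1)).1)
      (e := fun n => (1 / 2) ^ n * (M + M)) (hpow (M + M)) (fun n => ?_) fun n => ?_), hj⟩
    · rw [hsT]
      exact (hstp (s n) js (hlim n)).mono (by
        have : 0 ≤ (1 / 2 : ℝ) ^ n * (M + M) := by positivity
        linarith)
    · refine (hlim (n + 1)).mono ?_
      rw [pow_succ]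
      have : 0 ≤ (1 / 2 : ℝ) ^ n * (M + M) := by positivity
      linarith
  · simp only [le_min_iff] at hD hM
    obtain ⟨hD1, -, -, -, hD5⟩ := hD
    obtain ⟨hM1, -, -, -, hM5⟩ := hM
    rw [le_div_iff₀ (by positivity)] at hD5 hM5
    have hcon : C₂ * (D + M) ≤ 1 / 2 := by linarith
    have hn : ∀ n : ℕ, WDiff L a ((1 / 2) ^ n * (M + M)) j₁ j₂ := by
      intro n
      induction n with
      | zero =>
        rw [pow_zero, one_mul]
        exact h₁.c1.sub h₂.c1
      | succ n ih =>
        rw [pow_succ', mul_assoc]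
        exact (hT₂ D M _ M b _ _ _ _ _ _ hb hD1 h₁ h₂ hM1 ih s₁ s₂ h₁ h₂).mono
          (mul_le_mul_of_nonneg_right hcon (ih.hu.nonneg ⟨_, origin_mem hL⟩))
    intro z hz
    have := WDiff.eq (a := a) (s := fun _ => j₁) (j₁ := j₁) (j₂ := j₂) (hpow (M + M)) (fun n => ?_) hn z hz
    · exact ⟨this.1, this.2.1⟩
    · have hM0 : 0 ≤ M := h₁.c1.hu.nonneg ⟨_, origin_mem hL⟩
      have hz0 : Hol (strip L) a ((1 / 2) ^ n * (M + M)) fun _ : ℝ × ℝ => (0:ℝ) :=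
        Hol.const 0 (by rw [norm_zero]; positivity)
      have hd := h₁.c1.sub h₁.c1
      exact ⟨hd.gu, hd.gw, hd.pu, hd.pw, hz0.congr fun z _ => sub_self _,
        hz0.congr fun z _ => sub_self _, hz0.congr fun z _ => sub_self _,
        hz0.congr fun z _ => sub_self _, hz0.congr fun z _ => sub_self _⟩

end FixedPoint

section NormalisedEuler

variable {L a D M N : ℝ}

/-- `(u, 1 + w)` with pressure `p` solves the boundary value problem with data `b`. -/
structure NSol (L : ℝ) (b : BdryData) (j : Jet) (p px py : ℝ × ℝ → ℝ) : Prop where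
  gp : Grad L p px py
  ex : ∀ z ∈ strip L, px z = -(j.u z * j.ux z + (1 + j.w z) * j.uy z)
  ey : ∀ z ∈ strip L, py z = -(j.u z * j.wx z - (1 + j.w z) * j.ux z)
  pp : PerS L p
  bot : ∀ x, j.w (x, 0) = b.φ x
  botp : ∀ x, p (x, 0) = b.m x
  top : ∀ x, px (x, L) = b.κ x
  flux : -∫ y in (0:ℝ)..L, j.u (0, y) = b.J

variable {b : BdryData} {j : Jet} {X p px py : ℝ × ℝ → ℝ}

theorem Foot.grad_head (hX : Foot L b.φ j.u j.w X) (hL : 0 < L) (hb : b.Good a D)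
    (hD : D ≤ 1 / 4) (hj : C2F L a M j) : Grad L
    (fun z => botHead b j (X z) - 1 / 2 * (j.u z * j.u z + (1 + j.w z) * (1 + j.w z)))
    (fun z => (1 + j.w z) * botVort b j (X z) - (j.u z * j.ux z + (1 + j.w z) * j.wx z))
    (fun z => -j.u z * botVort b j (X z) - (j.u z * j.uy z - (1 + j.w z) * j.ux z)) := by
  have gH := hX.grad.comp (H' := fun x => (1 + b.φ x) * botVort b j x)
    fun z _ => botHead_hasDerivAt hL hb hD hj (X z)
  have g1w : Grad L (fun z => 1 + j.w z) j.wx (fun z => -j.ux z) :=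
    (hj.c1.gw.add_const 1).congr (fun z _ => add_comm _ _) (fun _ _ => rfl) fun _ _ => rfl
  refine (gH.sub (((hj.c1.gu.mul hj.c1.gu).add (g1w.mul g1w)).const_mul (1 / 2))).congr
    (fun _ _ => rfl) (fun z _ => ?_) fun z _ => ?_
  all_goals
    have := hb.hφ.b0.small hD (X z)
    field_simp
    ring

theorem Step.nsol (hL : 0 < L) (hb : b.Good a D) (hD : D ≤ 1 / 4) (hj : C2F L a M j)
    (h : Step L b X j j) : ∃ p px py, NSol L b j p px py := by
  refine ⟨_, _, _, h.foot.grad_head hL hb hD hj, fun z hz => ?_, fun z hz => ?_,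
    fun x y hy => ?_, h.bot, fun x => ?_, fun x => ?_, h.flux⟩
  · rw [← h.curl z hz]; ring
  · rw [← h.curl z hz]; ring
  · simp only [h.foot.comp_per (botHead_per hL hb hj) x y hy, hj.c1.pu x y hy, hj.c1.pw x y hy]
  · simp only [h.foot.bot, botHead, h.bot]; ring
  · have := h.top x
    linear_combination -this

theorem NSol.step (ha : 0 < a) (hL : 0 < L) (hb : b.Good a D) (hD : D ≤ 1 / 4) (hM : M ≤ 1 / 4)
    (hj : C2F L a M j) (h : NSol L b j p px py) : ∃ X, Step L b X j j := by
  obtain ⟨X, hX⟩ := exists_foot ha hL hb.hφ.b0 hD hj.c1 h.bot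
  have g1w : Grad L (fun z => 1 + j.w z) j.wx (fun z => -j.ux z) :=
    (hj.c1.gw.add_const 1).congr (fun z _ => add_comm _ _) (fun _ _ => rfl) fun _ _ => rfl
  set δ : ℝ × ℝ → ℝ := fun z => j.wx z - j.uy z - botVort b j (X z) with hδ
  set Δ : ℝ × ℝ → ℝ := fun z => p z -
    (botHead b j (X z) - 1 / 2 * (j.u z * j.u z + (1 + j.w z) * (1 + j.w z))) with hΔ
  have gΔ : Grad L Δ (fun z => (1 + j.w z) * δ z) (fun z => -j.u z * δ z) :=
    (h.gp.sub (hX.grad_head hL hb hD hj)).congr (fun _ _ => rfl)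
      (fun z hz => by simp only [hδ, h.ex z hz]; ring)
      (fun z hz => by simp only [hδ, h.ey z hz]; ring)
  have pΔ : PerS L Δ := fun x y hy => by
    simp only [hΔ, h.pp x y hy, hX.comp_per (botHead_per hL hb hj) x y hy, hj.c1.pu x y hy,
      hj.c1.pw x y hy]
  have hΔ0 : ∀ x, Δ (x, 0) = 0 := fun x => by
    simp only [hΔ, h.botp, hX.bot, botHead, h.bot]; ring
  have gF := g1w.mul (gΔ.mul gΔ)
  have gQ := hj.c1.gu.neg.mul (gΔ.mul gΔ)
  have cV : ContinuousOn (botVort b j) univ := fun x _ =>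
    (botVort_hasDerivAt hL hb hD hj x).continuousAt.continuousWithinAt
  have cX : ContinuousOn (fun z => botVort b j (X z)) (strip L) :=
    cV.comp hX.grad.continuousOn fun _ _ => mem_univ _
  have cδ : ContinuousOn δ (strip L) :=
    (hj.gwx.continuousOn.sub hj.guy.continuousOn).sub cX
  have cΔ := gΔ.continuousOn
  have cu := hj.c1.gu.continuousOn
  have cux := hj.gux.continuousOn
  have cw := g1w.continuousOn
  have hint : ∀ t ∈ Icc 0 L, ∫ x in (0:ℝ)..1, (1 + j.w (x, t)) * (Δ (x, t) * Δ (x, t)) = 0 :=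
    fun t ht => by
    have := green hL gF gQ (by fun_prop) (by fun_prop) (fun x y hy => by
      simp only [hj.c1.pu x y hy, pΔ x y hy]) ht
    have hz : ∀ z : ℝ × ℝ, (-j.ux z * (Δ z * Δ z) +
        (1 + j.w z) * (-j.u z * δ z * Δ z + Δ z * (-j.u z * δ z))) -
        (-j.ux z * (Δ z * Δ z) +
        -j.u z * ((1 + j.w z) * δ z * Δ z + Δ z * ((1 + j.w z) * δ z))) = 0 := fun z => by ring
    simpa only [hz, hΔ0, mul_zero, intervalIntegral.integral_zero, sub_zero] using this
  have hV : ∀ z ∈ strip L, 0 < 1 + j.w z := fun z hz => by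
    have := (abs_le.1 (hj.c1.hw.1 z hz)).1
    linarith
  have hΔz : ∀ z ∈ strip L, Δ z = 0 := pΔ.eq_of_Icc fun x hx y hy => by
    have hm : ∀ x, (x, y) ∈ strip L := fun x => mem_strip.2 hy
    have := eq_zero_of_integral_eq_zero zero_lt_one
      (cont_x (gF.continuousOn) hy).continuousOn
      (fun x _ => mul_nonneg (hV _ (hm x)).le (mul_self_nonneg _)) (hint y hy) x hx
    rcases mul_eq_zero.1 this with h1 | h1
    · exact absurd h1 (hV _ (hm x)).ne'
    · exact mul_self_eq_zero.1 h1
  have hδz : ∀ z ∈ strip L, δ z = 0 := fun z hz => by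
    have := ((Grad.const (L := L) 0).congr (f' := Δ) hΔz (fun _ _ => rfl) fun _ _ => rfl).unique
      hL gΔ z hz
    exact (mul_eq_zero.1 this.1.symm).resolve_left (hV z hz).ne'
  refine ⟨X, hX, fun z hz => sub_eq_zero.1 (hδz z hz), h.bot, fun x => ?_, h.flux⟩
  have hz : (x, L) ∈ strip L := mem_strip.2 ⟨hL.le, le_rfl⟩
  have h1 := hδz _ hz
  have h2 := h.ex _ hz
  rw [h.top] at h2
  simp only [hδ] at h1
  linear_combination h2 + (1 + j.w (x, L)) * h1

theorem NSol.pressure_unique (hL : 0 < L) {j' : Jet} {p' px' py' : ℝ × ℝ → ℝ} {M' : ℝ}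
    (hj : C2F L a M j) (hj' : C2F L a M' j')
    (h : NSol L b j p px py) (h' : NSol L b j' p' px' py')
    (he : ∀ z ∈ strip L, j.u z = j'.u z ∧ j.w z = j'.w z) : ∀ z ∈ strip L, p z = p' z := by
  have hu := (hj.c1.gu.congr (fun z hz => ((he z hz).1).symm) (fun _ _ => rfl)
    fun _ _ => rfl).unique hL hj'.c1.gu
  have hw := (hj.c1.gw.congr (fun z hz => ((he z hz).2).symm) (fun _ _ => rfl)
    fun _ _ => rfl).unique hL hj'.c1.gw
  have hg : Grad L (fun z => p z - p' z) (fun _ => 0) fun _ => 0 :=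
    (h.gp.sub h'.gp).congr (fun _ _ => rfl)
      (fun z hz => by
        rw [h.ex z hz, h'.ex z hz, (he z hz).1, (he z hz).2, (hu z hz).1, (hu z hz).2, sub_self])
      (fun z hz => by
        rw [h.ey z hz, h'.ey z hz, (he z hz).1, (he z hz).2, (hu z hz).1, (hw z hz).1, sub_self])
  intro z hz
  have := eq_of_grad_zero hg z hz (0, 0) (origin_mem hL)
  rw [h.botp, h'.botp, sub_self] at this
  linarith

end NormalisedEuler

section HolderNorms

variable {E F G : Type*} [NormedAddCommGroup E] [NormedSpace ℝ E] [NormedAddCommGroup F]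
  [NormedSpace ℝ F] [NormedAddCommGroup G] [NormedSpace ℝ G] {a N M : ℝ} {s : Set E} {f g : E → F}

/-- `f` is of class `C^{2,a}` on `s`, with all relevant quantities bounded by `N`. -/
structure HB (a N : ℝ) (s : Set E) (f : E → F) : Prop where
  smooth : ContDiffOn ℝ 2 f s
  bound : ∀ i ≤ 2, ∀ z ∈ s, ‖iteratedFDerivWithin ℝ i f s z‖ ≤ N
  holder : ∀ z ∈ s, ∀ z' ∈ s,
    ‖iteratedFDerivWithin ℝ 2 f s z - iteratedFDerivWithin ℝ 2 f s z'‖ ≤ N * ‖z - z'‖ ^ a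

theorem HB.hNorm_le (h : HB a N s f) : hNorm 2 a s f ≤ ENNReal.ofReal (4 * N) := by
  rcases s.eq_empty_or_nonempty with rfl | ⟨z₀, hz₀⟩
  · simp [hNorm, hSemi]
  have hN : 0 ≤ N := (norm_nonneg _).trans (h.bound 0 (by norm_num) z₀ hz₀)
  have h4 : ENNReal.ofReal (4 * N) = ∑ _i ∈ Finset.range 3, ENNReal.ofReal N + ENNReal.ofReal N := by
    rw [Finset.sum_const, Finset.card_range, nsmul_eq_mul, ENNReal.ofReal_mul (by norm_num),
      ENNReal.ofReal_ofNat]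
    push_cast
    ring
  rw [h4]
  refine add_le_add (Finset.sum_le_sum fun i hi => iSup₂_le fun z hz => ?_)
    (iSup₂_le fun z hz => iSup₂_le fun z' hz' => ENNReal.ofReal_le_ofReal ?_)
  · rw [← enorm_eq_nnnorm, ← ofReal_norm]
    exact ENNReal.ofReal_le_ofReal (h.bound i (by have := Finset.mem_range.1 hi; omega) z hz)
  · rcases (Real.rpow_nonneg (norm_nonneg (z - z')) a).eq_or_lt with h0 | h0
    · rw [← h0, div_zero]; exact hN
    · exact (div_le_iff₀ h0).2 (h.holder z hz z' hz')

theorem HB.of_hNorm (hf : ContDiffOn ℝ 2 f s) (hN : 0 ≤ N) (h : hNorm 2 a s f ≤ ENNReal.ofReal N) :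
    HB a N s f := by
  refine ⟨hf, fun i hi z hz => ?_, fun z hz z' hz' => ?_⟩
  · have h1 : (‖iteratedFDerivWithin ℝ i f s z‖₊ : ℝ≥0∞) ≤ hNorm 2 a s f := by
      refine le_trans ?_ le_self_add
      refine le_trans ?_ (Finset.single_le_sum (f := fun i => ⨆ x ∈ s,
        (‖iteratedFDerivWithin ℝ i f s x‖₊ : ℝ≥0∞)) (fun _ _ => zero_le)
        (Finset.mem_range.2 (by omega : i < 2 + 1)))
      exact le_iSup₂_of_le z hz le_rfl
    have h2 := h1.trans h
    rw [← enorm_eq_nnnorm, ← ofReal_norm] at h2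
    exact (ENNReal.ofReal_le_ofReal_iff hN).1 h2
  · rcases eq_or_ne z z' with rfl | hne
    · simp only [sub_self, norm_zero]; exact mul_nonneg hN (Real.rpow_nonneg le_rfl _)
    have h1 : ENNReal.ofReal (‖iteratedFDerivWithin ℝ 2 f s z - iteratedFDerivWithin ℝ 2 f s z'‖
        / ‖z - z'‖ ^ a) ≤ hNorm 2 a s f :=
      le_trans (le_iSup₂_of_le (f := fun z _ => ⨆ z' ∈ s, _) z hz
        (le_iSup₂_of_le (f := fun z' _ => ENNReal.ofReal (‖iteratedFDerivWithin ℝ 2 f s z -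
          iteratedFDerivWithin ℝ 2 f s z'‖ / ‖z - z'‖ ^ a)) z' hz' le_rfl)) le_add_self
    exact (div_le_iff₀ (Real.rpow_pos_of_pos (norm_pos_iff.2 (sub_ne_zero.2 hne)) a)).1
      ((ENNReal.ofReal_le_ofReal_iff hN).1 (h1.trans h))

theorem MemC.exists_HB (h : MemC 2 a s f) : ∃ N, 0 ≤ N ∧ HB a N s f :=
  ⟨(hNorm 2 a s f).toReal, ENNReal.toReal_nonneg, HB.of_hNorm h.1 ENNReal.toReal_nonneg
    (ENNReal.ofReal_toReal h.2.ne).ge⟩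

theorem HB.memC (h : HB a N s f) : MemC 2 a s f :=
  ⟨h.smooth, h.hNorm_le.trans_lt ENNReal.ofReal_lt_top⟩

theorem HB.comp_left (h : HB a N s f) (hs : UniqueDiffOn ℝ s) (T : F →L[ℝ] G) (hT : ‖T‖ ≤ 1) :
    HB a N s (fun z => T (f z)) := by
  have he : ∀ i ≤ 2, ∀ z ∈ s, iteratedFDerivWithin ℝ i (fun z => T (f z)) s z =
      T.compContinuousMultilinearMap (iteratedFDerivWithin ℝ i f s z) := fun i hi z hz =>
    T.iteratedFDerivWithin_comp_left (h.smooth.contDiffWithinAt hz) hs hz (by exact_mod_cast hi)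
  have hb : ∀ A : ContinuousMultilinearMap ℝ (fun _ : Fin 2 => E) F,
      ‖T.compContinuousMultilinearMap A‖ ≤ ‖A‖ := fun A =>
    (T.norm_compContinuousMultilinearMap_le A).trans
      ((mul_le_mul_of_nonneg_right hT (norm_nonneg _)).trans (one_mul _).le)
  refine ⟨T.contDiff.comp_contDiffOn h.smooth, fun i hi z hz => ?_, fun z hz z' hz' => ?_⟩
  · rw [he i hi z hz]
    refine (T.norm_compContinuousMultilinearMap_le _).trans
      (((mul_le_mul_of_nonneg_right hT (norm_nonneg _)).trans (one_mul _).le).trans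
        (h.bound i hi z hz))
  · rw [he 2 le_rfl z hz, he 2 le_rfl z' hz']
    refine le_trans (le_of_eq ?_) ((hb _).trans (h.holder z hz z' hz'))
    congr 1
    ext m
    simp

theorem HB.add (h : HB a N s f) (h' : HB a M s g) (hs : UniqueDiffOn ℝ s) :
    HB a (N + M) s (fun z => f z + g z) := by
  have he : ∀ i ≤ 2, ∀ z ∈ s, iteratedFDerivWithin ℝ i (fun z => f z + g z) s z =
      iteratedFDerivWithin ℝ i f s z + iteratedFDerivWithin ℝ i g s z := fun i hi z hz => by
    have hi' : (i : WithTop ℕ∞) ≤ 2 := by exact_mod_cast hi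
    exact iteratedFDerivWithin_add_apply ((h.smooth z hz).of_le hi') ((h'.smooth z hz).of_le hi')
      hs hz
  refine ⟨h.smooth.add h'.smooth, fun i hi z hz => ?_, fun z hz z' hz' => ?_⟩
  · rw [he i hi z hz]
    exact (norm_add_le _ _).trans (add_le_add (h.bound i hi z hz) (h'.bound i hi z hz))
  · rw [he 2 le_rfl z hz, he 2 le_rfl z' hz', add_sub_add_comm, add_mul]
    exact (norm_add_le _ _).trans (add_le_add (h.holder z hz z' hz') (h'.holder z hz z' hz'))

theorem HB.prodMk {f g : E → ℝ} (h : HB a N s f) (h' : HB a M s g) (hs : UniqueDiffOn ℝ s) :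
    HB a (N + M) s (fun z => (f z, g z)) := by
  have h1 := h.comp_left hs (ContinuousLinearMap.inl ℝ ℝ ℝ)
    (ContinuousLinearMap.opNorm_le_bound _ zero_le_one fun x => by simp)
  have h2 := h'.comp_left hs (ContinuousLinearMap.inr ℝ ℝ ℝ)
    (ContinuousLinearMap.opNorm_le_bound _ zero_le_one fun x => by simp)
  simpa using h1.add h2 hs

theorem HB.fst {f : E → ℝ × ℝ} (h : HB a N s f) (hs : UniqueDiffOn ℝ s) :
    HB a N s (fun z => (f z).1) :=
  h.comp_left hs (ContinuousLinearMap.fst ℝ ℝ ℝ) (ContinuousLinearMap.norm_fst_le ℝ ℝ ℝ)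

theorem HB.snd {f : E → ℝ × ℝ} (h : HB a N s f) (hs : UniqueDiffOn ℝ s) :
    HB a N s (fun z => (f z).2) :=
  h.comp_left hs (ContinuousLinearMap.snd ℝ ℝ ℝ) (ContinuousLinearMap.norm_snd_le ℝ ℝ ℝ)

theorem HB.exists_deriv {f : ℝ → ℝ} (ha : 0 < a) (ha1 : a ≤ 1) (h : HB a N univ f) :
    ∃ f2 : ℝ → ℝ, (∀ x, HasDerivAt f (deriv f x) x) ∧ (∀ x, HasDerivAt (deriv f) (f2 x) x) ∧
      Hol univ a (2 * N) f ∧ Hol univ a (2 * N) (deriv f) ∧ Hol univ a (2 * N) f2 := by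
  have hf : ContDiff ℝ 2 f := contDiffOn_univ.1 h.smooth
  have hN : 0 ≤ N := (norm_nonneg _).trans (h.bound 0 (by norm_num) 0 (mem_univ _))
  have h0 : ∀ x, HasDerivAt f (deriv f x) x := fun x =>
    (hf.differentiable (by norm_num) x).hasDerivAt
  have h1 : ∀ x, HasDerivAt (deriv f) (deriv (deriv f) x) x := fun x =>
    ((hf.deriv' (n := 1)).differentiable (by norm_num) x).hasDerivAt
  have b : ∀ i ≤ 2, ∀ x, ‖iteratedDeriv i f x‖ ≤ N := fun i hi x => by
    have := h.bound i hi x (mem_univ x)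
    rwa [iteratedFDerivWithin_univ, norm_iteratedFDeriv_eq_norm_iteratedDeriv] at this
  have b0 : ∀ x, ‖f x‖ ≤ N := fun x => by simpa using b 0 (by norm_num) x
  have b1 : ∀ x, ‖deriv f x‖ ≤ N := fun x => by simpa using b 1 (by norm_num) x
  have e2 : iteratedDeriv 2 f = deriv (deriv f) := by
    rw [iteratedDeriv_succ, iteratedDeriv_one]
  have b2 : ∀ x, ‖deriv (deriv f) x‖ ≤ N := fun x => by rw [← e2]; exact b 2 le_rfl x
  have lip : ∀ g : ℝ → ℝ, (∀ x, HasDerivAt g (deriv g x) x) → (∀ x, ‖deriv g x‖ ≤ N) →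
      ∀ x ∈ univ, ∀ y ∈ univ, ‖g x - g y‖ ≤ 2 * N * ‖x - y‖ := fun g hg hb x hx y hy =>
    convex_univ.norm_image_sub_le_of_norm_deriv_le (fun x _ => (hg x).differentiableAt)
      (fun x _ => (hb x).trans (by linarith)) hy hx
  refine ⟨_, h0, h1, Hol.of_lip ha ha1 (fun x _ => b0 x) (lip f h0 b1) le_rfl,
    Hol.of_lip ha ha1 (fun x _ => b1 x) (lip _ h1 b2) le_rfl, fun x _ => (b2 x).trans (by linarith),
    fun x hx y hy => ?_⟩
  have h3 := h.holder x hx y hy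
  rw [iteratedFDerivWithin_univ] at h3
  have e : ∀ x, deriv (deriv f) x = iteratedFDeriv ℝ 2 f x (fun _ => 1) := fun x => by
    rw [← e2, iteratedDeriv_eq_iteratedFDeriv]
  rw [e, e, ← sub_apply]
  refine (ContinuousMultilinearMap.le_opNorm _ _).trans ?_
  simp only [norm_one, Finset.prod_const_one, mul_one]
  refine h3.trans (mul_le_mul_of_nonneg_right (by linarith) (Real.rpow_nonneg (norm_nonneg _) _))

end HolderNorms

section StripHolder

variable {L a N M : ℝ} {f fx fy fxx fxy fyx fyy g gx gy gxx gxy gyy : ℝ × ℝ → ℝ}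

/-- `f` is of class `C^{2,a}` on the strip, with the displayed derivatives and size `N`. -/
structure G2 (L a N : ℝ) (f fx fy fxx fxy fyy : ℝ × ℝ → ℝ) : Prop where
  g0 : Grad L f fx fy
  gx : Grad L fx fxx fxy
  gy : Grad L fy fxy fyy
  h0 : Hol (strip L) a N f
  hx : Hol (strip L) a N fx
  hy : Hol (strip L) a N fy
  hxx : Hol (strip L) a N fxx
  hxy : Hol (strip L) a N fxy
  hyy : Hol (strip L) a N fyy

theorem Grad.symm (hL : 0 < L) (h : Grad L f fx fy) (hx : Grad L fx fxx fxy)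
    (hy : Grad L fy fyx fyy) : ∀ z ∈ strip L, fxy z = fyx z := fun z hz => by
  have hne : (interior (strip L)).Nonempty := by
    rw [strip_interior]; exact ⟨(0, L / 2), mem_univ _, by constructor <;> simp <;> linarith⟩
  have h2 : HasFDerivWithinAt (fun z => lin2 (fx z) (fy z))
      ((lin2 (fxx z) (fxy z)).smulRight (ContinuousLinearMap.fst ℝ ℝ ℝ) +
        (lin2 (fyx z) (fyy z)).smulRight (ContinuousLinearMap.snd ℝ ℝ ℝ)) (strip L) z :=
    ((hx z hz).smul_const (ContinuousLinearMap.fst ℝ ℝ ℝ)).add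
      ((hy z hz).smul_const (ContinuousLinearMap.snd ℝ ℝ ℝ))
  have := (strip_convex L).second_derivative_within_at_symmetric hne
    (fun x hx => (h x (interior_subset hx)).hasFDerivAt (mem_interior_iff_mem_nhds.1 hx)) hz
    (h2.mono interior_subset) (1, 0) (0, 1)
  simpa using this.symm

theorem Grad.contDiffOn_succ (hL : 0 < L) {n : ℕ} (h : Grad L f fx fy)
    (hx : ContDiffOn ℝ n fx (strip L)) (hy : ContDiffOn ℝ n fy (strip L)) :
    ContDiffOn ℝ (n + 1) f (strip L) :=
  (contDiffOn_succ_iff_hasFDerivWithinAt_of_uniqueDiffOn (strip_unique hL)).2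
    ⟨fun h => absurd h (by simp), fun z => lin2 (fx z) (fy z),
      (hx.smul contDiffOn_const).add (hy.smul contDiffOn_const), h⟩

theorem Grad.fderivWithin_eq (hL : 0 < L) (h : Grad L f fx fy) {z : ℝ × ℝ} (hz : z ∈ strip L) :
    fderivWithin ℝ f (strip L) z = lin2 (fx z) (fy z) :=
  (h z hz).fderivWithin (strip_unique hL z hz)

theorem HB.exists_G2 (ha : 0 < a) (ha1 : a ≤ 1) (hL : 0 < L) (h : HB a N (strip L) f) :
    ∃ fx fy fxx fxy fyy, G2 L a (2 * N) f fx fy fxx fxy fyy := by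
  have hN : 0 ≤ N := (norm_nonneg _).trans (h.bound 0 (by norm_num) _ (origin_mem hL))
  have hu := strip_unique hL
  have hd := (contDiffOn_succ_iff_fderivWithin hu).1
    (show ContDiffOn ℝ (1 + 1) f (strip L) by simpa [one_add_one_eq_two] using h.smooth)
  set D := fun z => fderivWithin ℝ f (strip L) z
  set D2 := fun z => fderivWithin ℝ D (strip L) z
  have hD : ∀ z ∈ strip L, HasFDerivWithinAt D (D2 z) (strip L) z := fun z hz =>
    (hd.2.2.differentiableOn (by norm_num) z hz).hasFDerivWithinAt
  have e2 : ∀ z ∈ strip L, ∀ p q, iteratedFDerivWithin ℝ 2 f (strip L) z ![p, q] = D2 z p q :=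
    fun z hz p q => by rw [iteratedFDerivWithin_two_apply f hu hz]; rfl
  have g0 : Grad L f (fun z => D z (1, 0)) (fun z => D z (0, 1)) := fun z hz => by
    refine (hd.1 z hz).hasFDerivWithinAt.congr_fderiv ?_
    ext <;> simp [D]
  have gD : ∀ e : ℝ × ℝ, Grad L (fun z => D z e) (fun z => D2 z (1, 0) e)
      (fun z => D2 z (0, 1) e) := fun e z hz => by
    refine ((ContinuousLinearMap.apply ℝ ℝ e).hasFDerivAt.comp_hasFDerivWithinAt z
      (hD z hz)).congr_fderiv ?_
    ext <;> simp
  have hs : ∀ z ∈ strip L, D2 z (0, 1) (1, 0) = D2 z (1, 0) (0, 1) := g0.symm hL (gD _) (gD _)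
  have n1 : ‖((1, 0) : ℝ × ℝ)‖ = 1 := by simp
  have n2 : ‖((0, 1) : ℝ × ℝ)‖ = 1 := by simp
  have nm : ∀ p q : ℝ × ℝ, ‖p‖ = 1 → ‖q‖ = 1 → ∏ i : Fin 2, ‖(![p, q] : Fin 2 → ℝ × ℝ) i‖ = 1 :=
    fun p q hp hq => by simp [Fin.prod_univ_two, hp, hq]
  have b2 : ∀ p q : ℝ × ℝ, ‖p‖ = 1 → ‖q‖ = 1 → Hol (strip L) a N (fun z => D2 z p q) :=
    fun p q hp hq => ⟨fun z hz => by
      simp only [← e2 z hz]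
      refine (ContinuousMultilinearMap.le_opNorm _ _).trans ?_
      rw [nm p q hp hq, mul_one]
      exact h.bound 2 le_rfl z hz, fun z hz z' hz' => by
      simp only [← e2 z hz, ← e2 z' hz', ← sub_apply]
      refine (ContinuousMultilinearMap.le_opNorm _ _).trans ?_
      rw [nm p q hp hq, mul_one]
      exact h.holder z hz z' hz'⟩
  have b1 : ∀ p : ℝ × ℝ, ‖p‖ = 1 → ∀ z ∈ strip L, ‖D z p‖ ≤ N := fun p hp z hz => by
    have := h.bound 1 (by norm_num) z hz
    rw [norm_iteratedFDerivWithin_one f (hu z hz)] at this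
    refine ((D z).le_opNorm p).trans ?_
    rwa [hp, mul_one]
  have b0 : ∀ z ∈ strip L, ‖f z‖ ≤ N := fun z hz => by
    simpa using h.bound 0 (by norm_num) z hz
  have h2 : N ≤ 2 * N := by linarith
  exact ⟨_, _, _, _, _, g0, gD _, (gD _).congr (fun _ _ => rfl) hs fun _ _ => rfl,
    g0.hol ha ha1 b0 (b1 _ n1) (b1 _ n2), (gD _).hol ha ha1 (b1 _ n1) (b2 _ _ n1 n1).1
      (b2 _ _ n2 n1).1, (gD _).hol ha ha1 (b1 _ n2) (b2 _ _ n1 n2).1 (b2 _ _ n2 n2).1,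
    (b2 _ _ n1 n1).mono h2, (b2 _ _ n2 n1).mono h2, (b2 _ _ n2 n2).mono h2⟩

theorem G2.hB (ha : 0 < a) (hL : 0 < L) (h : G2 L a N f fx fy fxx fxy fyy) :
    HB a (4 * N) (strip L) f := by
  have hN : 0 ≤ N := h.h0.nonneg ⟨_, origin_mem hL⟩
  have hu := strip_unique hL
  have hcx : ContDiffOn ℝ (0 + 1) fx (strip L) := by
    have := h.gx.contDiffOn_succ (n := 0) hL (contDiffOn_zero.2 (h.hxx.continuousOn ha))
      (contDiffOn_zero.2 (h.hxy.continuousOn ha))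
    simpa using this
  have hcy : ContDiffOn ℝ (0 + 1) fy (strip L) := by
    have := h.gy.contDiffOn_succ (n := 0) hL (contDiffOn_zero.2 (h.hxy.continuousOn ha))
      (contDiffOn_zero.2 (h.hyy.continuousOn ha))
    simpa using this
  have hc : ContDiffOn ℝ 2 f (strip L) := by
    have := h.g0.contDiffOn_succ (n := 1) hL (by simpa using hcx) (by simpa using hcy)
    simpa [one_add_one_eq_two] using this
  have e2 : ∀ z ∈ strip L, ∀ m : Fin 2 → ℝ × ℝ, iteratedFDerivWithin ℝ 2 f (strip L) z m =
      (fxx z * (m 0).1 + fxy z * (m 0).2) * (m 1).1 +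
        (fxy z * (m 0).1 + fyy z * (m 0).2) * (m 1).2 := fun z hz m => by
    have h2 : HasFDerivWithinAt (fun z => fderivWithin ℝ f (strip L) z)
      ((lin2 (fxx z) (fxy z)).smulRight (ContinuousLinearMap.fst ℝ ℝ ℝ) +
        (lin2 (fxy z) (fyy z)).smulRight (ContinuousLinearMap.snd ℝ ℝ ℝ)) (strip L) z :=
      (((h.gx z hz).smul_const (ContinuousLinearMap.fst ℝ ℝ ℝ)).add
        ((h.gy z hz).smul_const (ContinuousLinearMap.snd ℝ ℝ ℝ))).congr
        (fun z hz => h.g0.fderivWithin_eq hL hz) (h.g0.fderivWithin_eq hL hz)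
    rw [iteratedFDerivWithin_two_apply f hu hz, h2.fderivWithin (hu z hz)]
    simp
  have key : ∀ (p q r K : ℝ) (m : Fin 2 → ℝ × ℝ), |p| ≤ K → |q| ≤ K → |r| ≤ K →
      |(p * (m 0).1 + q * (m 0).2) * (m 1).1 + (q * (m 0).1 + r * (m 0).2) * (m 1).2|
        ≤ 4 * K * ∏ i, ‖m i‖ := fun p q r K m hp hq hr => by
    have hK := (abs_nonneg _).trans hp
    have m01 : |(m 0).1| ≤ ‖m 0‖ := norm_fst_le (m 0)
    have m02 : |(m 0).2| ≤ ‖m 0‖ := norm_snd_le (m 0)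
    have m11 : |(m 1).1| ≤ ‖m 1‖ := norm_fst_le (m 1)
    have m12 : |(m 1).2| ≤ ‖m 1‖ := norm_snd_le (m 1)
    have e : ∀ x y s t : ℝ, |x| ≤ K → |y| ≤ ‖m 0‖ → |s| ≤ K → |t| ≤ ‖m 0‖ →
        |x * y + s * t| ≤ 2 * K * ‖m 0‖ := fun x y s t hx hy hs ht => by
      refine (abs_add_le _ _).trans ?_
      rw [abs_mul, abs_mul]
      nlinarith [mul_le_mul hx hy (abs_nonneg _) hK, mul_le_mul hs ht (abs_nonneg _) hK]
    rw [Fin.prod_univ_two]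
    refine (abs_add_le _ _).trans ?_
    rw [abs_mul, abs_mul]
    have hK0 : 0 ≤ 2 * K * ‖m 0‖ := by positivity
    nlinarith [mul_le_mul (e _ _ _ _ hp m01 hq m02) m11 (abs_nonneg _) hK0,
      mul_le_mul (e _ _ _ _ hq m01 hr m02) m12 (abs_nonneg _) hK0]
  refine ⟨hc, fun i hi z hz => ?_, fun z hz z' hz' => ?_⟩
  · interval_cases i
    · rw [norm_iteratedFDerivWithin_zero]; exact (h.h0.1 z hz).trans (by linarith)
    · rw [norm_iteratedFDerivWithin_one f (hu z hz), h.g0.fderivWithin_eq hL hz]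
      refine (lin2_norm_le _ _).trans ?_
      have h1 := h.hx.1 z hz
      have h2 := h.hy.1 z hz
      rw [Real.norm_eq_abs] at h1 h2
      linarith
    · refine ContinuousMultilinearMap.opNorm_le_bound (by positivity) fun m => ?_
      rw [e2 z hz, Real.norm_eq_abs]
      exact key _ _ _ _ m (h.hxx.1 z hz) (h.hxy.1 z hz) (h.hyy.1 z hz)
  · have hr : 0 ≤ ‖z - z'‖ ^ a := Real.rpow_nonneg (norm_nonneg _) a
    refine ContinuousMultilinearMap.opNorm_le_bound (by positivity) fun m => ?_
    rw [sub_apply, e2 z hz, e2 z' hz', Real.norm_eq_abs, mul_assoc 4 N]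
    refine le_of_eq_of_le (congrArg abs ?_) (key _ _ _ _ m (h.hxx.2 z hz z' hz')
      (h.hxy.2 z hz z' hz') (h.hyy.2 z hz z' hz'))
    ring

theorem G2.mono (h : G2 L a N f fx fy fxx fxy fyy) (hNM : N ≤ M) : G2 L a M f fx fy fxx fxy fyy :=
  ⟨h.g0, h.gx, h.gy, h.h0.mono hNM, h.hx.mono hNM, h.hy.mono hNM, h.hxx.mono hNM, h.hxy.mono hNM,
    h.hyy.mono hNM⟩

theorem G2.sub (h : G2 L a N f fx fy fxx fxy fyy) (h' : G2 L a M g gx gy gxx gxy gyy) :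
    G2 L a (N + M) (fun z => f z - g z) (fun z => fx z - gx z) (fun z => fy z - gy z)
      (fun z => fxx z - gxx z) (fun z => fxy z - gxy z) (fun z => fyy z - gyy z) :=
  ⟨h.g0.sub h'.g0, h.gx.sub h'.gx, h.gy.sub h'.gy, h.h0.sub h'.h0, h.hx.sub h'.hx, h.hy.sub h'.hy,
    h.hxx.sub h'.hxx, h.hxy.sub h'.hxy, h.hyy.sub h'.hyy⟩

theorem G2.const_mul (h : G2 L a N f fx fy fxx fxy fyy) (c : ℝ) :
    G2 L a (|c| * N) (fun z => c * f z) (fun z => c * fx z) (fun z => c * fy z)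
      (fun z => c * fxx z) (fun z => c * fxy z) (fun z => c * fyy z) :=
  ⟨h.g0.const_mul c, h.gx.const_mul c, h.gy.const_mul c, h.h0.const_mul c, h.hx.const_mul c,
    h.hy.const_mul c, h.hxx.const_mul c, h.hxy.const_mul c, h.hyy.const_mul c⟩

theorem G2.congr (h : G2 L a N f fx fy fxx fxy fyy) (hg : ∀ z ∈ strip L, g z = f z) :
    G2 L a N g fx fy fxx fxy fyy :=
  ⟨h.g0.congr hg (fun _ _ => rfl) fun _ _ => rfl, h.gx, h.gy, h.h0.congr hg, h.hx, h.hy, h.hxx,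
    h.hxy, h.hyy⟩

theorem C2F.g2_u {j : Jet} (h : C2F L a N j) : G2 L a N j.u j.ux j.uy j.uxx j.uxy j.uyy :=
  ⟨h.c1.gu, h.gux, h.guy, h.c1.hu, h.c1.hux, h.c1.huy, h.huxx, h.huxy, h.huyy⟩

theorem C2F.g2_w {j : Jet} (h : C2F L a N j) : G2 L a N j.w j.wx (fun z => -j.ux z) j.wxx
    (fun z => -j.uxx z) (fun z => -j.uxy z) :=
  ⟨h.c1.gw, h.gwx, h.gux.neg, h.c1.hw, h.c1.hwx, h.c1.hux.neg, h.hwxx, h.huxx.neg, h.huxy.neg⟩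

theorem C2F.of_G2 {u ux uy uxx uxy uyy w wx wy wxx wxy wyy : ℝ × ℝ → ℝ} (hL : 0 < L)
    (hu : G2 L a N u ux uy uxx uxy uyy) (hw : G2 L a N w wx wy wxx wxy wyy) (pu : PerS L u)
    (pw : PerS L w) (hd : ∀ z ∈ strip L, wy z = -ux z) :
    C2F L a N ⟨u, w, ux, uy, wx, uxx, uxy, uyy, wxx⟩ := by
  have gwy : Grad L wy (fun z => -uxx z) (fun z => -uxy z) :=
    hu.gx.neg.congr hd (fun _ _ => rfl) fun _ _ => rfl
  have hs := fun z hz => (hw.gy.unique hL gwy z hz).1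
  exact ⟨⟨hu.g0, hw.g0.congr (fun _ _ => rfl) (fun _ _ => rfl) fun z hz => (hd z hz).symm, pu, pw,
    hu.h0, hw.h0, hu.hx, hu.hy, hw.hx⟩, hu.gx, hu.gy,
    hw.gx.congr (fun _ _ => rfl) (fun _ _ => rfl) fun z hz => (hs z hz).symm,
    hu.hxx, hu.hxy, hu.hyy, hw.hxx⟩

theorem C2F.of_potential {u ux uy uxx uxy uyy w : ℝ × ℝ → ℝ} (ha : a ∈ Ioo (0:ℝ) 1) (hL : 0 < L)
    (hu : G2 L a N u ux uy uxx uxy uyy) (gw : Grad L w uy (fun z => -ux z)) (pu : PerS L u)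
    (pw : PerS L w) (h0 : w (0, 0) = 0) :
    C2F L a (4 * (1 + L) * N) ⟨u, w, ux, uy, uy, uxx, uxy, uyy, uxy⟩ := by
  have hN : 0 ≤ N := hu.h0.nonneg ⟨_, origin_mem hL⟩
  have hs := gw.symm hL hu.gy hu.gx.neg
  have hw : Hol (strip L) a (4 * (1 + L) * N) w :=
    gw.hol_of_per ha hL pw h0 hu.hy.1 hu.hx.neg.1
  have hu' := hu.mono (M := 4 * (1 + L) * N) (by nlinarith)
  exact ⟨⟨hu.g0, gw, pu, pw, hu'.h0, hw, hu'.hx, hu'.hy, hu'.hy⟩, hu.gx, hu.gy,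
    hu.gy.congr (fun _ _ => rfl) (fun _ _ => rfl) fun z hz => (hs z hz).symm, hu'.hxx, hu'.hxy,
    hu'.hyy, hu'.hxy⟩

/-- The jet of a linear combination of two fields. -/
def Jet.lin (s : ℝ) (j j' : Jet) : Jet where
  u := fun z => j.u z + s * j'.u z
  w := fun z => j.w z + s * j'.w z
  ux := fun z => j.ux z + s * j'.ux z
  uy := fun z => j.uy z + s * j'.uy z
  wx := fun z => j.wx z + s * j'.wx z
  uxx := fun z => j.uxx z + s * j'.uxx z
  uxy := fun z => j.uxy z + s * j'.uxy z
  uyy := fun z => j.uyy z + s * j'.uyy z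
  wxx := fun z => j.wxx z + s * j'.wxx z

theorem C2F.lin {j j' : Jet} (h : C2F L a N j) (h' : C2F L a M j') (s : ℝ) :
    C2F L a (N + |s| * M) (j.lin s j') where
  c1 :=
    { gu := h.c1.gu.add (h'.c1.gu.const_mul s)
      gw := (h.c1.gw.add (h'.c1.gw.const_mul s)).congr (fun _ _ => rfl) (fun _ _ => rfl)
        fun z _ => by simp only [Jet.lin]; ring
      pu := fun x y hy => by simp only [Jet.lin, h.c1.pu x y hy, h'.c1.pu x y hy]
      pw := fun x y hy => by simp only [Jet.lin, h.c1.pw x y hy, h'.c1.pw x y hy]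
      hu := h.c1.hu.add (h'.c1.hu.const_mul s)
      hw := h.c1.hw.add (h'.c1.hw.const_mul s)
      hux := h.c1.hux.add (h'.c1.hux.const_mul s)
      huy := h.c1.huy.add (h'.c1.huy.const_mul s)
      hwx := h.c1.hwx.add (h'.c1.hwx.const_mul s) }
  gux := h.gux.add (h'.gux.const_mul s)
  guy := h.guy.add (h'.guy.const_mul s)
  gwx := (h.gwx.add (h'.gwx.const_mul s)).congr (fun _ _ => rfl) (fun _ _ => rfl)
    fun z _ => by simp only [Jet.lin]; ring
  huxx := h.huxx.add (h'.huxx.const_mul s)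
  huxy := h.huxy.add (h'.huxy.const_mul s)
  huyy := h.huyy.add (h'.huyy.const_mul s)
  hwxx := h.hwxx.add (h'.hwxx.const_mul s)

end StripHolder

section Normalisation

variable {L a N M s : ℝ} {v v₀ : ℝ × ℝ → ℝ × ℝ} {p px py pxx pxy pyx pyy : ℝ × ℝ → ℝ} {j : Jet}

theorem MemC.exists_G2 (ha : a ∈ Ioo (0:ℝ) 1) (hL : 0 < L) (h : MemC 2 a (strip L) v) :
    ∃ N ux uy uxx uxy uyy wx wy wxx wxy wyy,
      G2 L a N (fun z => (v z).1) ux uy uxx uxy uyy ∧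
      G2 L a N (fun z => (v z).2) wx wy wxx wxy wyy := by
  obtain ⟨N, -, hN⟩ := h.exists_HB
  obtain ⟨ux, uy, uxx, uxy, uyy, hu⟩ := (hN.fst (strip_unique hL)).exists_G2 ha.1 ha.2.le hL
  obtain ⟨wx, wy, wxx, wxy, wyy, hw⟩ := (hN.snd (strip_unique hL)).exists_G2 ha.1 ha.2.le hL
  exact ⟨_, _, _, _, _, _, _, _, _, _, _, hu, hw⟩

/-- A curl free and divergence free field, normalised by its vertical velocity at the origin. -/
theorem exists_jet_of_irrotational (ha : a ∈ Ioo (0:ℝ) 1) (hL : 0 < L) (hN : 0 ≤ N)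
    (hp : PerX v) (hv : MemC 2 a (strip L) v) (hd : ∀ z ∈ strip L, divF L v z = 0)
    (hc : ∀ z ∈ strip L, curlF L v z = 0) (h1 : hNorm 2 a (strip L) (c1 v) ≤ ENNReal.ofReal N)
    (hs : s * (v (0, 0)).2 = 1) :
    ∃ j : Jet, C2F L a (4 * (1 + L) * (|s| * (2 * N))) j ∧
      (∀ z ∈ strip L, j.u z = s * (v z).1) ∧ ∀ z ∈ strip L, j.w z = s * (v z).2 - 1 := by
  obtain ⟨_, _, _, _, _, _, wx, wy, _, _, _, -, hw⟩ := hv.exists_G2 ha hL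
  have hb : HB a N (strip L) (c1 v) :=
    HB.of_hNorm (ContinuousLinearMap.fst ℝ ℝ ℝ |>.contDiff.comp_contDiffOn hv.1) hN h1
  obtain ⟨ux, uy, uxx, uxy, uyy, hu⟩ := hb.exists_G2 ha.1 ha.2.le hL
  have gw : Grad L (fun z => (v z).2) uy (fun z => -ux z) := by
    refine hw.g0.congr (fun _ _ => rfl) (fun z hz => ?_) fun z hz => ?_
    · have h2 := hc z hz
      rw [curlF, hu.g0.pdy_eq hL hz] at h2
      have h3 : pdx L (c2 v) z = wx z := hw.g0.pdx_eq hL hz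
      linarith
    · have h2 := hd z hz
      rw [divF, hu.g0.pdx_eq hL hz] at h2
      have h3 : pdy L (c2 v) z = wy z := hw.g0.pdy_eq hL hz
      linarith
  have gw' : Grad L (fun z => s * (v z).2 + -1) (fun z => s * uy z) (fun z => -(s * ux z)) :=
    ((gw.const_mul s).add_const (-1)).congr (fun _ _ => rfl) (fun _ _ => rfl)
      fun _ _ => (mul_neg _ _).symm
  exact ⟨_, C2F.of_potential ha hL (hu.const_mul s) gw'
    (fun x y _ => by simp only [c1, hp x y]) (fun x y _ => by simp only [hp x y])
    (by simp [hs]), fun _ _ => rfl, fun _ _ => (sub_eq_add_neg _ _).symm⟩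

/-- The jet of the difference of two divergence free fields. -/
theorem exists_jet_of_sub (ha : a ∈ Ioo (0:ℝ) 1) (hL : 0 < L) (hM : 0 ≤ M)
    (hp : PerX v) (hp₀ : PerX v₀) (hv : MemC 2 a (strip L) v) (hv₀ : MemC 2 a (strip L) v₀)
    (hd : ∀ z ∈ strip L, divF L v z = 0) (hd₀ : ∀ z ∈ strip L, divF L v₀ z = 0)
    (h : hNorm 2 a (strip L) (fun z => v z - v₀ z) ≤ ENNReal.ofReal M) :
    ∃ j : Jet, C2F L a (2 * M) j ∧ (∀ z ∈ strip L, j.u z = (v z).1 - (v₀ z).1) ∧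
      ∀ z ∈ strip L, j.w z = (v z).2 - (v₀ z).2 := by
  obtain ⟨_, ux, uy, _, _, _, wx, wy, _, _, _, hu, hw⟩ := hv.exists_G2 ha hL
  obtain ⟨_, ux₀, uy₀, _, _, _, wx₀, wy₀, _, _, _, hu₀, hw₀⟩ := hv₀.exists_G2 ha hL
  have hb := HB.of_hNorm (hv.1.sub hv₀.1) hM h
  obtain ⟨dx, dy, dxx, dxy, dyy, h1⟩ := (hb.fst (strip_unique hL)).exists_G2 ha.1 ha.2.le hL
  obtain ⟨ex, ey, exx, exy, eyy, h2⟩ := (hb.snd (strip_unique hL)).exists_G2 ha.1 ha.2.le hL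
  refine ⟨_, C2F.of_G2 hL h1 h2 (fun x y _ => by simp only [hp x y, hp₀ x y])
    (fun x y _ => by simp only [hp x y, hp₀ x y]) fun z hz => ?_, fun _ _ => rfl, fun _ _ => rfl⟩
  have e1 := (h1.g0.unique hL (hu.g0.sub hu₀.g0) z hz).1
  have e2 := (h2.g0.unique hL (hw.g0.sub hw₀.g0) z hz).2
  have e3 := hd z hz
  have e4 := hd₀ z hz
  simp only [divF] at e3 e4
  have i1 : pdx L (c1 v) z = ux z := hu.g0.pdx_eq hL hz
  have i2 : pdy L (c2 v) z = wy z := hw.g0.pdy_eq hL hz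
  have i3 : pdx L (c1 v₀) z = ux₀ z := hu₀.g0.pdx_eq hL hz
  have i4 : pdy L (c2 v₀) z = wy₀ z := hw₀.g0.pdy_eq hL hz
  rw [e1, e2]
  linarith

/-- The pressure gradient of the normalised flow. -/
theorem Euler.normalise (ha : a ∈ Ioo (0:ℝ) 1) (hL : 0 < L) (hv : MemC 2 a (strip L) v)
    (hp : MemC 2 a (strip L) p) (hE : Euler L v p) (hj : C2F L a N j)
    (hu : ∀ z ∈ strip L, j.u z = s * (v z).1) (hw : ∀ z ∈ strip L, j.w z = s * (v z).2 - 1) :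
    ∃ px py, Grad L p px py ∧
      (∀ z ∈ strip L, s ^ 2 * px z = -(j.u z * j.ux z + (1 + j.w z) * j.uy z)) ∧
      ∀ z ∈ strip L, s ^ 2 * py z = -(j.u z * j.wx z - (1 + j.w z) * j.ux z) := by
  obtain ⟨_, ux, uy, _, _, _, wx, wy, _, _, _, h1, h2⟩ := hv.exists_G2 ha hL
  obtain ⟨_, -, hP⟩ := hp.exists_HB
  obtain ⟨px, py, _, _, _, h3⟩ := hP.exists_G2 ha.1 ha.2.le hL
  have gu : Grad L j.u (fun z => s * ux z) (fun z => s * uy z) :=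
    (h1.g0.const_mul s).congr hu (fun _ _ => rfl) fun _ _ => rfl
  have gw : Grad L j.w (fun z => s * wx z) (fun z => s * wy z) :=
    ((h2.g0.const_mul s).add_const (-1)).congr (fun z hz => (hw z hz).trans (sub_eq_add_neg _ _))
      (fun _ _ => rfl) fun _ _ => rfl
  have i : ∀ z ∈ strip L, pdx L (c1 v) z = ux z ∧ pdy L (c1 v) z = uy z ∧ pdx L (c2 v) z = wx z ∧
      pdy L (c2 v) z = wy z ∧ pdx L p z = px z ∧ pdy L p z = py z := fun z hz =>
    ⟨h1.g0.pdx_eq hL hz, h1.g0.pdy_eq hL hz, h2.g0.pdx_eq hL hz, h2.g0.pdy_eq hL hz,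
      h3.g0.pdx_eq hL hz, h3.g0.pdy_eq hL hz⟩
  refine ⟨px, py, h3.g0, fun z hz => ?_, fun z hz => ?_⟩
  · obtain ⟨i1, i2, i3, i4, i5, i6⟩ := i z hz
    have e := (hE z hz).1
    obtain ⟨k1, k2⟩ := hj.c1.gu.unique hL gu z hz
    rw [i1, i2, i5] at e
    rw [hu z hz, hw z hz, k1, k2]
    linear_combination s ^ 2 * e
  · obtain ⟨i1, i2, i3, i4, i5, i6⟩ := i z hz
    have e := (hE z hz).2.1
    obtain ⟨k1, k2⟩ := hj.c1.gw.unique hL gw z hz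
    rw [i3, i4, i6] at e
    have k2' : j.ux z = -(s * wy z) := by linarith
    rw [hu z hz, hw z hz, k1, k2']
    linear_combination s ^ 2 * e

theorem exists_G2_of_grads (ha : a ∈ Ioo (0:ℝ) 1) (hL : 0 < L) (g0 : Grad L p px py)
    (gx : Grad L px pxx pxy) (gy : Grad L py pyx pyy) (pp : PerS L p)
    (h1 : ∃ N, Hol (strip L) a N px) (h2 : ∃ N, Hol (strip L) a N py)
    (h3 : ∃ N, Hol (strip L) a N pxx) (h4 : ∃ N, Hol (strip L) a N pxy)
    (h5 : ∃ N, Hol (strip L) a N pyy) : ∃ N, G2 L a N p px py pxx pxy pyy := by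
  obtain ⟨N1, h1⟩ := h1
  obtain ⟨N2, h2⟩ := h2
  obtain ⟨N3, h3⟩ := h3
  obtain ⟨N4, h4⟩ := h4
  obtain ⟨N5, h5⟩ := h5
  have n1 := h1.nonneg ⟨_, origin_mem hL⟩
  have n2 := h2.nonneg ⟨_, origin_mem hL⟩
  have n3 := h3.nonneg ⟨_, origin_mem hL⟩
  have n4 := h4.nonneg ⟨_, origin_mem hL⟩
  have n5 := h5.nonneg ⟨_, origin_mem hL⟩
  have h0 : Hol (strip L) a (4 * (1 + L) * (N1 + N2) + |p (0, 0)|) p :=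
    (((g0.add_const (-p (0, 0))).hol_of_per ha hL (N := N1 + N2)
      (fun x y hy => by simp only [pp x y hy]) (by ring)
      (fun z hz => (h1.1 z hz).trans (by linarith)) fun z hz => (h2.1 z hz).trans
        (by linarith)).add (Hol.const (p (0, 0)) le_rfl)).congr fun z _ => by ring
  have n0 : 0 ≤ 4 * (1 + L) * (N1 + N2) + |p (0, 0)| := h0.nonneg ⟨_, origin_mem hL⟩
  refine ⟨4 * (1 + L) * (N1 + N2) + |p (0, 0)| + N1 + N2 + N3 + N4 + N5, g0, gx,
    gy.congr (fun _ _ => rfl) (g0.symm hL gx gy) fun _ _ => rfl, h0.mono ?_, h1.mono ?_,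
    h2.mono ?_, h3.mono ?_, h4.mono ?_, h5.mono ?_⟩
  all_goals linarith

theorem exists_hol_mul {f g : ℝ × ℝ → ℝ} (hf : ∃ N, Hol (strip L) a N f)
    (hg : ∃ N, Hol (strip L) a N g) : ∃ N, Hol (strip L) a N (fun z => f z * g z) := by
  obtain ⟨_, hf⟩ := hf
  obtain ⟨_, hg⟩ := hg
  exact ⟨_, hf.mul hg⟩

theorem exists_hol_add {f g : ℝ × ℝ → ℝ} (hf : ∃ N, Hol (strip L) a N f)
    (hg : ∃ N, Hol (strip L) a N g) : ∃ N, Hol (strip L) a N (fun z => f z + g z) := by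
  obtain ⟨_, hf⟩ := hf
  obtain ⟨_, hg⟩ := hg
  exact ⟨_, hf.add hg⟩

theorem exists_hol_sub {f g : ℝ × ℝ → ℝ} (hf : ∃ N, Hol (strip L) a N f)
    (hg : ∃ N, Hol (strip L) a N g) : ∃ N, Hol (strip L) a N (fun z => f z - g z) := by
  obtain ⟨_, hf⟩ := hf
  obtain ⟨_, hg⟩ := hg
  exact ⟨_, hf.sub hg⟩

theorem exists_hol_neg {f : ℝ × ℝ → ℝ} (hf : ∃ N, Hol (strip L) a N f) :
    ∃ N, Hol (strip L) a N (fun z => -f z) := by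
  obtain ⟨_, hf⟩ := hf
  exact ⟨_, hf.neg⟩

/-- The pressure of a normalised flow of class `C^{2,a}` is of class `C^{2,a}`. -/
theorem NSol.exists_pressure_G2 {b : BdryData} (ha : a ∈ Ioo (0:ℝ) 1) (hL : 0 < L)
    (hj : C2F L a N j) (h : NSol L b j p px py) :
    ∃ N pxx pxy pyy, G2 L a N p px py pxx pxy pyy := by
  have g1w : Grad L (fun z => 1 + j.w z) j.wx (fun z => -j.ux z) :=
    (hj.c1.gw.add_const 1).congr (fun _ _ => add_comm _ _) (fun _ _ => rfl) fun _ _ => rfl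
  have gx := ((hj.c1.gu.mul hj.gux).add (g1w.mul hj.guy)).neg.congr h.ex (fun _ _ => rfl)
    fun _ _ => rfl
  have gy := ((hj.c1.gu.mul hj.gwx).sub (g1w.mul hj.gux)).neg.congr h.ey (fun _ _ => rfl)
    fun _ _ => rfl
  have u : ∃ N, Hol (strip L) a N j.u := ⟨_, hj.c1.hu⟩
  have ux : ∃ N, Hol (strip L) a N j.ux := ⟨_, hj.c1.hux⟩
  have uy : ∃ N, Hol (strip L) a N j.uy := ⟨_, hj.c1.huy⟩
  have wx : ∃ N, Hol (strip L) a N j.wx := ⟨_, hj.c1.hwx⟩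
  have uxx : ∃ N, Hol (strip L) a N j.uxx := ⟨_, hj.huxx⟩
  have uxy : ∃ N, Hol (strip L) a N j.uxy := ⟨_, hj.huxy⟩
  have uyy : ∃ N, Hol (strip L) a N j.uyy := ⟨_, hj.huyy⟩
  have w1 : ∃ N, Hol (strip L) a N (fun z => 1 + j.w z) := ⟨_, (Hol.const 1 le_rfl).add hj.c1.hw⟩
  have px' : ∃ N, Hol (strip L) a N px := by
    obtain ⟨K, hK⟩ := exists_hol_neg (exists_hol_add (exists_hol_mul u ux) (exists_hol_mul w1 uy))
    exact ⟨K, hK.congr h.ex⟩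
  have py' : ∃ N, Hol (strip L) a N py := by
    obtain ⟨K, hK⟩ := exists_hol_neg (exists_hol_sub (exists_hol_mul u wx) (exists_hol_mul w1 ux))
    exact ⟨K, hK.congr h.ey⟩
  obtain ⟨K, hK⟩ := exists_G2_of_grads ha hL h.gp gx gy h.pp px' py'
    (exists_hol_neg (exists_hol_add (exists_hol_add (exists_hol_mul ux ux) (exists_hol_mul u uxx))
      (exists_hol_add (exists_hol_mul wx uy) (exists_hol_mul w1 uxy))))
    (exists_hol_neg (exists_hol_add (exists_hol_add (exists_hol_mul uy ux) (exists_hol_mul u uxy))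
      (exists_hol_add (exists_hol_mul (exists_hol_neg ux) uy) (exists_hol_mul w1 uyy))))
    (exists_hol_neg (exists_hol_sub (exists_hol_add (exists_hol_mul uy wx)
      (exists_hol_mul u (exists_hol_neg uxx)))
      (exists_hol_add (exists_hol_mul (exists_hol_neg ux) ux) (exists_hol_mul w1 uxy))))
  exact ⟨K, _, _, _, hK⟩

end Normalisation

section PerturbedData

variable {L a N M D T s J η y : ℝ} {v v₀ : ℝ × ℝ → ℝ × ℝ} {p₀ p px py : ℝ × ℝ → ℝ} {j : Jet}
  {φ φ1 φ2 ψ ψ1 ψ2 hm hm2 hp hp2 fm fm2 : ℝ → ℝ}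

theorem B1.add (h : B1 a N φ φ1) (h' : B1 a M ψ ψ1) :
    B1 a (N + M) (fun x => φ x + ψ x) (fun x => φ1 x + ψ1 x) :=
  ⟨fun x => (h.der x).add (h'.der x), fun x => by simp only [h.per x, h'.per x], h.h0.add h'.h0,
    h.h1.add h'.h1⟩

theorem B1.const_mul (h : B1 a N φ φ1) (c : ℝ) :
    B1 a (|c| * N) (fun x => c * φ x) (fun x => c * φ1 x) :=
  ⟨fun x => (h.der x).const_mul c, fun x => by simp only [h.per x], h.h0.const_mul c,
    h.h1.const_mul c⟩

theorem HB.exists_B2 (ha : a ∈ Ioo (0:ℝ) 1) (h : HB a N univ φ) (hp : Per φ) :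
    ∃ φ2, B2 a (2 * N) φ (deriv φ) φ2 := by
  obtain ⟨φ2, d1, d2, h0, h1, h2⟩ := h.exists_deriv ha.1 ha.2.le
  exact ⟨φ2, ⟨d1, hp, h0, h1⟩, ⟨d2, per_of_deriv d1 hp, h1, h2⟩⟩

/-- The horizontal pressure gradient of a normalised flow. -/
def momX (j : Jet) (z : ℝ × ℝ) : ℝ := -(j.u z * j.ux z + (1 + j.w z) * j.uy z)

/-- The horizontal derivative of `momX`. -/
def momXX (j : Jet) (z : ℝ × ℝ) : ℝ :=
  -(j.ux z * j.ux z + j.u z * j.uxx z + (j.wx z * j.uy z + (1 + j.w z) * j.uxy z))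

theorem C2F.momX_B1 (hL : 0 < L) (hj : C2F L a N j) (hN : N ≤ 1 / 4) (hy : y ∈ Icc 0 L) :
    B1 a (3 * N) (fun x => momX j (x, y)) (fun x => momXX j (x, y)) := by
  have hN0 := hj.c1.hu.nonneg ⟨_, origin_mem hL⟩
  have g1w : Grad L (fun z => 1 + j.w z) j.wx (fun z => -j.ux z) :=
    (hj.c1.gw.add_const 1).congr (fun _ _ => add_comm _ _) (fun _ _ => rfl) fun _ _ => rfl
  have g := ((hj.c1.gu.mul hj.gux).add (g1w.mul hj.guy)).neg
  have m := fun {f g : ℝ × ℝ → ℝ} (hf : Hol (strip L) a N f) (hg : Hol (strip L) a N g) =>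
    (hf.mul hg).mono (M := N / 2) (by nlinarith)
  have d : ∀ x, HasDerivAt (fun x => momX j (x, y)) (momXX j (x, y)) x := fun x =>
    g.hasDerivAt_x hy
  refine ⟨d, fun x => ?_, slice_hol_of_mem (f := momX j) ?_ hy,
    slice_hol_of_mem (f := momXX j) ?_ hy⟩
  · have h1 := (hj.c1.gu.perS hL hj.c1.pu)
    simp only [momX, hj.c1.pu x y hy, hj.c1.pw x y hy, h1.1 x y hy, h1.2 x y hy]
  · exact (((((m hj.c1.hu hj.c1.hux).add (hj.c1.huy.add (m hj.c1.hw hj.c1.huy)))).neg).mono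
      (by linarith)).congr fun z _ => by simp only [momX]; ring
  · exact ((((m hj.c1.hux hj.c1.hux).add (m hj.c1.hu hj.huxx)).add ((m hj.c1.hwx hj.c1.huy).add
      (hj.huxy.add (m hj.c1.hw hj.huxy)))).neg.mono (by linarith)).congr fun z _ => by
        simp only [momXX]; ring

/-- The normalised boundary data of the perturbed problem. -/
def perturbedData (L s J : ℝ) (j : Jet) (p₀ : ℝ × ℝ → ℝ) (hm hm2 hp hp2 fm fm2 : ℝ → ℝ) :
    BdryData where
  φ := fun x => j.w (x, 0) + -s * fm x
  φ1 := fun x => j.wx (x, 0) + -s * deriv fm x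
  φ2 := fun x => j.wxx (x, 0) + -s * fm2 x
  m := fun x => s ^ 2 * (p₀ (x, 0) + hm x)
  μ := fun x => momX j (x, 0) + s ^ 2 * deriv hm x
  μ1 := fun x => momXX j (x, 0) + s ^ 2 * hm2 x
  k := fun x => s ^ 2 * (p₀ (x, L) + hp x)
  κ := fun x => momX j (x, L) + s ^ 2 * deriv hp x
  κ1 := fun x => momXX j (x, L) + s ^ 2 * hp2 x
  J := s * J

theorem perturbedData_good (hL : 0 < L) (hj : C2F L a N j) (hN : N ≤ 1 / 4)
    (gp : Grad L p₀ px py) (ex : ∀ z ∈ strip L, s ^ 2 * px z = momX j z) (hp₀ : PerX p₀)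
    (bm : B2 a T hm (deriv hm) hm2) (bp : B2 a T hp (deriv hp) hp2) (bf : B2 a T fm (deriv fm) fm2)
    (h1 : N + |s| * T ≤ D) (h2 : 3 * N + |s ^ 2| * T ≤ D) (hJ : |s * J| ≤ D) :
    (perturbedData L s J j p₀ hm hm2 hp hp2 fm fm2).Good a D := by
  have h0 : (0:ℝ) ∈ Icc 0 L := left_mem_Icc.2 hL.le
  have hLm : L ∈ Icc 0 L := right_mem_Icc.2 hL.le
  have pwx := (hj.c1.gw.perS hL hj.c1.pw).1
  have w0 : B1 a N (fun x => j.w (x, 0)) (fun x => j.wx (x, 0)) :=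
    ⟨fun x => hj.c1.gw.hasDerivAt_x h0, fun x => hj.c1.pw x 0 h0, slice_hol_of_mem hj.c1.hw h0,
      slice_hol_of_mem hj.c1.hwx h0⟩
  have w1 : B1 a N (fun x => j.wx (x, 0)) (fun x => j.wxx (x, 0)) :=
    ⟨fun x => hj.gwx.hasDerivAt_x h0, fun x => pwx x 0 h0, slice_hol_of_mem hj.c1.hwx h0,
      slice_hol_of_mem hj.hwxx h0⟩
  have dp : ∀ {y : ℝ} (_ : y ∈ Icc 0 L) {h h2 : ℝ → ℝ} (_ : B2 a T h (deriv h) h2) (x : ℝ),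
      HasDerivAt (fun x => s ^ 2 * (p₀ (x, y) + h x)) (momX j (x, y) + s ^ 2 * deriv h x) x :=
    fun {y} hy {h h2} hb x => by
      refine (((gp.hasDerivAt_x (x := x) hy).add (hb.b0.der x)).const_mul (s ^ 2)).congr_deriv ?_
      rw [mul_add, ex (x, y) (mem_strip.2 hy)]
  refine ⟨⟨(w0.add (bf.b0.const_mul (-s))).mono (by rwa [abs_neg]),
    (w1.add (bf.b1.const_mul (-s))).mono (by rwa [abs_neg])⟩, dp h0 bm, fun x => ?_,
    ((hj.momX_B1 hL hN h0).add (bm.b1.const_mul (s ^ 2))).mono h2, dp hLm bp, fun x => ?_,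
    ((hj.momX_B1 hL hN hLm).add (bp.b1.const_mul (s ^ 2))).mono h2, hJ⟩
  · simp only [perturbedData, hp₀ x 0, bm.b0.per x]
  · simp only [perturbedData, hp₀ x L, bp.b0.per x]

end PerturbedData

section BoundaryValueProblem

variable {L a N N' M T s c J η : ℝ} {v v₀ : ℝ × ℝ → ℝ × ℝ} {p₀ p px py px₀ py₀ : ℝ × ℝ → ℝ}
  {j j₀ : Jet} {hm hm2 hp hp2 fm fm2 : ℝ → ℝ}

theorem SolCmod.exists_nsol (ha : a ∈ Ioo (0:ℝ) 1) (hL : 0 < L) (hM : 0 ≤ M)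
    (hv₀ : VP L 2 a v₀ p₀) (hE₀ : Euler L v₀ p₀) (hj₀ : C2F L a N j₀)
    (hu₀ : ∀ z ∈ strip L, j₀.u z = s * (v₀ z).1)
    (hw₀ : ∀ z ∈ strip L, j₀.w z = s * (v₀ z).2 - 1) (gp₀ : Grad L p₀ px₀ py₀)
    (ex₀ : ∀ z ∈ strip L, s ^ 2 * px₀ z = momX j₀ z)
    (h : SolCmod L a M v₀ p₀ hm hp fm J v p) :
    ∃ j, C2F L a (N + |s| * (2 * M)) j ∧ (∀ z ∈ strip L, j.u z = s * (v z).1) ∧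
      (∀ z ∈ strip L, j.w z = s * (v z).2 - 1) ∧ ∃ px py,
        NSol L (perturbedData L s J j₀ p₀ hm hm2 hp hp2 fm fm2) j (fun z => s ^ 2 * p z) px py := by
  obtain ⟨⟨pv, pp, mv, mp⟩, hE, hd, hbm, htop, hbf, hfl⟩ := h
  have hLm : L ∈ Icc 0 L := right_mem_Icc.2 hL.le
  obtain ⟨jd, hjd, hdu, hdw⟩ := exists_jet_of_sub ha hL hM pv hv₀.1 mv hv₀.2.2.1
    (fun z hz => (hE z hz).2.2) (fun z hz => (hE₀ z hz).2.2) hd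
  have hj := hj₀.lin hjd s
  have hu : ∀ z ∈ strip L, (j₀.lin s jd).u z = s * (v z).1 := fun z hz => by
    simp only [Jet.lin, hu₀ z hz, hdu z hz]; ring
  have hw : ∀ z ∈ strip L, (j₀.lin s jd).w z = s * (v z).2 - 1 := fun z hz => by
    simp only [Jet.lin, hw₀ z hz, hdw z hz]; ring
  obtain ⟨px, py, gp, ex, ey⟩ := hE.normalise ha hL mv mp hj hu hw
  refine ⟨_, hj, hu, hw, _, _, gp.const_mul (s ^ 2), ex, ey, fun x y _ => by simp only [pp x y],
    fun x => ?_, fun x => ?_, fun x => ?_, ?_⟩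
  · have hz : (x, (0:ℝ)) ∈ strip L := mem_strip.2 ⟨le_rfl, hL.le⟩
    rw [hw _ hz]
    simp only [perturbedData, hw₀ _ hz]
    linear_combination -s * hbf x
  · simp only [perturbedData, hbm x]
  · have h1 := htop x
    rw [(gp.hasDerivAt_x hLm).deriv, (gp₀.hasDerivAt_x hLm).deriv] at h1
    simp only [perturbedData, ← ex₀ (x, L) (mem_strip.2 hLm)]
    rw [h1]; ring
  · simp only [perturbedData]
    rw [← hfl, fluxC, mul_neg, ← intervalIntegral.integral_const_mul]
    congr 1
    refine intervalIntegral.integral_congr fun y hy => hu (0, y) (mem_strip.2 ?_)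
    rwa [uIcc_of_le hL.le] at hy

theorem NSol.exists_sol (ha : a ∈ Ioo (0:ℝ) 1) (hL : 0 < L) (hcs : c * s = 1)
    (hj₀ : C2F L a N j₀) (hu₀ : ∀ z ∈ strip L, j₀.u z = s * (v₀ z).1)
    (hw₀ : ∀ z ∈ strip L, j₀.w z = s * (v₀ z).2 - 1) (gp₀ : Grad L p₀ px₀ py₀)
    (ex₀ : ∀ z ∈ strip L, s ^ 2 * px₀ z = momX j₀ z) (hj : C2F L a N' j)
    (h : NSol L (perturbedData L s J j₀ p₀ hm hm2 hp hp2 fm fm2) j p px py)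
    (hM : 32 * (|c| * (N' + N)) ≤ M) : ∃ v p, SolCmod L a M v₀ p₀ hm hp fm J v p := by
  have hLm : L ∈ Icc 0 L := right_mem_Icc.2 hL.le
  have hun := strip_unique hL
  have hcs2 : c ^ 2 * s ^ 2 = 1 := by rw [← mul_pow, hcs, one_pow]
  set v : ℝ × ℝ → ℝ × ℝ := fun z => (c * j.u (clamp L z), c * (1 + j.w (clamp L z))) with hv
  set P : ℝ × ℝ → ℝ := fun z => c ^ 2 * p (clamp L z) with hP
  have v1 : ∀ z ∈ strip L, (v z).1 = c * j.u z := fun z hz => by simp only [hv, clamp_eq hz]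
  have v2 : ∀ z ∈ strip L, (v z).2 = c * (1 + j.w z) := fun z hz => by simp only [hv, clamp_eq hz]
  have hPz : ∀ z ∈ strip L, P z = c ^ 2 * p z := fun z hz => by simp only [hP, clamp_eq hz]
  have v01 : ∀ z ∈ strip L, (v₀ z).1 = c * j₀.u z := fun z hz => by
    rw [hu₀ z hz, ← mul_assoc, hcs, one_mul]
  have v02 : ∀ z ∈ strip L, (v₀ z).2 = c * (1 + j₀.w z) := fun z hz => by
    rw [hw₀ z hz]; linear_combination -(v₀ z).2 * hcs
  have g1 : Grad L (c1 v) (fun z => c * j.ux z) (fun z => c * j.uy z) :=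
    (hj.c1.gu.const_mul c).congr v1 (fun _ _ => rfl) fun _ _ => rfl
  have g2 : Grad L (c2 v) (fun z => c * j.wx z) (fun z => c * -j.ux z) :=
    ((hj.c1.gw.const_mul c).add_const c).congr (fun z hz => (v2 z hz).trans (by ring))
      (fun _ _ => rfl) fun _ _ => rfl
  have gP : Grad L P (fun z => c ^ 2 * px z) (fun z => c ^ 2 * py z) :=
    (h.gp.const_mul (c ^ 2)).congr hPz (fun _ _ => rfl) fun _ _ => rfl
  have d1 : HB a (4 * (|c| * (N' + N))) (strip L) (fun z => (v z - v₀ z).1) :=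
    (((hj.g2_u.sub hj₀.g2_u).const_mul c).congr fun z hz => by
      rw [Prod.fst_sub, v1 z hz, v01 z hz]; ring).hB ha.1 hL
  have d2 : HB a (4 * (|c| * (N' + N))) (strip L) (fun z => (v z - v₀ z).2) :=
    (((hj.g2_w.sub hj₀.g2_w).const_mul c).congr fun z hz => by
      rw [Prod.snd_sub, v2 z hz, v02 z hz]; ring).hB ha.1 hL
  have m1 : HB a (4 * (|c| * N')) (strip L) (fun z => (v z).1) :=
    ((hj.g2_u.const_mul c).congr v1).hB ha.1 hL
  have m2 : HB a (4 * (|c| * N' + |c|)) (strip L) (fun z => (v z).2) := by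
    refine G2.hB ha.1 hL (fx := fun z => c * j.wx z) (fy := fun z => c * -j.ux z)
      (fxx := fun z => c * j.wxx z) (fxy := fun z => c * -j.uxx z) (fyy := fun z => c * -j.uxy z) ?_
    have g := hj.g2_w.const_mul c
    have hle : |c| * N' ≤ |c| * N' + |c| := by linarith [abs_nonneg c]
    exact ⟨g2, g.gx, g.gy, (g.h0.add (Hol.const c le_rfl)).congr fun z hz =>
      (v2 z hz).trans (by ring), g.hx.mono hle, g.hy.mono hle, g.hxx.mono hle, g.hxy.mono hle,
      g.hyy.mono hle⟩
  obtain ⟨K, pxx, pxy, pyy, hpG⟩ := h.exists_pressure_G2 ha hL hj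
  have mP : HB a (4 * (|c ^ 2| * K)) (strip L) P := ((hpG.const_mul (c ^ 2)).congr hPz).hB ha.1 hL
  have pc : ∀ x y, clamp L (x + 1, y) = ((clamp L (x, y)).1 + 1, (clamp L (x, y)).2) :=
    fun x y => rfl
  have pcl : ∀ {f : ℝ × ℝ → ℝ}, PerS L f → ∀ x y, f (clamp L (x + 1, y)) = f (clamp L (x, y)) :=
    fun hf x y => by rw [pc]; exact hf _ _ (mem_strip.1 (clamp_mem hL _))
  refine ⟨v, P, ⟨fun x y => ?_, fun x y => ?_, (m1.prodMk m2 hun).memC, mP.memC⟩, fun z hz => ?_,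
    ?_, fun x => ?_, fun x => ?_, fun x => ?_, ?_⟩
  · simp only [hv, pcl hj.c1.pu, pcl hj.c1.pw]
  · simp only [hP, pcl h.pp]
  · rw [divF, g1.pdx_eq hL hz, g1.pdy_eq hL hz, g2.pdx_eq hL hz, g2.pdy_eq hL hz, gP.pdx_eq hL hz,
      gP.pdy_eq hL hz, v1 z hz, v2 z hz, h.ex z hz, h.ey z hz]
    refine ⟨?_, ?_, ?_⟩ <;> ring
  · refine le_trans (d1.prodMk d2 hun).hNorm_le (ENNReal.ofReal_le_ofReal ?_)
    linarith
  · have hz : (x, (0:ℝ)) ∈ strip L := mem_strip.2 ⟨le_rfl, hL.le⟩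
    rw [hPz _ hz, h.botp x]
    simp only [perturbedData]
    rw [← mul_assoc, hcs2, one_mul]
  · rw [(gP.hasDerivAt_x hLm).deriv, (gp₀.hasDerivAt_x hLm).deriv, h.top x]
    simp only [perturbedData, ← ex₀ (x, L) (mem_strip.2 hLm)]
    linear_combination (px₀ (x, L) + deriv hp x) * hcs2
  · have hz : (x, (0:ℝ)) ∈ strip L := mem_strip.2 ⟨le_rfl, hL.le⟩
    rw [v2 _ hz, v02 _ hz, h.bot x]
    simp only [perturbedData]
    linear_combination fm x * hcs
  · have h1 := h.flux
    simp only [perturbedData] at h1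
    have h2 : ∫ y in (0:ℝ)..L, (v (0, y)).1 = ∫ y in (0:ℝ)..L, c * j.u (0, y) :=
      intervalIntegral.integral_congr fun y hy => v1 (0, y) (mem_strip.2
        (by rwa [uIcc_of_le hL.le] at hy))
    rw [fluxC, h2, intervalIntegral.integral_const_mul]
    linear_combination c * h1 + J * hcs

theorem abs_fluxC_le (hL : 0 < L) (h : ∀ z ∈ strip L, |(v z).1| ≤ N) : |fluxC L v| ≤ N * L := by
  rw [fluxC, abs_neg, ← Real.norm_eq_abs]
  refine (intervalIntegral.norm_integral_le_of_norm_le_const fun y hy => ?_).trans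
    (by rw [sub_zero, abs_of_pos hL])
  rw [uIoc_of_le hL.le] at hy
  exact h _ (mem_strip.2 ⟨hy.1.le, hy.2⟩)

end BoundaryValueProblem

theorem exists_smallness_constants {C δ L vb : ℝ} (hC : 0 < C) (hδ : 0 < δ) (hL : 0 < L)
    (hvb : 0 < vb) :
    ∃ B C1 M K : ℝ, B = 8 * (1 + L) ∧ B + 2 ≤ C1 ∧ 3 * B + 2 * vb⁻¹ ≤ C1 ∧ 1 + L ≤ C1 ∧
      0 < M ∧ 0 < K ∧ K * M ≤ M ∧ 32 * (C * C1 + B) * (K * M) = M ∧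
      (C1 + 2 + B) * (vb⁻¹ * M) = δ := by
  obtain ⟨B, hB⟩ : ∃ B, B = 8 * (1 + L) := ⟨_, rfl⟩
  obtain ⟨C1, hC1⟩ : ∃ C1, C1 = 3 * B + 2 + 2 * vb⁻¹ + (1 + L) := ⟨_, rfl⟩
  have hvi : 0 < vb⁻¹ := inv_pos.2 hvb
  have hB0 : 8 < B := by rw [hB]; linarith
  have hC0 : 0 < C1 := by rw [hC1]; linarith
  have hCC : 0 < C * C1 := mul_pos hC hC0
  have hS : 1 ≤ 32 * (C * C1 + B) := by linarith
  have hS0 : 0 < C1 + 2 + B := by linarith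
  have hM : 0 < δ * vb / (C1 + 2 + B) := div_pos (mul_pos hδ hvb) hS0
  refine ⟨B, C1, δ * vb / (C1 + 2 + B), (32 * (C * C1 + B))⁻¹, hB, by linarith, by linarith,
    by linarith, hM, inv_pos.2 (by linarith), mul_le_of_le_one_left hM.le (inv_le_one_of_one_le₀ hS),
    ?_, ?_⟩
  · rw [← mul_assoc, mul_inv_cancel₀ (by linarith), one_mul]
  · field_simp

theorem euler_bvp_C_solvable (L a vb : ℝ) (hL : 0 < L) (ha : a ∈ Set.Ioo (0 : ℝ) 1)
    (hvb : 0 < vb) :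
    ∃ ε > (0 : ℝ), ∃ M > (0 : ℝ), ∃ K > (0 : ℝ),
      ∀ (v₀ : ℝ × ℝ → ℝ × ℝ) (p₀ : ℝ × ℝ → ℝ),
        VP L 2 a v₀ p₀ → Euler L v₀ p₀ →
        (∀ z ∈ strip L, curlF L v₀ z = 0) →
        (∀ z ∈ strip L, vb ≤ |(v₀ z).2|) →
        hNorm 2 a (strip L) (c1 v₀) ≤ ENNReal.ofReal ε →
        ∀ (hm hp fm : ℝ → ℝ) (J : ℝ),
          BData 2 a hm → BData 2 a hp → BData 2 a fm →
          hNorm 2 a (Set.univ : Set ℝ) hm + hNorm 2 a (Set.univ : Set ℝ) hp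
              + hNorm 2 a (Set.univ : Set ℝ) fm
              + ENNReal.ofReal |J - fluxC L v₀| ≤ ENNReal.ofReal (K * M) →
          ∃ v p, SolCmod L a M v₀ p₀ hm hp fm J v p ∧
            ∀ v' p', SolCmod L a M v₀ p₀ hm hp fm J v' p' →
              Set.EqOn v v' (strip L) ∧ Set.EqOn p p' (strip L) := by
  obtain ⟨C, hC, δ, hδ, hδ4, hex, huq⟩ := exists_fixed_point ha hL
  obtain ⟨B, C1, M, K, hB, h_b, h_v, h_l, hM0, hK0, hηM, hηS, hMS⟩ :=
    exists_smallness_constants hC hδ hL hvb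
  have hvi : 0 < vb⁻¹ := inv_pos.2 hvb
  have hB0 : 8 < B := by rw [hB]; linarith
  have hC0 : 0 < C1 := by linarith
  have hη0 : 0 < K * M := mul_pos hK0 hM0
  refine ⟨K * M, hη0, M, hM0, K, hK0, fun v₀ p₀ hVP hE hcurl hlow heps hm hp fm J bm bp bf hsum => ?_⟩
  generalize K * M = η at *
  have h00 := origin_mem hL
  set c := (v₀ (0, 0)).2 with hc
  have hcv : vb ≤ |c| := hlow _ h00
  have hc0 : c ≠ 0 := fun h => by rw [h, abs_zero] at hcv; linarith
  have hcs : c * c⁻¹ = 1 := mul_inv_cancel₀ hc0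
  set s := c⁻¹ with hs
  have hcs' : |c| * |s| = 1 := by rw [← abs_mul, hcs, abs_one]
  have hs0 : 0 ≤ |s| := abs_nonneg s
  have hsv : |s| ≤ vb⁻¹ := by rw [hs, abs_inv]; exact inv_anti₀ hvb hcv
  obtain ⟨j₀, hj₀', hu₀, hw₀⟩ := exists_jet_of_irrotational ha hL hη0.le hVP.1 hVP.2.2.1
    (fun z hz => (hE z hz).2.2) hcurl heps (s := s) (by rw [mul_comm]; exact hcs)
  have hj₀ : C2F L a (B * (|s| * η)) j₀ := hj₀'.mono (by rw [hB]; linarith)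
  have hsη : |s| * η ≤ vb⁻¹ * M := mul_le_mul hsv hηM hη0.le hvi.le
  have hsη0 : 0 ≤ |s| * η := by positivity
  have hN4 : B * (|s| * η) ≤ 1 / 4 := by
    have h1 := mul_le_mul_of_nonneg_left hsη (by linarith : (0 : ℝ) ≤ B)
    have h2 : 0 < (C1 + 2) * (vb⁻¹ * M) := mul_pos (by linarith) (mul_pos hvi hM0)
    linarith
  obtain ⟨px₀, py₀, gp₀, ex₀, -⟩ := hE.normalise ha hL hVP.2.2.1 hVP.2.2.2 hj₀ hu₀ hw₀
  have hJ := (ENNReal.ofReal_le_ofReal_iff hη0.le).1 (le_add_self.trans hsum)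
  have hsum3 := le_self_add.trans hsum
  have hsum2 := le_self_add.trans hsum3
  obtain ⟨hm2, Bm⟩ := (HB.of_hNorm bm.2.1 hη0.le (le_self_add.trans hsum2)).exists_B2 ha bm.1
  obtain ⟨hp2, Bp⟩ := (HB.of_hNorm bp.2.1 hη0.le (le_add_self.trans hsum2)).exists_B2 ha bp.1
  obtain ⟨fm2, Bf⟩ := (HB.of_hNorm bf.2.1 hη0.le (le_add_self.trans hsum3)).exists_B2 ha bf.1
  have hflux : |fluxC L v₀| ≤ η * L := abs_fluxC_le hL fun z hz => by
    have := (HB.of_hNorm (ContinuousLinearMap.fst ℝ ℝ ℝ |>.contDiff.comp_contDiffOn hVP.2.2.1.1)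
      hη0.le heps).bound 0 (by norm_num) z hz
    rwa [norm_iteratedFDerivWithin_zero] at this
  have hsJ : |s * J| ≤ C1 * (|s| * η) := by
    have h1 : |J| ≤ (1 + L) * η := by
      calc |J| = |(J - fluxC L v₀) + fluxC L v₀| := by rw [sub_add_cancel]
        _ ≤ η + η * L := (abs_add_le _ _).trans (add_le_add hJ hflux)
        _ = (1 + L) * η := by ring
    rw [abs_mul]
    calc |s| * |J| ≤ |s| * ((1 + L) * η) := mul_le_mul_of_nonneg_left h1 hs0
      _ = (1 + L) * (|s| * η) := by ring
      _ ≤ C1 * (|s| * η) := mul_le_mul_of_nonneg_right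
        h_l hsη0
  have hs2 : |s ^ 2| * (2 * η) ≤ 2 * vb⁻¹ * (|s| * η) := by
    rw [abs_pow]
    have := mul_le_mul_of_nonneg_right hsv hsη0
    linarith [show |s| ^ 2 * (2 * η) = 2 * (|s| * (|s| * η)) by ring]
  have hD1 : B * (|s| * η) + |s| * (2 * η) ≤ C1 * (|s| * η) := by
    have := mul_le_mul_of_nonneg_right h_b hsη0
    linarith
  have hD2 : 3 * (B * (|s| * η)) + |s ^ 2| * (2 * η) ≤ C1 * (|s| * η) := by
    have := mul_le_mul_of_nonneg_right h_v hsη0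
    linarith
  have hb := perturbedData_good (D := C1 * (|s| * η)) hL hj₀ hN4 gp₀ ex₀ hVP.2.1 Bm Bp Bf
    hD1 hD2 hsJ
  have hvM : 0 < vb⁻¹ * M := mul_pos hvi hM0
  have hDδ : C1 * (|s| * η) ≤ δ := by
    have h1 := mul_le_mul_of_nonneg_left hsη hC0.le
    have h2 : 0 < (2 + B) * (vb⁻¹ * M) := mul_pos (by linarith) hvM
    linarith
  have hMδ : B * (|s| * η) + |s| * (2 * M) ≤ δ := by
    have h1 := mul_le_mul_of_nonneg_right hsv hM0.le
    have h2 := mul_le_mul_of_nonneg_left hsη (by linarith : (0 : ℝ) ≤ B)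
    have h3 := mul_pos hC0 hvM
    linarith
  obtain ⟨j, X, hst, hj⟩ := hex _ _ hb hDδ
  obtain ⟨q, qx, qy, hq⟩ := hst.nsol hL hb (hDδ.trans hδ4) hj
  obtain ⟨v, p, hvp⟩ := hq.exists_sol (M := M) ha hL hcs hj₀ hu₀ hw₀ gp₀ ex₀ hj (by
    have : |c| * (C * (C1 * (|s| * η)) + B * (|s| * η)) = |c| * |s| * ((C * C1 + B) * η) := by ring
    rw [this, hcs', one_mul]
    linarith)
  refine ⟨v, p, hvp, fun v' p' hvp' => ?_⟩
  obtain ⟨j₁, hj₁, hu₁, hw₁, _, _, n₁⟩ := hvp.exists_nsol (hm2 := hm2) (hp2 := hp2) (fm2 := fm2)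
    ha hL hM0.le hVP hE hj₀ hu₀ hw₀ gp₀ ex₀
  obtain ⟨j₂, hj₂, hu₂, hw₂, _, _, n₂⟩ := hvp'.exists_nsol (hm2 := hm2) (hp2 := hp2) (fm2 := fm2)
    ha hL hM0.le hVP hE hj₀ hu₀ hw₀ gp₀ ex₀
  obtain ⟨X₁, s₁⟩ := n₁.step ha.1 hL hb (hDδ.trans hδ4) (hMδ.trans hδ4) hj₁
  obtain ⟨X₂, s₂⟩ := n₂.step ha.1 hL hb (hDδ.trans hδ4) (hMδ.trans hδ4) hj₂
  have he := huq _ _ _ _ _ _ _ hb hDδ hMδ hj₁ hj₂ s₁ s₂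
  have hsne : s ≠ 0 := inv_ne_zero hc0
  refine ⟨fun z hz => Prod.ext ?_ ?_, fun z hz => ?_⟩
  · have := (he z hz).1
    rw [hu₁ z hz, hu₂ z hz] at this
    exact mul_left_cancel₀ hsne this
  · have := (he z hz).2
    rw [hw₁ z hz, hw₂ z hz] at this
    exact mul_left_cancel₀ hsne (sub_left_injective this)
  · exact mul_left_cancel₀ (pow_ne_zero 2 hsne) (n₁.pressure_unique hL hj₁ hj₂ n₂ he z hz)
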